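/- Let X₁,…,Xₙ be independent points uniformly distributed in the unit square [0,1]², let P = {X₁,…,Xₙ}, and let N₁(n) be the number of order-1 Delaunay triangulations of P. Then liminf_{n→∞} (log₂ E[N₁(n)])/n ≥ ρ₁, where ρ₁ = (c₁ + 2c₂)/2 ≈ 0.525785, with c₁ = ∫₀^∞ ∫ₐ^∞ ∫ₐ^∞ 8πa · (2ac/√(c²−a²) − 2c·arcsin(a/c)) · (2ab/√(b²−a²) − 2b·arcsin(a/b)) · exp(−πb² + b²·arcsin(a/b) − a√(b²−a²) − πc² + c²·arcsin(a/c) − a√(c²−a²)) db dc da and c₂ = ∫₀^∞ ∫ₐ^∞ ∫_c^∞ 8πa · (2πc − 2c·arcsin(a/c) + 2ac/√(c²−a²)) · (2ab/√(b²−a²) − 2b·arcsin(a/b)) · exp(−πb² + b²·arcsin(a/b) − a√(b²−a²) − c²·arcsin(a/c) + a√(c²−a²)) db dc da. -/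

import Mathlib

open EuclideanGeometry Set

noncomputable section

/-- Points of the Euclidean plane. -/
abbrev Pt : Type := EuclideanSpace ℝ (Fin 2)

noncomputable instance : DecidableEq Pt := Classical.decEq _

/-- `P` is in general position: no three (distinct) points collinear and
no four (distinct) points concyclic. -/
def GenPos (P : Set Pt) : Prop :=
  (∀ u v w : Pt, u ∈ P → v ∈ P → w ∈ P → u ≠ v → u ≠ w → v ≠ w →
    ¬ Collinear ℝ ({u, v, w} : Set Pt)) ∧
  (∀ u v w z : Pt, u ∈ P → v ∈ P → w ∈ P → z ∈ P →
    u ≠ v → u ≠ w → u ≠ z → v ≠ w → v ≠ z → w ≠ z →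
    ¬ EuclideanGeometry.Cospherical ({u, v, w, z} : Set Pt))

/-- The (closed) triangle spanned by a finite set of points. -/
def triSet (t : Finset Pt) : Set Pt := convexHull ℝ (t : Set Pt)

/-- `T` is a triangulation of `P`: a finite set of triangles with vertices in `P`,
every point of `P` is a vertex of some triangle, the interiors of the triangles are
pairwise disjoint, and their union is the convex hull of `P`. -/
def IsTriangulation (P : Set Pt) (T : Set (Finset Pt)) : Prop :=
  T.Finite ∧
  (∀ t ∈ T, t.card = 3 ∧ (t : Set Pt) ⊆ P) ∧
  (∀ p ∈ P, ∃ t ∈ T, p ∈ t) ∧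
  (T.Pairwise fun t s => interior (triSet t) ∩ interior (triSet s) = ∅) ∧
  (⋃ t ∈ T, triSet t) = convexHull ℝ P

/-- The triangle `t` (with vertex set `t`) is order-`k` Delaunay with respect to `P`:
the open disk bounded by its circumcircle contains at most `k` points of `P`. -/
def OrderKTri (P : Set Pt) (k : ℕ) (t : Finset Pt) : Prop :=
  ∃ z : Pt, ∃ r : ℝ, (∀ p ∈ t, dist p z = r) ∧ {p ∈ P | dist p z < r}.encard ≤ (k : ℕ∞)

/-- `T` is an order-`k` Delaunay triangulation of `P`. -/
def IsOrderDT (P : Set Pt) (k : ℕ) (T : Set (Finset Pt)) : Prop :=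
  IsTriangulation P T ∧ ∀ t ∈ T, OrderKTri P k t

/-- `{u, v}` is an order-`k` Delaunay edge of `P`: some open disk having `u` and `v`
on its boundary circle contains at most `k` points of `P`. -/
def OrderKEdge (P : Set Pt) (k : ℕ) (u v : Pt) : Prop :=
  ∃ z : Pt, ∃ r : ℝ, dist u z = r ∧ dist v z = r ∧ {p ∈ P | dist p z < r}.encard ≤ (k : ℕ∞)

/-- `{u, v}` is a useful order-`k` Delaunay edge of `P`: some order-`k` Delaunay
triangulation of `P` contains a triangle having `u` and `v` among its vertices
(i.e. having segment `uv` as a side). -/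
def UsefulEdge (P : Set Pt) (k : ℕ) (u v : Pt) : Prop :=
  ∃ T, IsOrderDT P k T ∧ ∃ t ∈ T, u ∈ t ∧ v ∈ t

/-- `{u, v}` is a Delaunay edge: it is an edge of the (unique) order-0 Delaunay
triangulation of `P`. -/
def DelaunayEdge (P : Set Pt) (u v : Pt) : Prop := UsefulEdge P 0 u v

/-- `p` lies strictly to the left of the directed line from `v` to `u`, i.e. the
triple `v, u, p` makes a counterclockwise turn. -/
def ccw (v u p : Pt) : Prop :=
  0 < (u 0 - v 0) * (p 1 - v 1) - (u 1 - v 1) * (p 0 - v 0)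


section Probability

open MeasureTheory Filter Real

/-- The unit square `[0,1]²`. -/
def unitSq : Set Pt := {p : Pt | p 0 ∈ Set.Icc (0 : ℝ) 1 ∧ p 1 ∈ Set.Icc (0 : ℝ) 1}

/-- The uniform (probability) distribution on the unit square. -/
noncomputable def unifSq : Measure Pt := volume.restrict unitSq

/-- The law of `n` independent points, each uniform in the unit square: the product
measure on configurations `Fin n → Pt`. -/
noncomputable def conf (n : ℕ) : Measure (Fin n → Pt) := Measure.pi fun _ => unifSq

/-- The constant `c₁ ≈ 0.23807`. -/
noncomputable def c1 : ℝ :=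
  ∫ a in Set.Ioi (0 : ℝ), ∫ c in Set.Ioi a, ∫ b in Set.Ioi a,
    8 * π * a *
      (2 * a * c / Real.sqrt (c ^ 2 - a ^ 2) - 2 * c * Real.arcsin (a / c)) *
      (2 * a * b / Real.sqrt (b ^ 2 - a ^ 2) - 2 * b * Real.arcsin (a / b)) *
      Real.exp (-π * b ^ 2 + b ^ 2 * Real.arcsin (a / b) - a * Real.sqrt (b ^ 2 - a ^ 2)
        - π * c ^ 2 + c ^ 2 * Real.arcsin (a / c) - a * Real.sqrt (c ^ 2 - a ^ 2))

/-- The constant `c₂ ≈ 0.40675`. -/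
noncomputable def c2 : ℝ :=
  ∫ a in Set.Ioi (0 : ℝ), ∫ c in Set.Ioi a, ∫ b in Set.Ioi c,
    8 * π * a *
      (2 * π * c - 2 * c * Real.arcsin (a / c) + 2 * a * c / Real.sqrt (c ^ 2 - a ^ 2)) *
      (2 * a * b / Real.sqrt (b ^ 2 - a ^ 2) - 2 * b * Real.arcsin (a / b)) *
      Real.exp (-π * b ^ 2 + b ^ 2 * Real.arcsin (a / b) - a * Real.sqrt (b ^ 2 - a ^ 2)
        - c ^ 2 * Real.arcsin (a / c) + a * Real.sqrt (c ^ 2 - a ^ 2))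

end Probability

section

open MeasureTheory

theorem Pt.ext' {p q : Pt} (h0 : p 0 = q 0) (h1 : p 1 = q 1) : p = q := by
  ext i; fin_cases i <;> assumption

/-- Twice the signed area of the triangle `u v w`. -/
def crs (u v w : Pt) : ℝ := (v 0 - u 0) * (w 1 - u 1) - (v 1 - u 1) * (w 0 - u 0)

/-- The power of `p` with respect to the circle with centre `z` and squared radius `k`. -/
def pw (z : Pt) (k : ℝ) (p : Pt) : ℝ := (p 0 - z 0) ^ 2 + (p 1 - z 1) ^ 2 - k

/-- No three points collinear and no four concyclic, in coordinates. -/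
structure GP (P : Set Pt) : Prop where
  col : ∀ u ∈ P, ∀ v ∈ P, ∀ w ∈ P, u ≠ v → u ≠ w → v ≠ w → crs u v w ≠ 0
  cir : ∀ u ∈ P, ∀ v ∈ P, ∀ w ∈ P, ∀ y ∈ P, u ≠ v → u ≠ w → u ≠ y → v ≠ w → v ≠ y → w ≠ y →
    ∀ z k, pw z k u = 0 → pw z k v = 0 → pw z k w = 0 → pw z k y = 0 → False

theorem GP.mono {P Q : Set Pt} (h : GP P) (hQ : Q ⊆ P) : GP Q where
  col u hu v hv w hw := h.col u (hQ hu) v (hQ hv) w (hQ hw)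
  cir u hu v hv w hw y hy := h.cir u (hQ hu) v (hQ hv) w (hQ hw) y (hQ hy)

theorem dist_sq_eq (p z : Pt) : dist p z ^ 2 = (p 0 - z 0) ^ 2 + (p 1 - z 1) ^ 2 := by
  rw [EuclideanSpace.dist_sq_eq]; simp [Real.dist_eq, sq_abs]

theorem pw_eq (z : Pt) (k : ℝ) (p : Pt) : pw z k p = dist p z ^ 2 - k := by
  rw [dist_sq_eq, pw]

theorem mem_triSet {u v w p : Pt} : p ∈ triSet {u, v, w} ↔ ∃ a b c : ℝ, 0 ≤ a ∧ 0 ≤ b ∧ 0 ≤ c ∧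
    a + b + c = 1 ∧ p 0 = a * u 0 + b * v 0 + c * w 0 ∧ p 1 = a * u 1 + b * v 1 + c * w 1 := by
  rw [triSet, Finset.coe_insert, Finset.coe_pair, convexHull_insert (by simp), convexHull_pair]
  simp only [mem_convexJoin, mem_singleton_iff, exists_eq_left, segment, mem_ofPred_eq]
  constructor
  · rintro ⟨q, ⟨a, b, ha, hb, hab, rfl⟩, c, d, hc, hd, hcd, rfl⟩
    refine ⟨c, d * a, d * b, hc, by positivity, by positivity, ?_, ?_, ?_⟩
    · linear_combination hcd + d * hab
    all_goals simp; ring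
  · rintro ⟨a, b, c, ha, hb, hc, habc, h0, h1⟩
    by_cases hbc : b + c = 0
    · have hb0 : b = 0 := by linarith
      have hc0 : c = 0 := by linarith
      refine ⟨v, ⟨1, 0, by simp⟩, 1, 0, by simp, by simp, by simp, ?_⟩
      have : a = 1 := by linarith
      subst hb0 hc0 this
      apply Pt.ext' <;> simp [h0, h1]
    · have : 0 < b + c := lt_of_le_of_ne (by positivity) (Ne.symm hbc)
      refine ⟨(b / (b + c)) • v + (c / (b + c)) • w, ⟨b / (b + c), c / (b + c), by positivity,
        by positivity, by field_simp, rfl⟩, a, b + c, ha, this.le, by linarith, ?_⟩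
      apply Pt.ext'
      · simp [h0]; field_simp
        ring
      · simp [h1]; field_simp
        ring

/-- Differences of power functions are affine. -/
theorem pw_sub_comb (z z' : Pt) (k k' : ℝ) {u v w p : Pt} {a b c : ℝ} (h : a + b + c = 1)
    (h0 : p 0 = a * u 0 + b * v 0 + c * w 0) (h1 : p 1 = a * u 1 + b * v 1 + c * w 1) :
    pw z k p - pw z' k' p = a * (pw z k u - pw z' k' u) + b * (pw z k v - pw z' k' v)
      + c * (pw z k w - pw z' k' w) := by
  simp only [pw, h0, h1]
  linear_combination (z 0 ^ 2 + z 1 ^ 2 - z' 0 ^ 2 - z' 1 ^ 2 - k + k') * (-h)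

/-- Three non-collinear points lie on a circle. -/
theorem exists_circle {u v w : Pt} (h : crs u v w ≠ 0) :
    ∃ z k, pw z k u = 0 ∧ pw z k v = 0 ∧ pw z k w = 0 := by
  have h' : (v 0 - u 0) * (w 1 - u 1) - (v 1 - u 1) * (w 0 - u 0) ≠ 0 := h
  obtain ⟨D, hD⟩ : ∃ D, D = (v 0 - u 0) * (w 1 - u 1) - (v 1 - u 1) * (w 0 - u 0) := ⟨_, rfl⟩
  rw [← hD] at h'
  obtain ⟨e, he⟩ : ∃ e, e = ((v 0 - u 0) ^ 2 + (v 1 - u 1) ^ 2) / 2 := ⟨_, rfl⟩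
  obtain ⟨f, hf⟩ : ∃ f, f = ((w 0 - u 0) ^ 2 + (w 1 - u 1) ^ 2) / 2 := ⟨_, rfl⟩
  obtain ⟨X, hX⟩ : ∃ X, X = (e * (w 1 - u 1) - f * (v 1 - u 1)) / D := ⟨_, rfl⟩
  obtain ⟨Y, hY⟩ : ∃ Y, Y = (f * (v 0 - u 0) - e * (w 0 - u 0)) / D := ⟨_, rfl⟩
  have e1 : X * (v 0 - u 0) + Y * (v 1 - u 1) = e := by
    rw [hX, hY]; field_simp; rw [hD]; ring
  have e2 : X * (w 0 - u 0) + Y * (w 1 - u 1) = f := by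
    rw [hX, hY]; field_simp; rw [hD]; ring
  refine ⟨!₂[u 0 + X, u 1 + Y], X ^ 2 + Y ^ 2, ?_, ?_, ?_⟩ <;> simp [pw]
  · linear_combination -2 * e1 - 2 * he
  · linear_combination -2 * e2 - 2 * hf

/-- Barycentric coordinates. -/
theorem exists_bary {u v w : Pt} (h : crs u v w ≠ 0) (p : Pt) : ∃ a b c : ℝ, a + b + c = 1 ∧
    p 0 = a * u 0 + b * v 0 + c * w 0 ∧ p 1 = a * u 1 + b * v 1 + c * w 1 := by
  refine ⟨crs p v w / crs u v w, crs u p w / crs u v w, crs u v p / crs u v w, ?_, ?_, ?_⟩ <;>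
  field_simp <;> simp only [crs] <;> ring

theorem crs_comb (q r : Pt) {u v w p : Pt} {a b c : ℝ} (h : a + b + c = 1)
    (h0 : p 0 = a * u 0 + b * v 0 + c * w 0) (h1 : p 1 = a * u 1 + b * v 1 + c * w 1) :
    crs q r p = a * crs q r u + b * crs q r v + c * crs q r w := by
  simp only [crs, h0, h1]
  linear_combination ((r 0 - q 0) * q 1 - (r 1 - q 1) * q 0) * h

theorem crs_swap (u v w : Pt) : crs v u w = - crs u v w := by simp only [crs]; ring
@[simp] theorem crs_left (u v : Pt) : crs u v u = 0 := by simp only [crs]; ring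
@[simp] theorem crs_right (u v : Pt) : crs u v v = 0 := by simp only [crs]; ring

theorem volume_line (A B C : ℝ) (h : B ≠ 0 ∨ C ≠ 0) :
    volume {p : Pt | A + B * p 0 + C * p 1 = 0} = 0 := by
  let S : AffineSubspace ℝ Pt :=
    { carrier := {p | A + B * p 0 + C * p 1 = 0}
      smul_vsub_vadd_mem' := by
        intro c p q r hp hq hr
        simp only [mem_ofPred_eq] at *
        simp
        linear_combination c * hp - c * hq + hr }
  have : S ≠ ⊤ := by
    intro hS
    have key : ∀ p : Pt, A + B * p 0 + C * p 1 = 0 := fun p ↦ by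
      have : p ∈ S := by rw [hS]; trivial
      exact this
    have h1 := key 0
    have h2 := key !₂[B, C]
    simp at h1 h2
    have : B ^ 2 + C ^ 2 = 0 := by linarith
    rcases h with h | h <;> nlinarith [sq_nonneg B, sq_nonneg C, sq_pos_of_ne_zero h]
  exact Measure.addHaar_affineSubspace volume S this

theorem volume_crs {u v : Pt} (h : u ≠ v) : volume {p : Pt | crs u v p = 0} = 0 := by
  have := volume_line ((v 1 - u 1) * u 0 - (v 0 - u 0) * u 1) (-(v 1 - u 1)) (v 0 - u 0) ?_
  · convert this using 2
    ext p
    simp only [crs, mem_ofPred_eq]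
    constructor <;> intro h <;> linarith
  · by_contra! hh
    exact h (Pt.ext' (by linarith) (by linarith))

theorem isClosed_triSet (t : Finset Pt) : IsClosed (triSet t) :=
  (t.finite_toSet.isCompact_convexHull (𝕜 := ℝ)).isClosed

/-- A triangle lies in any half plane containing its vertices. -/
theorem triSet_pw_sub_le {t : Finset Pt} {z z' : Pt} {k k' : ℝ}
    (h : ∀ p ∈ t, pw z k p - pw z' k' p ≤ 0) {p : Pt} (hp : p ∈ triSet t) :
    pw z k p - pw z' k' p ≤ 0 := by
  have hc : Convex ℝ {p : Pt | pw z k p - pw z' k' p ≤ 0} := by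
    intro x hx y hy a b ha hb hab
    simp only [mem_ofPred_eq] at *
    have := pw_sub_comb z z' k k' (u := x) (v := y) (w := y) (p := a • x + b • y)
      (a := a) (b := b) (c := 0) (by linarith) (by simp) (by simp)
    rw [this]; nlinarith
  exact convexHull_min (s := (t : Set Pt)) (fun p hp ↦ h p hp) hc hp

/-- Two convex sets meeting in a null set have disjoint interiors. -/
theorem interior_inter_eq_empty {A B : Set Pt} (h : volume (A ∩ B) = 0) :
    interior A ∩ interior B = ∅ := by
  rw [← interior_inter]
  exact isOpen_interior.eq_empty_of_measure_zero (measure_mono_null interior_subset h)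

/-- The Delaunay triangles of `P`. -/
def Del (P : Set Pt) : Set (Finset Pt) := {t | t.card = 3 ∧ (t : Set Pt) ⊆ P ∧
  ∃ z k, (∀ p ∈ t, pw z k p = 0) ∧ ∀ p ∈ P, 0 ≤ pw z k p}

theorem pw_sub_eq (z z' : Pt) (k k' : ℝ) (p : Pt) : pw z k p - pw z' k' p =
    (z 0 ^ 2 + z 1 ^ 2 - k - (z' 0 ^ 2 + z' 1 ^ 2 - k')) + 2 * (z' 0 - z 0) * p 0
      + 2 * (z' 1 - z 1) * p 1 := by
  simp only [pw]; ring

theorem volume_pw_sub {z z' : Pt} (k k' : ℝ) (h : z ≠ z') :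
    volume {p : Pt | pw z k p - pw z' k' p = 0} = 0 := by
  simp only [pw_sub_eq]
  apply volume_line
  by_contra! hh
  exact h (Pt.ext' (by linarith) (by linarith))

/-- Three vertices determine a circle that contains no further point. -/
theorem GP.eq_of_circle {P : Set Pt} (hP : GP P) {t s : Finset Pt} (ht : t.card = 3)
    (hs : s.card = 3) (htP : (t : Set Pt) ⊆ P) (hsP : (s : Set Pt) ⊆ P) {z : Pt} {k : ℝ}
    (h : ∀ p ∈ t, pw z k p = 0) (h' : ∀ p ∈ s, pw z k p = 0) : t = s := by
  by_contra hne
  have : ¬ s ⊆ t := fun hst ↦ hne (Finset.eq_of_subset_of_card_le hst (by omega)).symm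
  obtain ⟨q, hqs, hqt⟩ := Finset.not_subset.1 this
  obtain ⟨u, v, w, huv, huw, hvw, rfl⟩ := Finset.card_eq_three.1 ht
  simp only [Finset.mem_insert, Finset.mem_singleton, not_or] at hqt h
  refine hP.cir u (htP (by simp)) v (htP (by simp)) w (htP (by simp)) q (hsP hqs) huv huw
    (Ne.symm hqt.1) hvw (Ne.symm hqt.2.1) (Ne.symm hqt.2.2) z k ?_ ?_ ?_ (h' q hqs) <;>
  apply h <;> simp

theorem Del.volume_inter {P : Set Pt} (hP : GP P) {t s : Finset Pt} (ht : t ∈ Del P)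
    (hs : s ∈ Del P) (hne : t ≠ s) : volume (triSet t ∩ triSet s) = 0 := by
  obtain ⟨ht3, htP, z, k, ht0, htn⟩ := ht
  obtain ⟨hs3, hsP, z', k', hs0, hsn⟩ := hs
  have h1 : ∀ p ∈ t, pw z k p - pw z' k' p ≤ 0 := fun p hp ↦ by
    rw [ht0 p hp]; linarith [hsn p (htP hp)]
  have h2 : ∀ p ∈ s, pw z' k' p - pw z k p ≤ 0 := fun p hp ↦ by
    rw [hs0 p hp]; linarith [htn p (hsP hp)]
  by_cases hz : z = z'
  · exfalso
    subst hz
    obtain ⟨p, hp⟩ : t.Nonempty := by rw [← Finset.card_pos]; omega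
    obtain ⟨q, hq⟩ : s.Nonempty := by rw [← Finset.card_pos]; omega
    have a1 := h1 p hp
    have a2 := h2 q hq
    simp only [pw] at a1 a2
    have : k = k' := by linarith
    subst this
    exact hne (hP.eq_of_circle ht3 hs3 htP hsP ht0 hs0)
  · refine measure_mono_null ?_ (volume_pw_sub k k' hz)
    rintro p ⟨hpt, hps⟩
    have := triSet_pw_sub_le h1 hpt
    have := triSet_pw_sub_le h2 hps
    simp only [mem_ofPred_eq]; linarith

theorem crs_perm_ne {u v w : Pt} (h : crs u v w ≠ 0) : u ≠ v ∧ u ≠ w ∧ v ≠ w := by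
  refine ⟨?_, ?_, ?_⟩ <;> rintro rfl <;> apply h <;> simp only [crs] <;> ring

/-- The exchange step: replace a vertex of a triangle around `x` by `q`. -/
theorem exists_exchange {u v w x q : Pt} (h : crs u v w ≠ 0) (hx : x ∈ triSet {u, v, w})
    (hu : crs v w x ≠ 0) (hv : crs u w x ≠ 0) (hw : crs u v x ≠ 0) :
    ∃ u' v' w' : Pt, ({u', v', w'} : Finset Pt) = {u, v, w} ∧ ∃ a b c : ℝ, 0 < a ∧ 0 ≤ b ∧ 0 ≤ c ∧
      a + b + c = 1 ∧ x 0 = a * q 0 + b * v' 0 + c * w' 0 ∧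
      x 1 = a * q 1 + b * v' 1 + c * w' 1 := by
  obtain ⟨a, b, c, ha, hb, hc, habc, h0, h1⟩ := mem_triSet.1 hx
  have ha' : 0 < a := lt_of_le_of_ne ha (by
    rintro rfl; apply hu; rw [crs_comb _ _ habc h0 h1]; simp)
  have hb' : 0 < b := lt_of_le_of_ne hb (by
    rintro rfl; apply hv; rw [crs_comb _ _ habc h0 h1]; simp)
  have hc' : 0 < c := lt_of_le_of_ne hc (by
    rintro rfl; apply hw; rw [crs_comb _ _ habc h0 h1]; simp)
  obtain ⟨a', b', c', hsum, q0, q1⟩ := exists_bary h q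
  have main : ∀ u v w : Pt, ∀ a b c a' b' c' : ℝ, 0 < a → 0 < b → 0 < c → a + b + c = 1 →
      a' + b' + c' = 1 → x 0 = a * u 0 + b * v 0 + c * w 0 → x 1 = a * u 1 + b * v 1 + c * w 1 →
      q 0 = a' * u 0 + b' * v 0 + c' * w 0 → q 1 = a' * u 1 + b' * v 1 + c' * w 1 →
      0 < a' → b' * a ≤ b * a' → c' * a ≤ c * a' → ∃ a b c : ℝ, 0 < a ∧ 0 ≤ b ∧ 0 ≤ c ∧
      a + b + c = 1 ∧ x 0 = a * q 0 + b * v 0 + c * w 0 ∧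
      x 1 = a * q 1 + b * v 1 + c * w 1 := by
    intro u v w a b c a' b' c' ha hb hc hs hs' x0 x1 q0 q1 ha' hb' hc'
    refine ⟨a / a', b - b' * (a / a'), c - c' * (a / a'), by positivity, ?_, ?_, ?_, ?_, ?_⟩
    · rw [sub_nonneg, ← mul_div_assoc, div_le_iff₀ ha']; exact hb'
    · rw [sub_nonneg, ← mul_div_assoc, div_le_iff₀ ha']; exact hc'
    · field_simp; linear_combination a' * hs - a * hs'
    · rw [x0, q0]; field_simp; ring
    · rw [x1, q1]; field_simp; ring
  have key : (0 < a' ∧ b' * a ≤ b * a' ∧ c' * a ≤ c * a') ∨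
      (0 < b' ∧ a' * b ≤ a * b' ∧ c' * b ≤ c * b') ∨
      (0 < c' ∧ a' * c ≤ a * c' ∧ b' * c ≤ b * c') := by
    have e : ∀ {r s : ℝ} (s' r' : ℝ), 0 < r → 0 < s → (s' / s ≤ r' / r ↔ s' * r ≤ s * r') := by
      intro r s s' r' hr hs
      rw [div_le_div_iff₀ hs hr, mul_comm s r']
    have pos : ∀ {r s t r' s' t' : ℝ}, 0 < r → 0 < s → 0 < t → r' + s' + t' = 1 →
        s' / s ≤ r' / r → t' / t ≤ r' / r → 0 < r' := by
      intro r s t r' s' t' hr hs ht hsum h1 h2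
      by_contra! hneg
      have h3 : r' / r ≤ 0 := div_nonpos_of_nonpos_of_nonneg hneg hr.le
      have h4 : s' ≤ 0 := by
        by_contra! h; have := div_pos h hs; linarith
      have h5 : t' ≤ 0 := by
        by_contra! h; have := div_pos h ht; linarith
      linarith
    rcases le_total (b' / b) (a' / a) with h1 | h1 <;>
      rcases le_total (c' / c) (a' / a) with h2 | h2
      <;> rcases le_total (c' / c) (b' / b) with h3 | h3
    · left; exact ⟨pos ha' hb' hc' hsum h1 h2, (e _ _ ha' hb').1 h1, (e _ _ ha' hc').1 h2⟩
    · left; exact ⟨pos ha' hb' hc' hsum h1 h2, (e _ _ ha' hb').1 h1, (e _ _ ha' hc').1 h2⟩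
    · right; right
      have h1 := h1.trans h2
      exact ⟨pos hc' ha' hb' (by linarith) h2 h1, (e _ _ hc' ha').1 h2, (e _ _ hc' hb').1 h1⟩
    · right; right
      exact ⟨pos hc' ha' hb' (by linarith) h2 h3, (e _ _ hc' ha').1 h2, (e _ _ hc' hb').1 h3⟩
    · right; left
      exact ⟨pos hb' ha' hc' (by linarith) h1 h3, (e _ _ hb' ha').1 h1, (e _ _ hb' hc').1 h3⟩
    · right; left
      have h3 := h2.trans h1
      exact ⟨pos hb' ha' hc' (by linarith) h1 h3, (e _ _ hb' ha').1 h1, (e _ _ hb' hc').1 h3⟩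
    · right; left
      exact ⟨pos hb' ha' hc' (by linarith) h1 h3, (e _ _ hb' ha').1 h1, (e _ _ hb' hc').1 h3⟩
    · right; right
      exact ⟨pos hc' ha' hb' (by linarith) h2 h3, (e _ _ hc' ha').1 h2, (e _ _ hc' hb').1 h3⟩
  rcases key with ⟨h2, h3, h4⟩ | ⟨h2, h3, h4⟩ | ⟨h2, h3, h4⟩
  · exact ⟨u, v, w, rfl, main u v w a b c a' b' c' ha' hb' hc' habc hsum h0 h1 q0 q1 h2 h3 h4⟩
  · refine ⟨v, u, w, by ext; simp; tauto, main v u w b a c b' a' c' hb' ha' hc' (by linarith)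
      (by linarith) (by linarith) (by linarith) (by linarith) (by linarith) h2 h3 h4⟩
  · refine ⟨w, u, v, by ext; simp; tauto, main w u v c a b c' a' b' hc' ha' hb' (by linarith)
      (by linarith) (by linarith) (by linarith) (by linarith) (by linarith) h2 h3 h4⟩

theorem pair_mem_line {p q x : Pt} (h : x ∈ convexHull ℝ ({p, q} : Set Pt)) : crs p q x = 0 := by
  rw [convexHull_pair] at h
  obtain ⟨a, b, -, -, hab, rfl⟩ := h
  rw [crs_comb p q (u := p) (v := q) (w := q) (a := a) (b := b) (c := 0) (by linarith)
    (by simp) (by simp)]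
  simp

theorem exists_triangle {P : Finset Pt} (hP3 : 3 ≤ P.card) {x : Pt}
    (hx : x ∈ convexHull ℝ (P : Set Pt)) (hgen : ∀ p ∈ P, ∀ q ∈ P, p ≠ q → crs p q x ≠ 0) :
    ∃ t ∈ P.powersetCard 3, x ∈ triSet t := by
  rw [convexHull_eq_union] at hx
  simp only [mem_iUnion] at hx
  obtain ⟨t, htP, hind, hxt⟩ := hx
  have hcard : t.card ≤ 3 := by
    have := hind.card_le_finrank_succ
    simp only [Fintype.card_coe] at this
    have h2 : Module.finrank ℝ (vectorSpan ℝ (range ((↑) : t → Pt))) ≤ Module.finrank ℝ Pt :=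
      Submodule.finrank_le _
    simp at h2
    omega
  have hne : ∀ s : Finset Pt, s ⊆ P → s.card = 2 → x ∉ convexHull ℝ (s : Set Pt) := by
    intro s hs h2 hxs
    obtain ⟨p, q, hpq, rfl⟩ := Finset.card_eq_two.1 h2
    refine hgen p (hs (by simp)) q (hs (by simp)) hpq (pair_mem_line ?_)
    simpa using hxs
  have h3 : t.card = 3 := by
    by_contra hlt
    have hlt : t.card ≤ 2 := by omega
    obtain ⟨s, hts, hsP, hs⟩ := Finset.exists_subsuperset_card_eq (s := t) (t := P)
      (by exact_mod_cast htP) hlt (by omega)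
    exact hne s hsP hs (convexHull_mono (by exact_mod_cast hts) hxt)
  exact ⟨t, Finset.mem_powersetCard.2 ⟨by exact_mod_cast htP, h3⟩, hxt⟩

/-- A generic point of the hull lies in a Delaunay triangle. -/
theorem Del.exists_mem {P : Finset Pt} (hP : GP P) (hP3 : 3 ≤ P.card) {x : Pt}
    (hx : x ∈ convexHull ℝ (P : Set Pt)) (hgen : ∀ p ∈ P, ∀ q ∈ P, p ≠ q → crs p q x ≠ 0) :
    ∃ t ∈ Del P, x ∈ triSet t := by
  classical
  have hcirc : ∀ t : Finset Pt, t ∈ P.powersetCard 3 → ∃ c : Pt × ℝ, ∀ p ∈ t, pw c.1 c.2 p = 0 := by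
    intro t ht
    rw [Finset.mem_powersetCard] at ht
    obtain ⟨u, v, w, huv, huw, hvw, rfl⟩ := Finset.card_eq_three.1 ht.2
    obtain ⟨z, k, h1, h2, h3⟩ := exists_circle (hP.col u (ht.1 (by simp)) v (ht.1 (by simp)) w
      (ht.1 (by simp)) huv huw hvw)
    exact ⟨(z, k), by simp [h1, h2, h3]⟩
  choose! C hC using hcirc
  obtain ⟨t₀, ht₀, hxt₀⟩ := exists_triangle hP3 hx hgen
  obtain ⟨t, ht, hmax⟩ := Finset.exists_max_image ((P.powersetCard 3).filter (x ∈ triSet ·))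
    (fun t ↦ pw (C t).1 (C t).2 x) ⟨t₀, Finset.mem_filter.2 ⟨ht₀, hxt₀⟩⟩
  rw [Finset.mem_filter] at ht
  obtain ⟨htP, hxt⟩ := ht
  have htP' := Finset.mem_powersetCard.1 htP
  refine ⟨t, ⟨htP'.2, by exact_mod_cast htP'.1, (C t).1, (C t).2, hC t htP, ?_⟩, hxt⟩
  intro q hq
  by_contra! hneg
  have hqt : q ∉ t := fun h ↦ by rw [hC t htP q h] at hneg; exact lt_irrefl _ hneg
  obtain ⟨u, v, w, huv, huw, hvw, rfl⟩ := Finset.card_eq_three.1 htP'.2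
  have hu : u ∈ P := htP'.1 (by simp)
  have hv : v ∈ P := htP'.1 (by simp)
  have hw : w ∈ P := htP'.1 (by simp)
  obtain ⟨u', v', w', heq, a, b, c, ha, hb, hc, habc, h0, h1⟩ := exists_exchange (q := q)
    (hP.col u hu v hv w hw huv huw hvw) hxt (hgen v hv w hw hvw) (hgen u hu w hw huw)
    (hgen u hu v hv huv)
  rw [← heq] at hmax htP hxt htP' hneg hqt
  have hv'w' : v' ≠ w' := by
    rintro rfl
    have := htP'.2
    rw [Finset.insert_eq_of_mem (a := v') (s := {v'}) (by simp)] at this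
    have := Finset.card_le_two (a := u') (b := v')
    omega
  simp only [Finset.mem_insert, Finset.mem_singleton, not_or] at hqt
  have hs : ({q, v', w'} : Finset Pt) ∈ P.powersetCard 3 := by
    rw [Finset.mem_powersetCard]
    refine ⟨?_, ?_⟩
    · intro y hy
      simp only [Finset.mem_insert, Finset.mem_singleton] at hy
      rcases hy with rfl | rfl | rfl
      · exact hq
      · exact htP'.1 (by simp)
      · exact htP'.1 (by simp)
    · exact Finset.card_eq_three.2 ⟨q, v', w', hqt.2.1, hqt.2.2, hv'w', rfl⟩
  have hle := hmax {q, v', w'} (Finset.mem_filter.2 ⟨hs, mem_triSet.2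
    ⟨a, b, c, ha.le, hb, hc, habc, h0, h1⟩⟩)
  have e := pw_sub_comb (C {q, v', w'}).1 (C {u', v', w'}).1 (C {q, v', w'}).2 (C {u', v', w'}).2
    habc h0 h1
  rw [hC _ hs q (by simp), hC _ hs v' (by simp), hC _ hs w' (by simp), hC _ htP v' (by simp),
    hC _ htP w' (by simp)] at e
  nlinarith

theorem interior_triSet_nonempty {u v w : Pt} (h : crs u v w ≠ 0) :
    (interior (triSet {u, v, w})).Nonempty := by
  let O : Set Pt := {p | 0 < crs p v w / crs u v w ∧ 0 < crs u p w / crs u v w ∧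
    0 < crs u v p / crs u v w}
  have hO : IsOpen O := by
    simp only [O, ofPred_and]
    refine IsOpen.inter ?_ (IsOpen.inter ?_ ?_) <;> refine isOpen_lt continuous_const ?_ <;>
      simp only [crs] <;> fun_prop
  have hsub : O ⊆ triSet {u, v, w} := by
    rintro p ⟨h1, h2, h3⟩
    refine mem_triSet.2 ⟨_, _, _, h1.le, h2.le, h3.le, ?_, ?_, ?_⟩ <;> field_simp <;>
      simp only [crs] <;> ring
  refine ⟨!₂[(u 0 + v 0 + w 0) / 3, (u 1 + v 1 + w 1) / 3], interior_maximal hsub hO ?_⟩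
  refine ⟨?_, ?_, ?_⟩
  all_goals
    refine lt_of_lt_of_eq (show (0 : ℝ) < 1 / 3 by norm_num) ?_
    rw [eq_div_iff h]
    simp [crs]; ring

theorem Del.iUnion_eq {P : Finset Pt} (hP : GP P) (hP3 : 3 ≤ P.card) :
    (⋃ t ∈ Del P, triSet t) = convexHull ℝ (P : Set Pt) := by
  have hfin : (Del (P : Set Pt)).Finite := by
    refine (P.powersetCard 3).finite_toSet.subset ?_
    rintro t ⟨h3, hsub, -⟩
    exact Finset.mem_coe.2 (Finset.mem_powersetCard.2 ⟨by exact_mod_cast hsub, h3⟩)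
  have hcl : IsClosed (⋃ t ∈ Del (P : Set Pt), triSet t) :=
    hfin.isClosed_biUnion fun t _ ↦ isClosed_triSet t
  apply Subset.antisymm
  · refine iUnion₂_subset fun t ht ↦ convexHull_mono ht.2.1
  have hint : interior (convexHull ℝ (P : Set Pt)) ⊆ ⋃ t ∈ Del (P : Set Pt), triSet t := by
    rw [← sdiff_eq_empty]
    refine (isOpen_interior.sdiff hcl).eq_empty_of_measure_zero (μ := volume) ?_
    refine measure_mono_null (t := ⋃ p ∈ P, ⋃ q ∈ P, ⋃ (_ : p ≠ q), {x | crs p q x = 0}) ?_ ?_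
    · rintro x ⟨hx, hx'⟩
      by_contra hcon
      apply hx'
      obtain ⟨t, ht, hxt⟩ := Del.exists_mem hP hP3 (interior_subset hx) (by
        intro p hp q hq hpq h0
        apply hcon
        simp only [mem_iUnion]
        exact ⟨p, hp, q, hq, hpq, h0⟩)
      exact mem_iUnion₂.2 ⟨t, ht, hxt⟩
    · refine (measure_biUnion_null_iff P.countable_toSet).2 fun p _ ↦
        (measure_biUnion_null_iff P.countable_toSet).2 fun q _ ↦ measure_iUnion_null fun h ↦
          volume_crs h
  have hne : (interior (convexHull ℝ (P : Set Pt))).Nonempty := by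
    obtain ⟨t, htP, ht3⟩ := Finset.exists_subset_card_eq hP3
    obtain ⟨u, v, w, huv, huw, hvw, rfl⟩ := Finset.card_eq_three.1 ht3
    exact (interior_triSet_nonempty (hP.col u (htP (by simp)) v (htP (by simp)) w
      (htP (by simp)) huv huw hvw)).mono (interior_mono (convexHull_mono (by exact_mod_cast htP)))
  calc convexHull ℝ (P : Set Pt) ⊆ closure (convexHull ℝ (P : Set Pt)) := subset_closure
    _ = closure (interior (convexHull ℝ (P : Set Pt))) :=
      ((convex_convexHull ℝ _).closure_interior_eq_closure_of_nonempty_interior hne).symm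
    _ ⊆ _ := hcl.closure_subset_iff.2 hint

theorem Del.finite (P : Finset Pt) : (Del (P : Set Pt)).Finite := by
  refine (P.powersetCard 3).finite_toSet.subset ?_
  rintro t ⟨h3, hsub, -⟩
  exact Finset.mem_coe.2 (Finset.mem_powersetCard.2 ⟨by exact_mod_cast hsub, h3⟩)

/-- The power function is strictly convex. -/
theorem pw_comb (z : Pt) (k : ℝ) {u v w p : Pt} {a b c : ℝ} (h : a + b + c = 1)
    (h0 : p 0 = a * u 0 + b * v 0 + c * w 0) (h1 : p 1 = a * u 1 + b * v 1 + c * w 1) :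
    pw z k p = a * pw z k u + b * pw z k v + c * pw z k w - (a * b * dist u v ^ 2 +
      a * c * dist u w ^ 2 + b * c * dist v w ^ 2) := by
  have ha : a = 1 - b - c := by linarith
  subst ha
  simp only [pw, h0, h1, dist_sq_eq]
  ring

/-- Every point of `P` is a vertex of every triangle with empty disk containing it. -/
theorem Del.mem_of_mem_triSet {P : Set Pt} {t : Finset Pt} (ht : t ∈ Del P) {p : Pt} (hp : p ∈ P)
    (hpt : p ∈ triSet t) : p ∈ t := by
  obtain ⟨ht3, htP, z, k, h0, hn⟩ := ht
  obtain ⟨u, v, w, huv, huw, hvw, rfl⟩ := Finset.card_eq_three.1 ht3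
  obtain ⟨a, b, c, ha, hb, hc, habc, e0, e1⟩ := mem_triSet.1 hpt
  have e := pw_comb z k habc e0 e1
  rw [h0 u (by simp), h0 v (by simp), h0 w (by simp)] at e
  have := hn p hp
  have d1 : 0 < dist u v ^ 2 := by have := dist_pos.2 huv; positivity
  have d2 : 0 < dist u w ^ 2 := by have := dist_pos.2 huw; positivity
  have d3 : 0 < dist v w ^ 2 := by have := dist_pos.2 hvw; positivity
  have f1 : 0 ≤ a * b * dist u v ^ 2 := by positivity
  have f2 : 0 ≤ a * c * dist u w ^ 2 := by positivity
  have f3 : 0 ≤ b * c * dist v w ^ 2 := by positivity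
  have g1 : a * b = 0 := by
    have : a * b * dist u v ^ 2 = 0 := by linarith
    rcases mul_eq_zero.1 this with h | h; exacts [h, absurd h d1.ne']
  have g2 : a * c = 0 := by
    have : a * c * dist u w ^ 2 = 0 := by linarith
    rcases mul_eq_zero.1 this with h | h; exacts [h, absurd h d2.ne']
  have g3 : b * c = 0 := by
    have : b * c * dist v w ^ 2 = 0 := by linarith
    rcases mul_eq_zero.1 this with h | h; exacts [h, absurd h d3.ne']
  have : (b = 0 ∧ c = 0 ∧ a = 1) ∨ (a = 0 ∧ c = 0 ∧ b = 1) ∨ (a = 0 ∧ b = 0 ∧ c = 1) := by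
    rcases mul_eq_zero.1 g1 with h | h
    · rcases mul_eq_zero.1 g3 with h' | h'
      · right; right; exact ⟨h, h', by linarith⟩
      · right; left; exact ⟨h, h', by linarith⟩
    · rcases mul_eq_zero.1 g2 with h' | h'
      · right; right; exact ⟨h', h, by linarith⟩
      · left; exact ⟨h, h', by linarith⟩
  rcases this with ⟨rfl, rfl, rfl⟩ | ⟨rfl, rfl, rfl⟩ | ⟨rfl, rfl, rfl⟩
  · have : p = u := Pt.ext' (by simpa using e0) (by simpa using e1)
    simp [this]
  · have : p = v := Pt.ext' (by simpa using e0) (by simpa using e1)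
    simp [this]
  · have : p = w := Pt.ext' (by simpa using e0) (by simpa using e1)
    simp [this]

theorem Del.exists_vertex {P : Finset Pt} (hP : GP P) (hP3 : 3 ≤ P.card) {p : Pt} (hp : p ∈ P) :
    ∃ t ∈ Del P, p ∈ t := by
  have : p ∈ ⋃ t ∈ Del (P : Set Pt), triSet t := by
    rw [Del.iUnion_eq hP hP3]; exact subset_convexHull ℝ _ hp
  obtain ⟨t, ht, hpt⟩ := mem_iUnion₂.1 this
  exact ⟨t, ht, Del.mem_of_mem_triSet ht (by exact_mod_cast hp) hpt⟩

/-- `uv` is the non-Delaunay diagonal of an order-1 flippable quadrilateral `u x v y`. -/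
structure Flip (P : Set Pt) (u v x y : Pt) : Prop where
  hu : u ∈ P
  hv : v ∈ P
  hx : x ∈ P
  hy : y ∈ P
  opp : crs u v x * crs u v y < 0
  circ₁ : ∃ z k, pw z k u = 0 ∧ pw z k v = 0 ∧ pw z k x = 0 ∧ pw z k y < 0 ∧
    ∀ p ∈ P, p ≠ y → 0 ≤ pw z k p
  circ₂ : ∃ z k, pw z k u = 0 ∧ pw z k v = 0 ∧ pw z k y = 0 ∧ pw z k x < 0 ∧
    ∀ p ∈ P, p ≠ x → 0 ≤ pw z k p

/-- The open segments `uv` and `xy` cross. -/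
def Crossing (u v x y : Pt) : Prop := ∃ a b c d : ℝ, 0 < a ∧ 0 < b ∧ 0 < c ∧ 0 < d ∧ a + b = 1 ∧
  c + d = 1 ∧ a * u 0 + b * v 0 = c * x 0 + d * y 0 ∧ a * u 1 + b * v 1 = c * x 1 + d * y 1

theorem Crossing.symm {u v x y : Pt} (h : Crossing u v x y) : Crossing x y u v := by
  obtain ⟨a, b, c, d, ha, hb, hc, hd, hab, hcd, h0, h1⟩ := h
  exact ⟨c, d, a, b, hc, hd, ha, hb, hcd, hab, h0.symm, h1.symm⟩

theorem Crossing.swap {u v x y : Pt} (h : Crossing u v x y) : Crossing u v y x := by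
  obtain ⟨a, b, c, d, ha, hb, hc, hd, hab, hcd, h0, h1⟩ := h
  exact ⟨a, b, d, c, ha, hb, hd, hc, hab, by linarith, by linarith, by linarith⟩

theorem Crossing.triSet_subset {u v x y : Pt} (h : Crossing u v x y) :
    triSet {u, v, x} ⊆ triSet {u, x, y} ∪ triSet {v, x, y} := by
  obtain ⟨a, b, c, d, ha, hb, hc, hd, hab, hcd, h0, h1⟩ := h
  intro p hp
  obtain ⟨e, f, g, he, hf, hg, hefg, p0, p1⟩ := mem_triSet.1 hp
  rcases le_total (a * f) (b * e) with hle | hle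
  · left
    refine mem_triSet.2 ⟨e - a * (f / b), f / b * c + g, f / b * d, ?_, by positivity,
      by positivity, ?_, ?_, ?_⟩
    · rw [sub_nonneg, ← mul_div_assoc, div_le_iff₀ hb]; linarith
    · field_simp; linear_combination b * hefg - f * hab + f * hcd
    · rw [p0]; field_simp; linear_combination f * h0
    · rw [p1]; field_simp; linear_combination f * h1
  · right
    refine mem_triSet.2 ⟨f - b * (e / a), e / a * c + g, e / a * d, ?_, by positivity,
      by positivity, ?_, ?_, ?_⟩
    · rw [sub_nonneg, ← mul_div_assoc, div_le_iff₀ ha]; linarith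
    · field_simp; linear_combination a * hefg - e * hab + e * hcd
    · rw [p0]; field_simp; linear_combination e * h0
    · rw [p1]; field_simp; linear_combination e * h1

theorem Crossing.crs_pos {u v x y : Pt} (h : Crossing u v x y) :
    ∃ s : ℝ, 0 < s ∧ crs u x v = s * crs u x y := by
  obtain ⟨a, b, c, d, ha, hb, hc, hd, hab, hcd, h0, h1⟩ := h
  refine ⟨d / b, by positivity, ?_⟩
  field_simp
  simp only [crs]
  have ea : a = 1 - b := by linarith
  have ec : c = 1 - d := by linarith
  subst ea ec
  linear_combination (u 1 - x 1) * h0 - (u 0 - x 0) * h1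

theorem Crossing.not_crossing {u v x y : Pt} (h : Crossing u v x y) (hne : crs u x y ≠ 0) :
    ¬ Crossing x v u y := by
  intro h'
  obtain ⟨s, hs, h1⟩ := h.swap.crs_pos
  obtain ⟨a, b, c, d, ha, hb, hc, hd, hab, hcd, e0, e1⟩ := h'
  have : b * crs u y v = - a * crs u y x := by
    simp only [crs]
    have ea : a = 1 - b := by linarith
    have ec : c = 1 - d := by linarith
    subst ea ec
    linear_combination (u 1 - y 1) * e0 - (u 0 - y 0) * e1
  rw [h1] at this
  have hz : (b * s + a) * crs u y x = 0 := by linarith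
  rcases mul_eq_zero.1 hz with h | h
  · have : 0 < b * s := by positivity
    linarith
  · apply hne; simp only [crs] at h ⊢; linarith

namespace Flip

variable {P : Set Pt} {u v x y : Pt}

theorem swapxy (h : Flip P u v x y) : Flip P u v y x :=
  ⟨h.hu, h.hv, h.hy, h.hx, by linarith [h.opp], h.circ₂, h.circ₁⟩

theorem swapuv (h : Flip P u v x y) : Flip P v u x y := by
  refine ⟨h.hv, h.hu, h.hx, h.hy, ?_, ?_, ?_⟩
  · rw [crs_swap u v, crs_swap u v]; linarith [h.opp]
  · obtain ⟨z, k, h1, h2, h3⟩ := h.circ₁; exact ⟨z, k, h2, h1, h3⟩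
  · obtain ⟨z, k, h1, h2, h3⟩ := h.circ₂; exact ⟨z, k, h2, h1, h3⟩

theorem crs_ne (h : Flip P u v x y) : crs u v x ≠ 0 :=
  fun h0 ↦ by have := h.opp; rw [h0] at this; simp at this

theorem ne_uv (h : Flip P u v x y) : u ≠ v := (crs_perm_ne h.crs_ne).1
theorem ne_ux (h : Flip P u v x y) : u ≠ x := (crs_perm_ne h.crs_ne).2.1
theorem ne_vx (h : Flip P u v x y) : v ≠ x := (crs_perm_ne h.crs_ne).2.2
theorem ne_uy (h : Flip P u v x y) : u ≠ y := h.swapxy.ne_ux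
theorem ne_vy (h : Flip P u v x y) : v ≠ y := h.swapxy.ne_vx
theorem ne_xy (h : Flip P u v x y) : x ≠ y := by
  rintro rfl; exact absurd h.opp (not_lt.2 (mul_self_nonneg _))

theorem crossing (h : Flip P u v x y) : Crossing u v x y := by
  obtain ⟨z, k, hu, hv, hx, hy, -⟩ := h.circ₁
  have hopp := h.opp
  have huv := h.ne_uv
  obtain ⟨c, d, hc, hd, hcd, hm⟩ : ∃ c d : ℝ, 0 < c ∧ 0 < d ∧ c + d = 1 ∧
      c * crs u v x + d * crs u v y = 0 := by
    rcases mul_neg_iff.1 hopp with ⟨h1, h2⟩ | ⟨h1, h2⟩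
    · refine ⟨-crs u v y / (crs u v x - crs u v y), crs u v x / (crs u v x - crs u v y),
        div_pos (by linarith) (by linarith), div_pos h1 (by linarith), ?_, ?_⟩ <;>
      · have : crs u v x - crs u v y ≠ 0 := by linarith
        field_simp; ring
    · refine ⟨crs u v y / (crs u v y - crs u v x), -crs u v x / (crs u v y - crs u v x),
        div_pos h2 (by linarith), div_pos (by linarith) (by linarith), ?_, ?_⟩ <;>
      · have : crs u v y - crs u v x ≠ 0 := by linarith
        field_simp; ring
  obtain ⟨m, hmdef⟩ : ∃ m : Pt, m = c • x + d • y := ⟨_, rfl⟩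
  have m0 : m 0 = c * x 0 + d * y 0 := by simp [hmdef]
  have m1 : m 1 = c * x 1 + d * y 1 := by simp [hmdef]
  obtain ⟨a, b, e, habe, n0, n1⟩ := exists_bary h.crs_ne m
  have he : e = 0 := by
    have e1 := crs_comb u v (u := x) (v := y) (w := y) (p := m) (a := c) (b := d) (c := 0)
      (by linarith) (by linarith) (by linarith)
    have e2 := crs_comb u v habe n0 n1
    simp at e1 e2
    rw [e1, hm] at e2
    exact (mul_eq_zero.1 e2.symm).resolve_right h.crs_ne
  subst he
  have p1 := pw_comb z k habe n0 n1
  have p2 := pw_comb z k (u := x) (v := y) (w := y) (p := m) (a := c) (b := d) (c := 0)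
      (by linarith) (by linarith) (by linarith)
  rw [p1, hu, hv, hx] at p2
  simp at p2
  have d1 : 0 < dist u v ^ 2 := by have := dist_pos.2 huv; positivity
  have hab : 0 < a * b := by
    have hneg : -(a * b * dist u v ^ 2) < 0 := by
      rw [p2]
      have : d * pw z k y < 0 := mul_neg_of_pos_of_neg hd hy
      have : 0 ≤ c * d * dist x y ^ 2 := by positivity
      linarith
    by_contra! hcon
    nlinarith
  have hs : a + b = 1 := by linarith
  obtain ⟨ha, hb⟩ : 0 < a ∧ 0 < b := by
    rcases mul_pos_iff.1 hab with h | h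
    · exact h
    · exfalso; linarith [h.1, h.2]
  exact ⟨a, b, c, d, ha, hb, hc, hd, hs, hcd, by linarith, by linarith⟩

theorem mem_del (hP : GP P) (h : Flip P u v x y) : {u, x, y} ∈ Del P := by
  obtain ⟨z₁, k₁, u1, v1, x1, y1, p1⟩ := h.circ₁
  obtain ⟨z₂, k₂, u2, v2, y2, x2, p2⟩ := h.circ₂
  have hcr := hP.col u h.hu x h.hx y h.hy h.ne_ux h.ne_uy h.ne_xy
  obtain ⟨z, k, u0, x0, y0⟩ := exists_circle hcr
  refine ⟨Finset.card_eq_three.2 ⟨u, x, y, h.ne_ux, h.ne_uy, h.ne_xy, rfl⟩, ?_, z, k, ?_, ?_⟩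
  · intro p hp
    simp at hp
    rcases hp with rfl | rfl | rfl
    exacts [h.hu, h.hx, h.hy]
  · simp [u0, x0, y0]
  · intro p hp
    by_cases hpx : p = x
    · rw [hpx, x0]
    by_cases hpy : p = y
    · rw [hpy, y0]
    have g1 := p1 p hp hpy
    have g2 := p2 p hp hpx
    obtain ⟨a, b, c, habc, e0, e1⟩ := exists_bary hcr p
    have s1 := pw_sub_comb z z₁ k k₁ habc e0 e1
    have s2 := pw_sub_comb z z₂ k k₂ habc e0 e1
    simp only [u0, x0, y0, u1, x1, u2, y2, sub_zero, mul_zero, zero_add, add_zero] at s1 s2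
    by_cases hc : 0 ≤ c
    · nlinarith
    by_cases hb : 0 ≤ b
    · nlinarith
    push Not at hc hb
    have ha : 0 < a := by linarith
    have e := pw_comb z k (u := p) (v := x) (w := y) (p := u) (a := 1 / a) (b := -b / a)
      (c := -c / a) (by field_simp; linarith) (by rw [e0]; field_simp; ring)
      (by rw [e1]; field_simp; ring)
    rw [u0, x0, y0] at e
    have t1 : 0 ≤ 1 / a * (-b / a) * dist p x ^ 2 := by
      have : 0 ≤ -b := by linarith
      positivity
    have t2 : 0 ≤ 1 / a * (-c / a) * dist p y ^ 2 := by
      have : 0 ≤ -c := by linarith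
      positivity
    have t3 : 0 ≤ -b / a * (-c / a) * dist x y ^ 2 := by
      have : 0 ≤ -b := by linarith
      have : 0 ≤ -c := by linarith
      positivity
    have : 0 ≤ 1 / a * pw z k p := by linarith
    by_contra! hcon
    have : 1 / a * pw z k p < 0 := mul_neg_of_pos_of_neg (by positivity) hcon
    linarith

end Flip

theorem GP.eq_of_same_side {P : Set Pt} (hP : GP P) {q r x y : Pt} (hq : q ∈ P) (hr : r ∈ P)
    (hx : x ∈ P) (hy : y ∈ P) (hside : 0 < crs q r x * crs q r y) {z z' : Pt} {k k' : ℝ}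
    (q1 : pw z k q = 0) (r1 : pw z k r = 0) (x1 : pw z k x = 0) (y1 : 0 ≤ pw z k y)
    (q2 : pw z' k' q = 0) (r2 : pw z' k' r = 0) (y2 : pw z' k' y = 0) (x2 : 0 ≤ pw z' k' x) :
    x = y := by
  have hne : crs q r x ≠ 0 := fun h ↦ by simp [h] at hside
  have hne' : crs q r y ≠ 0 := fun h ↦ by simp [h] at hside
  obtain ⟨a, b, c, habc, e0, e1⟩ := exists_bary hne y
  have e := crs_comb q r habc e0 e1
  simp only [crs_left, crs_right, mul_zero, zero_add] at e
  have hc : 0 < c := by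
    rw [e] at hside
    have h2 : 0 < crs q r x ^ 2 := by positivity
    by_contra! hcon
    nlinarith
  have s := pw_sub_comb z z' k k' habc e0 e1
  simp only [q1, q2, r1, r2, x1, y2, sub_zero, mul_zero, zero_add, zero_sub] at s
  have hx0 : pw z' k' x = 0 := by
    by_contra hcon
    have : 0 < pw z' k' x := lt_of_le_of_ne x2 (Ne.symm hcon)
    have : c * -pw z' k' x < 0 := mul_neg_of_pos_of_neg hc (by linarith)
    linarith
  by_contra hxy
  obtain ⟨n1, n2, n3⟩ := crs_perm_ne hne
  obtain ⟨n4, n5, n6⟩ := crs_perm_ne hne'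
  exact hP.cir q hq r hr x hx y hy n1 n2 n5 n3 n6 hxy z' k' q2 r2 hx0 y2

namespace Flip

variable {P : Set Pt} {u v x y u' v' x' y' : Pt}

theorem apex_unique (hP : GP P) (h : Flip P u v x y) (h' : Flip P u v' x y) : v = v' := by
  obtain ⟨-, -, z, k, h0, hn⟩ := h.swapuv.mem_del hP
  obtain ⟨-, -, z', k', h0', hn'⟩ := h'.swapuv.mem_del hP
  refine hP.eq_of_same_side h.hx h.hy h.hv h'.hv ?_ (h0 x (by simp)) (h0 y (by simp))
    (h0 v (by simp)) (hn _ h'.hv) (h0' x (by simp)) (h0' y (by simp)) (h0' v' (by simp))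
    (hn' _ h.hv)
  have hc := hP.col u h.hu x h.hx y h.hy h.ne_ux h.ne_uy h.ne_xy
  have key : ∀ w, Crossing u w x y → ∃ s : ℝ, 0 < s ∧ crs x y w = - s * crs u x y := by
    rintro w ⟨a, b, c, d, ha, hb, hc, hd, hab, hcd, e0, e1⟩
    refine ⟨a / b, by positivity, ?_⟩
    field_simp
    simp only [crs]
    have ea : a = 1 - b := by linarith
    have ec : c = 1 - d := by linarith
    subst ea ec
    linear_combination (x 1 - y 1) * e0 - (x 0 - y 0) * e1
  obtain ⟨s, hs, e⟩ := key v h.crossing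
  obtain ⟨s', hs', e'⟩ := key v' h'.crossing
  rw [e, e']
  have : 0 < crs u x y ^ 2 := by positivity
  have : 0 < s * s' * crs u x y ^ 2 := by positivity
  linarith

theorem not_adjacent (hP : GP P) (h : Flip P u v x y) (h' : Flip P x v' u y) : False := by
  have hc := hP.col u h.hu x h.hx y h.hy h.ne_ux h.ne_uy h.ne_xy
  obtain ⟨z, k, u1, v1, x1, y1, p1⟩ := h.circ₁
  obtain ⟨z', k', u2, v2, x2, y2, p2⟩ := h'.circ₁
  have hvv : v = v' := by
    refine hP.eq_of_same_side h.hu h.hx h.hv h'.hv ?_ u1 x1 v1 (p1 _ h'.hv h'.ne_vy) x2 u2 v2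
      (p2 _ h.hv h.ne_vy)
    obtain ⟨s, hs, e⟩ := h.crossing.crs_pos
    obtain ⟨s', hs', e'⟩ := h'.crossing.crs_pos
    rw [crs_swap u x, crs_swap u x] at e'
    have e' : crs u x v' = s' * crs u x y := by linarith
    rw [e, e']
    have : 0 < crs u x y ^ 2 := by positivity
    have : 0 < s * s' * crs u x y ^ 2 := by positivity
    linarith
  subst hvv
  exact h.crossing.not_crossing hc h'.crossing

/-- Two flippable quadrilaterals sharing a Delaunay triangle coincide. -/
theorem eq_of_shared (hP : GP P) (h : Flip P u v x y) (h' : Flip P u' v' x' y')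
    (hs : ({u, x, y} : Finset Pt) = {u', x', y'}) :
    u = u' ∧ v = v' ∧ (x = x' ∧ y = y' ∨ x = y' ∧ y = x') := by
  have m1 : u ∈ ({u', x', y'} : Finset Pt) := by rw [← hs]; simp
  have m2 : x ∈ ({u', x', y'} : Finset Pt) := by rw [← hs]; simp
  have m3 : y ∈ ({u', x', y'} : Finset Pt) := by rw [← hs]; simp
  simp only [Finset.mem_insert, Finset.mem_singleton] at m1 m2 m3
  have n1 := h.ne_ux
  have n2 := h.ne_uy
  have n3 := h.ne_xy
  rcases m1 with rfl | rfl | rfl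
  · rcases m2 with rfl | rfl | rfl
    · exact absurd rfl n1
    · rcases m3 with rfl | rfl | rfl
      · exact absurd rfl n2
      · exact absurd rfl n3
      · exact ⟨rfl, h.apex_unique hP h', Or.inl ⟨rfl, rfl⟩⟩
    · rcases m3 with rfl | rfl | rfl
      · exact absurd rfl n2
      · exact ⟨rfl, h.apex_unique hP h'.swapxy, Or.inr ⟨rfl, rfl⟩⟩
      · exact absurd rfl n3
  · exfalso
    rcases m2 with rfl | rfl | rfl
    · rcases m3 with rfl | rfl | rfl
      · exact absurd rfl n3
      · exact absurd rfl n2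
      · exact h.not_adjacent hP h'
    · exact absurd rfl n1
    · rcases m3 with rfl | rfl | rfl
      · exact h.swapxy.not_adjacent hP h'
      · exact absurd rfl n2
      · exact absurd rfl n3
  · exfalso
    rcases m2 with rfl | rfl | rfl
    · rcases m3 with rfl | rfl | rfl
      · exact absurd rfl n3
      · exact h.not_adjacent hP h'.swapxy
      · exact absurd rfl n2
    · rcases m3 with rfl | rfl | rfl
      · exact h.swapxy.not_adjacent hP h'.swapxy
      · exact absurd rfl n3
      · exact absurd rfl n2
    · exact absurd rfl n1

end Flip

section

/-- The two Delaunay triangles of the quadrilateral `q = (u, v, x, y)`. -/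
def oldTri (q : Pt × Pt × Pt × Pt) : Set (Finset Pt) :=
  {{q.1, q.2.2.1, q.2.2.2}, {q.2.1, q.2.2.1, q.2.2.2}}

/-- The two triangles of the quadrilateral `q = (u, v, x, y)` after the flip. -/
def newTri (q : Pt × Pt × Pt × Pt) : Set (Finset Pt) :=
  {{q.1, q.2.1, q.2.2.1}, {q.1, q.2.1, q.2.2.2}}

/-- `q = (u, v, x, y)` is a flippable quadrilateral. -/
def FlipQ (P : Set Pt) (q : Pt × Pt × Pt × Pt) : Prop := Flip P q.1 q.2.1 q.2.2.1 q.2.2.2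

/-- The tuples `q` and `q'` describe the same quadrilateral with the same diagonals. -/
def SameQ (q q' : Pt × Pt × Pt × Pt) : Prop :=
  (q.1 = q'.1 ∧ q.2.1 = q'.2.1 ∨ q.1 = q'.2.1 ∧ q.2.1 = q'.1) ∧
  (q.2.2.1 = q'.2.2.1 ∧ q.2.2.2 = q'.2.2.2 ∨ q.2.2.1 = q'.2.2.2 ∧ q.2.2.2 = q'.2.2.1)

variable {P : Set Pt} {q q' : Pt × Pt × Pt × Pt}

theorem FlipQ.oldTri_subset (hP : GP P) (h : FlipQ P q) : oldTri q ⊆ Del P := by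
  rintro t (rfl | rfl)
  · exact Flip.mem_del hP h
  · exact (Flip.swapuv h).mem_del hP

theorem FlipQ.sameQ (hP : GP P) (h : FlipQ P q) (h' : FlipQ P q') {t : Finset Pt}
    (ht : t ∈ oldTri q) (ht' : t ∈ oldTri q') : SameQ q q' := by
  rcases ht with rfl | rfl <;> rcases ht' with hs | hs
  · have := Flip.eq_of_shared hP h h' hs; exact ⟨by tauto, by tauto⟩
  · have := Flip.eq_of_shared hP h (Flip.swapuv h') hs; exact ⟨by tauto, by tauto⟩
  · have := Flip.eq_of_shared hP (Flip.swapuv h) h' hs; exact ⟨by tauto, by tauto⟩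
  · have := Flip.eq_of_shared hP (Flip.swapuv h) (Flip.swapuv h') hs
    exact ⟨by tauto, by tauto⟩

theorem FlipQ.iUnion_eq (h : FlipQ P q) :
    (⋃ t ∈ newTri q, triSet t) = ⋃ t ∈ oldTri q, triSet t := by
  have hc := Flip.crossing h
  obtain ⟨u, v, x, y⟩ := q
  simp only [newTri, oldTri, biUnion_insert, biUnion_singleton] at *
  apply Subset.antisymm
  · refine union_subset hc.triSet_subset ?_
    have := hc.swap.triSet_subset
    rwa [Finset.pair_comm y x] at this
  · refine union_subset ?_ ?_
    · have := hc.symm.triSet_subset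
      have e1 : ({x, y, u} : Finset Pt) = {u, x, y} := by ext; simp; tauto
      have e2 : ({x, u, v} : Finset Pt) = {u, v, x} := by ext; simp; tauto
      have e3 : ({y, u, v} : Finset Pt) = {u, v, y} := by ext; simp; tauto
      rwa [e1, e2, e3] at this
    · have := hc.symm.swap.triSet_subset
      have e1 : ({x, y, v} : Finset Pt) = {v, x, y} := by ext; simp; tauto
      have e2 : ({x, v, u} : Finset Pt) = {u, v, x} := by ext; simp; tauto
      have e3 : ({y, v, u} : Finset Pt) = {u, v, y} := by ext; simp; tauto
      rwa [e1, e2, e3] at this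

theorem FlipQ.not_del (h : FlipQ P q) {t : Finset Pt} (ht : t ∈ newTri q) :
    t ∉ Del P := by
  have main : ∀ u v x y, Flip P u v x y → ({u, v, x} : Finset Pt) ∉ Del P := by
    rintro u v x y h ⟨-, hsub, z', k', h0, hn⟩
    obtain ⟨z, k, hu, hv, hx, hy, hp⟩ := h.circ₁
    have hyneg : pw z k y < 0 := hy
    obtain ⟨a, b, c, habc, e0, e1⟩ := exists_bary h.crs_ne y
    have s := pw_sub_comb z z' k k' habc e0 e1
    rw [hu, hv, hx, h0 u (by simp), h0 v (by simp), h0 x (by simp)] at s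
    have := hn y h.hy
    linarith
  rcases ht with rfl | rfl
  · exact main _ _ _ _ h
  · exact main _ _ _ _ (Flip.swapxy h)

theorem orderKTri_of_pw {t : Finset Pt} (htne : t.Nonempty) {z : Pt} {k : ℝ}
    (h0 : ∀ p ∈ t, pw z k p = 0) {n : ℕ} (hn : {p ∈ P | pw z k p < 0}.encard ≤ n) :
    OrderKTri P n t := by
  have hk : 0 ≤ k := by
    obtain ⟨p, hp⟩ := htne
    have := h0 p hp
    rw [pw_eq] at this
    nlinarith [sq_nonneg (dist p z)]
  refine ⟨z, √k, fun p hp ↦ ?_, ?_⟩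
  · have := h0 p hp
    rw [pw_eq] at this
    rw [← Real.sqrt_sq (dist_nonneg (x := p) (y := z))]
    congr 1; linarith
  · refine le_trans (encard_le_encard ?_) hn
    rintro p ⟨hp, hpz⟩
    refine ⟨hp, ?_⟩
    rw [pw_eq]
    have := Real.lt_sqrt (dist_nonneg (x := p) (y := z)) (y := k)
    linarith [this.1 hpz]

theorem Del.orderKTri {t : Finset Pt} (ht : t ∈ Del P) (n : ℕ) : OrderKTri P n t := by
  obtain ⟨h3, -, z, k, h0, hn⟩ := ht
  refine orderKTri_of_pw (by rw [← Finset.card_pos]; omega) h0 ?_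
  have : {p ∈ P | pw z k p < 0} = ∅ := by
    rw [eq_empty_iff_forall_notMem]
    rintro p ⟨hp, hp'⟩
    exact absurd (hn p hp) (not_le.2 hp')
  rw [this]; simp

theorem FlipQ.orderKTri (h : FlipQ P q) {t : Finset Pt} (ht : t ∈ newTri q) :
    OrderKTri P 1 t := by
  have main : ∀ u v x y, Flip P u v x y → OrderKTri P 1 ({u, v, x} : Finset Pt) := by
    intro u v x y h
    obtain ⟨z, k, hu, hv, hx, hy, hp⟩ := h.circ₁
    refine orderKTri_of_pw (by simp) (z := z) (k := k) (by simp [hu, hv, hx]) ?_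
    refine (encard_le_encard (t := {y}) ?_).trans (by simp)
    rintro p ⟨hpP, hneg⟩
    by_contra hne
    exact absurd (hp p hpP hne) (not_le.2 hneg)
  rcases ht with rfl | rfl
  · exact main _ _ _ _ h
  · exact main _ _ _ _ (Flip.swapxy h)

theorem FlipQ.card_newTri (h : FlipQ P q) {t : Finset Pt} (ht : t ∈ newTri q) :
    t.card = 3 ∧ (t : Set Pt) ⊆ P := by
  have main : ∀ u v x y, Flip P u v x y → ({u, v, x} : Finset Pt).card = 3 ∧
      (({u, v, x} : Finset Pt) : Set Pt) ⊆ P := by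
    intro u v x y h
    refine ⟨Finset.card_eq_three.2 ⟨u, v, x, h.ne_uv, h.ne_ux, h.ne_vx, rfl⟩, ?_⟩
    intro p hp
    simp at hp
    rcases hp with rfl | rfl | rfl
    exacts [h.hu, h.hv, h.hx]
  rcases ht with rfl | rfl
  · exact main _ _ _ _ h
  · exact main _ _ _ _ (Flip.swapxy h)

theorem FlipQ.volume_newTri (h : FlipQ P q) {t s : Finset Pt} (ht : t ∈ newTri q)
    (hs : s ∈ newTri q) (hne : t ≠ s) : volume (triSet t ∩ triSet s) = 0 := by
  have side : ∀ u v x : Pt, ∀ ε : ℝ, 0 ≤ ε * crs u v x →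
      triSet {u, v, x} ⊆ {p | 0 ≤ ε * crs u v p} := by
    intro u v x ε hx p hp
    obtain ⟨a, b, c, ha, hb, hc, habc, e0, e1⟩ := mem_triSet.1 hp
    have e := crs_comb u v habc e0 e1
    simp only [crs_left, crs_right, mul_zero, zero_add] at e
    simp only [mem_ofPred_eq, e]
    nlinarith
  have main : ∀ u v x y, Flip P u v x y → volume (triSet {u, v, x} ∩ triSet {u, v, y}) = 0 := by
    intro u v x y h
    refine measure_mono_null ?_ (volume_crs h.ne_uv)
    rintro p ⟨h1, h2⟩
    have hopp := h.opp
    have a1 := side u v x (crs u v x) (mul_self_nonneg _) h1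
    have a2 := side u v y (- crs u v x) (by linarith) h2
    simp only [mem_ofPred_eq] at a1 a2 ⊢
    have : crs u v x * crs u v p = 0 := by linarith
    exact (mul_eq_zero.1 this).resolve_left h.crs_ne
  rcases ht with rfl | rfl <;> rcases hs with rfl | rfl
  · exact absurd rfl hne
  · exact main _ _ _ _ h
  · exact main _ _ _ _ (Flip.swapxy h)
  · exact absurd rfl hne

/-- The Delaunay triangulation with the quadrilaterals of `S` flipped. -/
def flipped (P : Set Pt) (S : Finset (Pt × Pt × Pt × Pt)) : Set (Finset Pt) :=
  {t ∈ Del P | ∀ q ∈ S, t ∉ oldTri q} ∪ ⋃ q ∈ S, newTri q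

theorem volume_inter_of_newTri (h : FlipQ P q) {t : Finset Pt} (ht : t ∈ newTri q) {A : Set Pt}
    (hA : ∀ s ∈ oldTri q, volume (triSet s ∩ A) = 0) : volume (triSet t ∩ A) = 0 := by
  have hsub : triSet t ⊆ ⋃ s ∈ oldTri q, triSet s := by
    rw [← h.iUnion_eq]; exact subset_biUnion_of_mem ht
  refine measure_mono_null (inter_subset_inter_left A hsub) ?_
  rw [iUnion₂_inter]
  refine (measure_biUnion_null_iff ?_).2 hA
  simp [oldTri]

theorem isOrderDT_flipped {P : Finset Pt} (hP : GP P) (hP3 : 3 ≤ P.card)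
    {S : Finset (Pt × Pt × Pt × Pt)} (hS : ∀ q ∈ S, FlipQ P q)
    (hS' : ∀ q ∈ S, ∀ q' ∈ S, SameQ q q' → q = q') : IsOrderDT P 1 (flipped P S) := by
  have hnew : ∀ q ∈ S, ∀ t ∈ newTri q, t ∈ flipped P S := fun q hq t ht ↦
    Or.inr (mem_iUnion₂.2 ⟨q, hq, ht⟩)
  have holdcov : ∀ q ∈ S, ∀ t ∈ oldTri q, triSet t ⊆ ⋃ s ∈ flipped (P : Set Pt) S, triSet s := by
    intro q hq t ht
    refine (subset_biUnion_of_mem (u := fun t ↦ triSet t) ht).trans ?_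
    rw [← (hS q hq).iUnion_eq]
    exact biUnion_subset_biUnion_left (hnew q hq)
  have hsub : ∀ t ∈ flipped (P : Set Pt) S, t.card = 3 ∧ (t : Set Pt) ⊆ P := by
    rintro t (ht | ht)
    · exact ⟨ht.1.1, ht.1.2.1⟩
    · obtain ⟨q, hq, ht⟩ := mem_iUnion₂.1 ht
      exact (hS q hq).card_newTri ht
  refine ⟨⟨?_, hsub, ?_, ?_, ?_⟩, ?_⟩
  · refine (P.powersetCard 3).finite_toSet.subset fun t ht ↦ ?_
    have := hsub t ht
    exact Finset.mem_coe.2 (Finset.mem_powersetCard.2 ⟨by exact_mod_cast this.2, this.1⟩)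
  · intro p hp
    obtain ⟨t, ht, hpt⟩ := Del.exists_vertex hP hP3 hp
    by_cases hold : ∀ q ∈ S, t ∉ oldTri q
    · exact ⟨t, Or.inl ⟨ht, hold⟩, hpt⟩
    · push Not at hold
      obtain ⟨q, hq, htq⟩ := hold
      have : p = q.1 ∨ p = q.2.1 ∨ p = q.2.2.1 ∨ p = q.2.2.2 := by
        rcases htq with rfl | rfl <;> simp at hpt <;> tauto
      rcases this with rfl | rfl | rfl | rfl
      · exact ⟨_, hnew q hq _ (Or.inl rfl), by simp⟩
      · exact ⟨_, hnew q hq _ (Or.inl rfl), by simp⟩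
      · exact ⟨_, hnew q hq _ (Or.inl rfl), by simp⟩
      · exact ⟨_, hnew q hq _ (Or.inr rfl), by simp⟩
  · intro t ht s hs hne
    apply interior_inter_eq_empty
    rcases ht with ⟨ht, ht'⟩ | ht <;> rcases hs with ⟨hs, hs'⟩ | hs
    · exact Del.volume_inter hP ht hs hne
    · obtain ⟨q, hq, hsq⟩ := mem_iUnion₂.1 hs
      rw [inter_comm]
      refine volume_inter_of_newTri (hS q hq) hsq fun s' hs' ↦ ?_
      refine Del.volume_inter hP ((hS q hq).oldTri_subset hP hs') ht ?_
      rintro rfl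
      exact ht' q hq hs'
    · obtain ⟨q, hq, htq⟩ := mem_iUnion₂.1 ht
      refine volume_inter_of_newTri (hS q hq) htq fun t' ht' ↦ ?_
      refine Del.volume_inter hP ((hS q hq).oldTri_subset hP ht') hs ?_
      rintro rfl
      exact hs' q hq ht'
    · obtain ⟨q, hq, htq⟩ := mem_iUnion₂.1 ht
      obtain ⟨q', hq', hsq'⟩ := mem_iUnion₂.1 hs
      by_cases hqq : q = q'
      · subst hqq
        exact (hS q hq).volume_newTri htq hsq' hne
      · refine volume_inter_of_newTri (hS q hq) htq fun t' ht' ↦ ?_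
        rw [inter_comm]
        refine volume_inter_of_newTri (hS q' hq') hsq' fun s' hs' ↦ ?_
        refine Del.volume_inter hP ((hS q' hq').oldTri_subset hP hs')
          ((hS q hq).oldTri_subset hP ht') ?_
        rintro rfl
        exact hqq (hS' q hq q' hq' ((hS q hq).sameQ hP (hS q' hq') ht' hs'))
  · apply Subset.antisymm
    · exact iUnion₂_subset fun t ht ↦ convexHull_mono (hsub t ht).2
    · rw [← Del.iUnion_eq hP hP3]
      refine iUnion₂_subset fun t ht ↦ ?_
      by_cases hold : ∀ q ∈ S, t ∉ oldTri q
      · exact subset_biUnion_of_mem (u := fun t ↦ triSet t)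
          (show t ∈ flipped (P : Set Pt) S from Or.inl ⟨ht, hold⟩)
      · push Not at hold
        obtain ⟨q, hq, htq⟩ := hold
        exact holdcov q hq t htq
  · rintro t (ht | ht)
    · exact Del.orderKTri ht.1 1
    · obtain ⟨q, hq, ht⟩ := mem_iUnion₂.1 ht
      exact (hS q hq).orderKTri ht

theorem finite_isOrderDT (P : Finset Pt) (k : ℕ) :
    {T : Set (Finset Pt) | IsOrderDT (P : Set Pt) k T}.Finite := by
  refine (P.powersetCard 3).finite_toSet.finite_subsets.subset fun T hT t ht ↦ ?_
  have := hT.1.2.1 t ht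
  exact Finset.mem_coe.2 (Finset.mem_powersetCard.2 ⟨by exact_mod_cast this.2, this.1⟩)

/-- Every set of flippable quadrilaterals can be flipped simultaneously. -/
theorem two_pow_le_ncard {P : Finset Pt} (hP : GP P) (hP3 : 3 ≤ P.card)
    {F : Finset (Pt × Pt × Pt × Pt)} (hF : ∀ q ∈ F, FlipQ P q)
    (hF' : ∀ q ∈ F, ∀ q' ∈ F, SameQ q q' → q = q') :
    2 ^ F.card ≤ {T : Set (Finset Pt) | IsOrderDT (P : Set Pt) 1 T}.ncard := by
  rw [← Finset.card_powerset, ← ncard_coe_finset]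
  refine ncard_le_ncard_of_injOn (flipped (P : Set Pt)) ?_ ?_ (finite_isOrderDT P 1)
  · intro S hS
    have hS := Finset.mem_powerset.1 (Finset.mem_coe.1 hS)
    exact isOrderDT_flipped hP hP3 (fun q hq ↦ hF q (hS hq))
      (fun q hq q' hq' ↦ hF' q (hS hq) q' (hS hq'))
  · have key : ∀ S : Finset (Pt × Pt × Pt × Pt), S ⊆ F → ∀ q ∈ F, q ∈ S ↔
        ({q.1, q.2.2.1, q.2.2.2} : Finset Pt) ∉ flipped P S := by
      intro S hS q hq
      have hold : ({q.1, q.2.2.1, q.2.2.2} : Finset Pt) ∈ oldTri q := Or.inl rfl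
      have hdel := (hF q hq).oldTri_subset hP hold
      constructor
      · rintro hqS (⟨-, h⟩ | h)
        · exact h q hqS hold
        · obtain ⟨q', hq', h⟩ := mem_iUnion₂.1 h
          exact (hF q' (hS hq')).not_del h hdel
      · intro h
        by_contra hqS
        refine h (Or.inl ⟨hdel, fun q' hq' hold' ↦ hqS ?_⟩)
        rw [hF' q hq q' (hS hq') ((hF q hq).sameQ hP (hF q' (hS hq')) hold hold')]
        exact hq'
    intro S hS S' hS' heq
    have hS := Finset.mem_powerset.1 (Finset.mem_coe.1 hS)
    have hS' := Finset.mem_powerset.1 (Finset.mem_coe.1 hS')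
    ext q
    constructor
    · intro h
      rw [key S' hS' q (hS h), ← heq, ← key S hS q (hS h)]; exact h
    · intro h
      rw [key S hS q (hS' h), heq, ← key S' hS' q (hS' h)]; exact h

end

theorem Del.eq_of_middle {P : Set Pt} (hP : GP P) {q p r q' r' : Pt} (ht : {q, p, r} ∈ Del P)
    (hs : {q', p, r'} ∈ Del P) (hq : q 0 < p 0) (hr : p 0 < r 0) (hq' : q' 0 < p 0)
    (hr' : p 0 < r' 0) (h : 0 < crs q r p * crs q' r' p) :
    ({q, p, r} : Finset Pt) = {q', p, r'} := by
  obtain ⟨ht3, htP, z, k, ht0, htn⟩ := ht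
  obtain ⟨hs3, hsP, z', k', hs0, hsn⟩ := hs
  have e : ∀ x, pw z k x - pw z' k' x = _ := pw_sub_eq z z' k k'
  generalize hA : z 0 ^ 2 + z 1 ^ 2 - k - (z' 0 ^ 2 + z' 1 ^ 2 - k') = A at e
  generalize hB : 2 * (z' 0 - z 0) = B at e
  generalize hC : 2 * (z' 1 - z 1) = C at e
  have hp : A + B * p 0 + C * p 1 = 0 := by
    rw [← e, ht0 p (by simp), hs0 p (by simp), sub_zero]
  have h1 : ∀ x ∈ ({q, p, r} : Finset Pt), A + B * x 0 + C * x 1 ≤ 0 := fun x hx ↦ by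
    rw [← e, ht0 x hx]; linarith [hsn x (htP hx)]
  have h2 : ∀ x ∈ ({q', p, r'} : Finset Pt), 0 ≤ A + B * x 0 + C * x 1 := fun x hx ↦ by
    rw [← e, hs0 x hx]; linarith [htn x (hsP hx)]
  have hq1 := h1 q (by simp)
  have hr1 := h1 r (by simp)
  have hq2 := h2 q' (by simp)
  have hr2 := h2 r' (by simp)
  have i1 : 0 ≤ C * crs q r p := by
    have : C * crs q r p = -((r 0 - p 0) * (A + B * q 0 + C * q 1)
      + (p 0 - q 0) * (A + B * r 0 + C * r 1)) := by
      simp only [crs]; linear_combination (r 0 - q 0) * hp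
    rw [this]; nlinarith
  have i2 : C * crs q' r' p ≤ 0 := by
    have : C * crs q' r' p = -((r' 0 - p 0) * (A + B * q' 0 + C * q' 1)
      + (p 0 - q' 0) * (A + B * r' 0 + C * r' 1)) := by
      simp only [crs]; linear_combination (r' 0 - q' 0) * hp
    rw [this]; nlinarith
  have hC0 : C = 0 := by
    have : C ^ 2 * (crs q r p * crs q' r' p) ≤ 0 := by nlinarith
    have : C ^ 2 ≤ 0 := by nlinarith [sq_nonneg C]
    nlinarith
  have hB0 : B = 0 := by
    subst hC0
    have : B * (q 0 - p 0) ≤ 0 := by linarith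
    have : B * (r 0 - p 0) ≤ 0 := by linarith
    apply le_antisymm <;> nlinarith
  have hz : z = z' := Pt.ext' (by linarith) (by linarith)
  have hk : k = k' := by
    subst hz hC0 hB0; linarith
  subst hz hk
  exact hP.eq_of_circle ht3 hs3 htP hsP ht0 hs0

theorem exists_sorted {t : Finset Pt} (ht : t.card = 3)
    (hinj : InjOn (fun p : Pt ↦ p 0) t) :
    ∃ q p r : Pt, t = {q, p, r} ∧ q 0 < p 0 ∧ p 0 < r 0 := by
  obtain ⟨a, b, c, hab, hac, hbc, rfl⟩ := Finset.card_eq_three.1 ht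
  have hab : a 0 ≠ b 0 := fun h ↦ hab (hinj (by simp) (by simp) h)
  have hac : a 0 ≠ c 0 := fun h ↦ hac (hinj (by simp) (by simp) h)
  have hbc : b 0 ≠ c 0 := fun h ↦ hbc (hinj (by simp) (by simp) h)
  rcases hab.lt_or_gt with h1 | h1 <;> rcases hac.lt_or_gt with h2 | h2 <;>
    rcases hbc.lt_or_gt with h3 | h3
  · exact ⟨a, b, c, rfl, h1, h3⟩
  · exact ⟨a, c, b, by grind, h2, h3⟩
  · exact absurd (h1.trans h3) (not_lt.2 h2.le)
  · exact ⟨c, a, b, by grind, h2, h1⟩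
  · exact ⟨b, a, c, by grind, h1, h2⟩
  · exact absurd (h3.trans h1) (not_lt.2 h2.le)
  · exact ⟨b, c, a, by grind, h3, h2⟩
  · exact ⟨c, b, a, by grind, h3, h1⟩

theorem Del.ncard_le {R : Finset Pt} (hR : GP (R : Set Pt))
    (hinj : InjOn (fun p : Pt ↦ p 0) (R : Set Pt)) : (Del (R : Set Pt)).ncard ≤ 2 * R.card := by
  have key : ∀ t ∈ Del (R : Set Pt), ∃ q p r : Pt, t = {q, p, r} ∧ q 0 < p 0 ∧ p 0 < r 0 :=
    fun t ht ↦ exists_sorted ht.1 (hinj.mono ht.2.1)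
  choose! q p r hqpr hq hr using key
  have := ncard_le_ncard_of_injOn (s := Del (R : Set Pt))
    (t := ((R ×ˢ (Finset.univ : Finset Bool) : Finset (Pt × Bool)) : Set (Pt × Bool)))
    (fun t ↦ (p t, decide (0 < crs (q t) (r t) (p t)))) ?_ ?_ (Finset.finite_toSet _)
  · rw [ncard_coe_finset, Finset.card_product] at this
    simpa [mul_comm] using this
  · intro t ht
    have : p t ∈ ({q t, p t, r t} : Finset Pt) := by simp
    rw [← hqpr t ht] at this
    exact Finset.mem_coe.2 (Finset.mem_product.2 ⟨ht.2.1 this, Finset.mem_univ _⟩)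
  · intro t ht s hs hts
    simp only [Prod.mk.injEq, decide_eq_decide] at hts
    obtain ⟨hp, hsgn⟩ := hts
    have ne : ∀ t ∈ Del (R : Set Pt), crs (q t) (r t) (p t) ≠ 0 := by
      intro t ht
      have hsub := ht.2.1
      rw [hqpr t ht] at hsub
      have i1 := hq t ht
      have i2 := hr t ht
      refine hR.col _ (hsub (by simp)) _ (hsub (by simp)) _ (hsub (by simp)) ?_ ?_ ?_ <;>
      intro h <;> have := congrArg (fun p : Pt ↦ p 0) h <;> simp only at this <;> linarith
    have h1 := ne t ht
    have h2 := ne s hs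
    rw [hqpr t ht, hqpr s hs, hp]
    have ht' := ht
    have hs' := hs
    rw [hqpr t ht, hp] at ht'
    rw [hqpr s hs] at hs'
    refine Del.eq_of_middle hR ht' hs' (hp ▸ hq t ht) (hp ▸ hr t ht) (hq s hs) (hr s hs) ?_
    rw [← hp]
    by_cases h : 0 < crs (q t) (r t) (p t)
    · have := hsgn.1 h
      rw [← hp] at this
      positivity
    · have h3 : ¬ 0 < crs (q s) (r s) (p s) := fun h' ↦ h (hsgn.2 h')
      rw [← hp] at h3 h2
      exact mul_pos_of_neg_of_neg (lt_of_le_of_ne (not_lt.1 h) h1) (lt_of_le_of_ne (not_lt.1 h3) h2)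

theorem card_orderKTri_le {P : Finset Pt} (hP : GP (P : Set Pt))
    (hinj : InjOn (fun p : Pt ↦ p 0) (P : Set Pt)) {S : Finset (Finset Pt)}
    (hS : ∀ t ∈ S, t.card = 3 ∧ (t : Set Pt) ⊆ P ∧ OrderKTri P 1 t) :
    S.card ≤ 32 * P.card := by
  classical
  have h1 : ∀ t ∈ S, 2 ^ (P.card - 4) ≤
      (P.powerset.bipartiteAbove (fun t (R : Finset Pt) ↦ t ∈ Del (R : Set Pt)) t).card := by
    intro t ht
    obtain ⟨ht3, htP, z, r, hr, hc⟩ := hS t ht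
    obtain ⟨c, hc⟩ : ∃ c, ∀ p ∈ P, dist p z < r → p = c := by
      by_cases h : ∃ c ∈ P, dist c z < r
      · obtain ⟨c, hcP, hcr⟩ := h
        exact ⟨c, fun p hp hpr ↦ encard_le_one_iff.1 hc p c ⟨hp, hpr⟩ ⟨hcP, hcr⟩⟩
      · exact ⟨0, fun p hp hpr ↦ absurd ⟨p, hp, hpr⟩ h⟩
    have hcard : P.card - 4 ≤ ((P \ t).erase c).card := by
      have a1 := Finset.pred_card_le_card_erase (s := P \ t) (a := c)
      have a2 := Finset.le_card_sdiff t P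
      omega
    calc 2 ^ (P.card - 4) ≤ 2 ^ ((P \ t).erase c).card := Nat.pow_le_pow_right (by norm_num) hcard
      _ = ((P \ t).erase c).powerset.card := (Finset.card_powerset _).symm
      _ ≤ _ := by
        refine Finset.card_le_card_of_injOn (fun U ↦ t ∪ U) ?_ ?_
        · intro U hU
          have hU := Finset.mem_powerset.1 (Finset.mem_coe.1 hU)
          refine Finset.mem_coe.2 (Finset.mem_filter.2 ⟨Finset.mem_powerset.2 ?_, ht3, ?_, z, r ^ 2,
            ?_, ?_⟩)
          · refine Finset.union_subset (by exact_mod_cast htP) fun x hx ↦ ?_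
            exact (Finset.mem_sdiff.1 (Finset.mem_of_mem_erase (hU hx))).1
          · simp
          · intro p hp
            rw [pw_eq, hr p hp, sub_self]
          · intro p hp
            rw [pw_eq]
            by_contra hlt
            have hr0 : 0 ≤ r := by
              obtain ⟨q, hq⟩ : t.Nonempty := by rw [← Finset.card_pos]; omega
              rw [← hr q hq]; exact dist_nonneg
            have hlt : dist p z < r := by
              refine lt_of_pow_lt_pow_left₀ 2 hr0 (by linarith)
            rcases Finset.mem_union.1 (Finset.mem_coe.1 hp) with hp | hp
            · exact absurd (hr p hp) hlt.ne
            · have := hU hp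
              rw [Finset.mem_erase, Finset.mem_sdiff] at this
              exact this.1 (hc p this.2.1 hlt)
        · intro U hU V hV hUV
          have hU := Finset.mem_powerset.1 (Finset.mem_coe.1 hU)
          have hV := Finset.mem_powerset.1 (Finset.mem_coe.1 hV)
          have hd : ∀ U ⊆ (P \ t).erase c, Disjoint t U := fun U hU ↦
            Finset.disjoint_left.2 fun x hx hxU ↦
              (Finset.mem_sdiff.1 (Finset.mem_of_mem_erase (hU hxU))).2 hx
          have hUV : t ∪ U = t ∪ V := hUV
          rw [← Finset.union_sdiff_cancel_left (hd U hU), hUV,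
            Finset.union_sdiff_cancel_left (hd V hV)]
  have h2 : ∀ R ∈ P.powerset,
      (S.bipartiteBelow (fun t (R : Finset Pt) ↦ t ∈ Del (R : Set Pt)) R).card
      ≤ 2 * P.card := by
    intro R hR
    have hR := Finset.mem_powerset.1 hR
    have hsub : (R : Set Pt) ⊆ P := by exact_mod_cast hR
    calc _ ≤ (Del (R : Set Pt)).ncard := by
          rw [← ncard_coe_finset]
          exact ncard_le_ncard (fun t ht ↦ (Finset.mem_filter.1 (Finset.mem_coe.1 ht)).2)
            (Del.finite R)
      _ ≤ 2 * R.card := Del.ncard_le (hP.mono hsub) (hinj.mono hsub)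
      _ ≤ 2 * P.card := by have := Finset.card_le_card hR; omega
  have h3 := Finset.sum_le_sum h1
  rw [Finset.sum_card_bipartiteAbove_eq_sum_card_bipartiteBelow] at h3
  have h4 := h3.trans (Finset.sum_le_sum h2)
  rw [Finset.sum_const, Finset.sum_const, Finset.card_powerset, smul_eq_mul, smul_eq_mul] at h4
  have h5 : 2 ^ P.card ≤ 16 * 2 ^ (P.card - 4) := by
    rw [show (16 : ℕ) = 2 ^ 4 by norm_num, ← pow_add]
    exact Nat.pow_le_pow_right (by norm_num) (by omega)
  have h6 : 0 < 2 ^ (P.card - 4) := by positivity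
  nlinarith

theorem ncard_le_two_pow {P : Finset Pt} (hP : GP (P : Set Pt))
    (hinj : InjOn (fun p : Pt ↦ p 0) (P : Set Pt)) :
    {T : Set (Finset Pt) | IsOrderDT (P : Set Pt) 1 T}.ncard ≤ 2 ^ (32 * P.card) := by
  classical
  let S := (P.powersetCard 3).filter (OrderKTri (P : Set Pt) 1)
  have hS : ∀ t ∈ S, t.card = 3 ∧ (t : Set Pt) ⊆ P ∧ OrderKTri P 1 t := by
    intro t ht
    obtain ⟨h1, h2⟩ := Finset.mem_filter.1 ht
    obtain ⟨h3, h4⟩ := Finset.mem_powersetCard.1 h1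
    exact ⟨h4, by exact_mod_cast h3, h2⟩
  calc _ ≤ (𝒫 (S : Set (Finset Pt))).ncard := by
        refine ncard_le_ncard (fun T hT t ht ↦ ?_) S.finite_toSet.finite_subsets
        have := hT.1.2.1 t ht
        exact Finset.mem_coe.2 (Finset.mem_filter.2 ⟨Finset.mem_powersetCard.2
          ⟨by exact_mod_cast this.2, this.1⟩, hT.2 t ht⟩)
    _ = 2 ^ S.card := by rw [ncard_powerset _ S.finite_toSet, ncard_coe_finset]
    _ ≤ _ := Nat.pow_le_pow_right (by norm_num) (card_orderKTri_le hP hinj hS)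

theorem measurableSet_unitSq : MeasurableSet unitSq := by
  have : IsClosed unitSq := by
    have e : unitSq = (fun p : Pt ↦ p 0) ⁻¹' Icc 0 1 ∩ (fun p : Pt ↦ p 1) ⁻¹' Icc 0 1 := rfl
    rw [e]
    exact (isClosed_Icc.preimage (by fun_prop)).inter (isClosed_Icc.preimage (by fun_prop))
  exact this.measurableSet

theorem volume_unitSq : volume unitSq = 1 := by
  have h := (EuclideanSpace.volume_preserving_symm_measurableEquiv_toLp (Fin 2)).measure_preimage
    (s := Set.pi univ fun _ ↦ Icc (0 : ℝ) 1)
    (MeasurableSet.univ_pi fun _ ↦ measurableSet_Icc).nullMeasurableSet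
  rw [volume_pi_pi] at h
  simp at h
  rw [← h]
  congr 1
  ext p
  simp [unitSq, Pi.le_def, and_assoc]
  tauto

instance : IsProbabilityMeasure unifSq := ⟨by
  rw [unifSq, Measure.restrict_apply_univ, volume_unitSq]⟩

instance (n : ℕ) : IsProbabilityMeasure (conf n) := by unfold conf; infer_instance

theorem conf_null {n : ℕ} {B : Set (Fin n → Pt)} (hB : MeasurableSet B) (i : Fin n)
    (h : ∀ x, volume {p | Function.update x i p ∈ B} = 0) : conf n B = 0 := by
  rw [← lintegral_indicator_one hB, conf]
  have hm : Measurable (B.indicator (1 : (Fin n → Pt) → ENNReal)) := measurable_one.indicator hB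
  rw [lintegral_eq_lmarginal_univ 0, lmarginal_erase' _ hm (Finset.mem_univ i)]
  have : (fun x ↦ ∫⁻ p, B.indicator (1 : (Fin n → Pt) → ENNReal) (Function.update x i p) ∂unifSq)
      = fun _ ↦ 0 := by
    funext x
    have e : (fun p ↦ B.indicator (1 : (Fin n → Pt) → ENNReal) (Function.update x i p)) =
        {p | Function.update x i p ∈ B}.indicator 1 := by
      funext p; simp [indicator]
    rw [e, lintegral_indicator_one]
    · exact nonpos_iff_eq_zero.1 ((Measure.restrict_apply_le _ _).trans (h x).le)
    · exact (measurable_update x) hB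
  rw [this]
  simp [lmarginal]

/-- The incircle determinant. -/
def inc (u v w y : Pt) : ℝ :=
  ((u 0 - y 0) ^ 2 + (u 1 - y 1) ^ 2) * crs y v w - ((v 0 - y 0) ^ 2 + (v 1 - y 1) ^ 2) * crs y u w
    + ((w 0 - y 0) ^ 2 + (w 1 - y 1) ^ 2) * crs y u v

theorem inc_eq {u v w : Pt} {z : Pt} {k : ℝ} (hu : pw z k u = 0) (hv : pw z k v = 0)
    (hw : pw z k w = 0) (y : Pt) : inc u v w y = - crs u v w * pw z k y := by
  simp only [inc, crs, pw] at *
  linear_combination ((v 0 - y 0) * (w 1 - y 1) - (v 1 - y 1) * (w 0 - y 0)) * hu -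
    ((u 0 - y 0) * (w 1 - y 1) - (u 1 - y 1) * (w 0 - y 0)) * hv +
    ((u 0 - y 0) * (v 1 - y 1) - (u 1 - y 1) * (v 0 - y 0)) * hw

theorem volume_circle (z : Pt) (k : ℝ) : volume {p : Pt | pw z k p = 0} = 0 := by
  refine measure_mono_null ?_ (Measure.addHaar_sphere volume z √k)
  intro p hp
  have hp : pw z k p = 0 := hp
  rw [pw_eq] at hp
  rw [Metric.mem_sphere, ← Real.sqrt_sq (dist_nonneg (x := p) (y := z))]
  congr 1; linarith

@[fun_prop]
theorem Continuous.crs {X : Type*} [TopologicalSpace X] {f g h : X → Pt} (hf : Continuous f)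
    (hg : Continuous g) (hh : Continuous h) : Continuous fun x ↦ crs (f x) (g x) (h x) := by
  unfold _root_.crs; fun_prop

theorem ae_generic (n : ℕ) :
    ∀ᵐ x ∂conf n, Function.Injective (fun i ↦ x i 0) ∧ GP (range x) := by
  have h1 : ∀ᵐ x ∂conf n, ∀ i j : Fin n, i ≠ j → x i 0 ≠ x j 0 := by
    simp only [ae_all_iff]
    intro i j hij
    have := conf_null (B := {x : Fin n → Pt | x i 0 = x j 0}) ?_ j fun x ↦ ?_
    · exact measure_mono_null (fun x hx ↦ not_not.1 hx) this
    · exact (isClosed_eq (by fun_prop) (by fun_prop)).measurableSet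
    · convert volume_line (-(x i 0)) 1 0 (by simp) using 2
      ext p
      simp only [mem_ofPred_eq, Function.update_self, Function.update_of_ne hij]
      constructor <;> intro h <;> linarith
  have h2 : ∀ᵐ x ∂conf n, ∀ i j k : Fin n, i ≠ k → j ≠ k → x i ≠ x j →
      crs (x i) (x j) (x k) ≠ 0 := by
    simp only [ae_all_iff]
    intro i j k hik hjk
    have := conf_null (B := {x : Fin n → Pt | x i ≠ x j ∧ crs (x i) (x j) (x k) = 0}) ?_ k
      fun x ↦ ?_
    · refine measure_mono_null (fun x hx ↦ ?_) this
      simpa using hx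
    · exact (isClosed_eq (by fun_prop) (by fun_prop)).measurableSet.compl.inter
        (isClosed_eq (by fun_prop) (by fun_prop)).measurableSet
    · by_cases hij : x i = x j
      · simp [Function.update_of_ne hik, Function.update_of_ne hjk, hij]
      · refine measure_mono_null ?_ (volume_crs hij)
        intro p hp
        simpa [Function.update_of_ne hik, Function.update_of_ne hjk, hij] using hp
  have h3 : ∀ᵐ x ∂conf n, ∀ i j k l : Fin n, i ≠ l → j ≠ l → k ≠ l →
      crs (x i) (x j) (x k) ≠ 0 → inc (x i) (x j) (x k) (x l) ≠ 0 := by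
    simp only [ae_all_iff]
    intro i j k l hil hjl hkl
    have := conf_null (B := {x : Fin n → Pt | crs (x i) (x j) (x k) ≠ 0 ∧
      inc (x i) (x j) (x k) (x l) = 0}) ?_ l fun x ↦ ?_
    · refine measure_mono_null (fun x hx ↦ ?_) this
      simpa using hx
    · refine (isClosed_eq (by fun_prop) (by fun_prop)).measurableSet.compl.inter
        (isClosed_eq ?_ (by fun_prop)).measurableSet
      unfold inc; fun_prop
    · by_cases hijk : crs (x i) (x j) (x k) = 0
      · simp [Function.update_of_ne hil, Function.update_of_ne hjl, Function.update_of_ne hkl, hijk]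
      · obtain ⟨z, r, h1, h2, h3⟩ := exists_circle hijk
        refine measure_mono_null ?_ (volume_circle z r)
        intro p hp
        simpa [Function.update_of_ne hil, Function.update_of_ne hjl, Function.update_of_ne hkl,
          hijk, inc_eq h1 h2 h3] using hp
  filter_upwards [h1, h2, h3] with x h1 h2 h3
  have ne : ∀ {i j}, x i ≠ x j → i ≠ j := fun h h' ↦ h (congrArg x h')
  refine ⟨fun i j hij ↦ by_contra fun h ↦ h1 i j h hij, ⟨?_, ?_⟩⟩
  · rintro _ ⟨i, rfl⟩ _ ⟨j, rfl⟩ _ ⟨k, rfl⟩ hij hik hjk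
    exact h2 i j k (ne hik) (ne hjk) hij
  · rintro _ ⟨i, rfl⟩ _ ⟨j, rfl⟩ _ ⟨k, rfl⟩ _ ⟨l, rfl⟩ hij hik hil hjk hjl hkl z r hi hj hk hl
    have := h3 i j k l (ne hil) (ne hjl) (ne hkl) (h2 i j k (ne hik) (ne hjk) hij)
    rw [inc_eq hi hj hk, hl, mul_zero] at this
    exact this rfl

/-- Projections of countable unions of closed sets are measurable. -/
theorem measurableSet_exists_closed {X Y ι : Type*} [TopologicalSpace X] [TopologicalSpace Y]
    [SigmaCompactSpace X] [SigmaCompactSpace Y] [T2Space X] [MeasurableSpace X] [BorelSpace X]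
    [Countable ι] {C : ι → Set (X × Y)} (hC : ∀ k, IsClosed (C k)) :
    MeasurableSet {x | ∃ y, ∃ k, (x, y) ∈ C k} := by
  have e : {x | ∃ y, ∃ k, (x, y) ∈ C k} = ⋃ k, Prod.fst '' C k := by
    ext x; simp; tauto
  rw [e]
  refine MeasurableSet.iUnion fun k ↦ ?_
  obtain ⟨K, hK, hKC⟩ := (isSigmaCompact_univ.of_isClosed_subset (hC k) (subset_univ _)).image
    continuous_fst
  rw [← hKC]
  exact MeasurableSet.iUnion fun m ↦ (hK m).measurableSet

section
variable {n : ℕ}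

theorem isClosed_mem_convexHull (s : Set (Fin n)) :
    IsClosed {q : (Fin n → Pt) × Pt | q.2 ∈ convexHull ℝ (q.1 '' s)} := by
  let K : Set (Fin n → ℝ) := convexHull ℝ ((fun i ↦ Pi.single i 1) '' s)
  have hK : IsCompact K := (s.toFinite.image _).isCompact_convexHull (𝕜 := ℝ)
  have : CompactSpace K := isCompact_iff_compactSpace.1 hK
  let C : Set (((Fin n → Pt) × Pt) × K) :=
    {q | Fintype.linearCombination ℝ q.1.1 (q.2 : Fin n → ℝ) = q.1.2}
  have hC : IsClosed C := by
    refine isClosed_eq ?_ (by fun_prop)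
    simp only [Fintype.linearCombination_apply]
    refine continuous_finsetSum _ fun i _ ↦ Continuous.fun_smul ?_ ?_
    · exact (continuous_apply i).comp (continuous_subtype_val.comp continuous_snd)
    · exact (continuous_apply i).comp (continuous_fst.comp continuous_fst)
  convert isClosedMap_fst_of_compactSpace _ hC using 1
  ext ⟨x, z⟩
  have e : x '' s = Fintype.linearCombination ℝ x '' ((fun i ↦ Pi.single i 1) '' s) := by
    rw [image_image]
    refine image_congr fun i _ ↦ ?_
    simp [Fintype.linearCombination_apply_single]
  simp only [mem_ofPred_eq, e, ← LinearMap.image_convexHull]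
  constructor
  · rintro ⟨w, hw, h⟩
    exact ⟨((x, z), ⟨w, hw⟩), h, rfl⟩
  · rintro ⟨⟨⟨x', z'⟩, w⟩, h, he⟩
    obtain ⟨rfl, rfl⟩ := Prod.mk.inj he
    exact ⟨w, w.2, h⟩

theorem mem_interior_iff_closedBall {A : Set Pt} {z : Pt} :
    z ∈ interior A ↔ ∃ m : ℕ, ∀ w ∈ Metric.closedBall (0 : Pt) (1 / (m + 1)), z + w ∈ A := by
  constructor
  · intro h
    obtain ⟨ε, hε, hsub⟩ := Metric.mem_nhds_iff.1 (mem_interior_iff_mem_nhds.1 h)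
    obtain ⟨m, hm⟩ := exists_nat_one_div_lt hε
    refine ⟨m, fun w hw ↦ hsub ?_⟩
    rw [mem_closedBall_zero_iff] at hw
    simpa using hw.trans_lt hm
  · rintro ⟨m, hm⟩
    refine mem_interior_iff_mem_nhds.2 (Metric.mem_nhds_iff.2 ⟨1 / (m + 1), by positivity, ?_⟩)
    intro y hy
    have := hm (y - z) (by
      rw [mem_closedBall_zero_iff, ← dist_eq_norm]; exact (Metric.mem_ball.1 hy).le)
    simpa using this

theorem measurableSet_interior_inter (s t : Set (Fin n)) :
    MeasurableSet {x : Fin n → Pt | interior (convexHull ℝ (x '' s)) ∩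
      interior (convexHull ℝ (x '' t)) = ∅} := by
  let C (k : ℕ × ℕ) : Set ((Fin n → Pt) × Pt) :=
    (⋂ w ∈ Metric.closedBall (0 : Pt) (1 / (k.1 + 1)),
      {q | q.2 + w ∈ convexHull ℝ (q.1 '' s)}) ∩
    ⋂ w ∈ Metric.closedBall (0 : Pt) (1 / (k.2 + 1)), {q | q.2 + w ∈ convexHull ℝ (q.1 '' t)}
  have hC : ∀ k, IsClosed (C k) := fun k ↦ by
    have key : ∀ (s : Set (Fin n)) (w : Pt),
        IsClosed {q : (Fin n → Pt) × Pt | q.2 + w ∈ convexHull ℝ (q.1 '' s)} := fun s w ↦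
      (isClosed_mem_convexHull s).preimage
        (f := fun q : (Fin n → Pt) × Pt ↦ (q.1, q.2 + w)) (by fun_prop)
    exact (isClosed_biInter fun w _ ↦ key s w).inter (isClosed_biInter fun w _ ↦ key t w)
  convert (measurableSet_exists_closed hC).compl using 1
  ext x
  simp only [mem_ofPred_eq, mem_compl_iff, not_exists, eq_empty_iff_forall_notMem, mem_inter_iff,
    mem_interior_iff_closedBall, C, mem_iInter, Prod.forall]
  grind

theorem measurableSet_iUnion_eq (F : Finset (Finset (Fin n))) :
    MeasurableSet {x : Fin n → Pt | (⋃ s ∈ F, convexHull ℝ (x '' s)) = convexHull ℝ (range x)} := by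
  let U : Set ((Fin n → Pt) × Pt) := {q | ∃ s ∈ F, q.2 ∈ convexHull ℝ (q.1 '' (s : Set (Fin n)))}
  have hU : IsClosed U := by
    have : U = ⋃ s ∈ F, {q | q.2 ∈ convexHull ℝ (q.1 '' (s : Set (Fin n)))} := by
      ext q; simp [U]
    rw [this]
    exact isClosed_biUnion_finset fun s _ ↦ isClosed_mem_convexHull _
  obtain ⟨G, hG, -, hGU, -⟩ := hU.isOpen_compl.exists_iUnion_isClosed
  have hC : ∀ k, IsClosed (G k ∩ {q | q.2 ∈ convexHull ℝ (q.1 '' univ)}) := fun k ↦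
    (hG k).inter (isClosed_mem_convexHull _)
  convert (measurableSet_exists_closed hC).compl using 1
  ext x
  have hsub : (⋃ s ∈ F, convexHull ℝ (x '' s)) ⊆ convexHull ℝ (range x) :=
    iUnion₂_subset fun s _ ↦ convexHull_mono (image_subset_range _ _)
  have hmem : ∀ z, (∃ k, (x, z) ∈ G k) ↔ z ∉ ⋃ s ∈ F, convexHull ℝ (x '' s) := fun z ↦ by
    rw [← mem_iUnion, hGU]; simp [U]
  rw [mem_compl_iff, mem_ofPred_eq, mem_ofPred_eq, subset_antisymm_iff, and_iff_right hsub]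
  simp only [mem_inter_iff, mem_ofPred_eq, image_univ, exists_and_right, hmem]
  simp only [subset_def]
  push Not
  exact forall_congr' fun z ↦ not_imp_not.symm

theorem measurableSet_orderKTri (t : Finset (Fin n)) (k : ℕ) :
    MeasurableSet {x : Fin n → Pt | ∃ zr : Pt × ℝ, ∃ S : Finset (Fin n),
      S.card ≤ k ∧ (∀ i ∈ t, dist (x i) zr.1 = zr.2) ∧ ∀ i ∉ S, zr.2 ≤ dist (x i) zr.1} := by
  refine measurableSet_exists_closed (C := fun S : Finset (Fin n) ↦ {q : (Fin n → Pt) × Pt × ℝ |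
    S.card ≤ k ∧ (∀ i ∈ t, dist (q.1 i) q.2.1 = q.2.2) ∧ ∀ i ∉ S, q.2.2 ≤ dist (q.1 i) q.2.1})
    fun S ↦ ?_
  simp only [ofPred_and, ofPred_forall]
  refine isClosed_const.inter (IsClosed.inter ?_ ?_)
  · exact isClosed_iInter fun i ↦ isClosed_iInter fun _ ↦ isClosed_eq (by fun_prop) (by fun_prop)
  · exact isClosed_iInter fun i ↦ isClosed_iInter fun _ ↦ isClosed_le (by fun_prop) (by fun_prop)

/-- The combinatorial description of an order-`k` Delaunay triangulation of `range x`. -/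
def IndexDT (k : ℕ) (F : Finset (Finset (Fin n))) (x : Fin n → Pt) : Prop :=
  (∀ t ∈ F, t.card = 3) ∧ (∀ i, ∃ t ∈ F, i ∈ t) ∧
  (∀ t ∈ F, ∀ s ∈ F, t ≠ s →
    interior (convexHull ℝ (x '' t)) ∩ interior (convexHull ℝ (x '' s)) = ∅) ∧
  (⋃ s ∈ F, convexHull ℝ (x '' s)) = convexHull ℝ (range x) ∧
  ∀ t ∈ F, ∃ zr : Pt × ℝ, ∃ S : Finset (Fin n),
    S.card ≤ k ∧ (∀ i ∈ t, dist (x i) zr.1 = zr.2) ∧ ∀ i ∉ S, zr.2 ≤ dist (x i) zr.1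

theorem measurableSet_indexDT (k : ℕ) (F : Finset (Finset (Fin n))) :
    MeasurableSet {x : Fin n → Pt | IndexDT k F x} := by
  simp only [IndexDT, ofPred_and, ofPred_forall]
  refine (MeasurableSet.iInter fun _ ↦ MeasurableSet.iInter fun _ ↦ .const _).inter <|
    (MeasurableSet.iInter fun _ ↦ .const _).inter <| MeasurableSet.inter ?_ <|
    (measurableSet_iUnion_eq F).inter ?_
  · exact MeasurableSet.iInter fun t ↦ MeasurableSet.iInter fun _ ↦ MeasurableSet.iInter fun s ↦
      MeasurableSet.iInter fun _ ↦ MeasurableSet.iInter fun _ ↦ measurableSet_interior_inter _ _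
  · exact MeasurableSet.iInter fun t ↦ MeasurableSet.iInter fun _ ↦ measurableSet_orderKTri t k

theorem orderKTri_image {x : Fin n → Pt} (hx : Function.Injective x) {k : ℕ}
    {t : Finset (Fin n)} : OrderKTri (range x) k (t.image x) ↔
    ∃ zr : Pt × ℝ, ∃ S : Finset (Fin n),
      S.card ≤ k ∧ (∀ i ∈ t, dist (x i) zr.1 = zr.2) ∧ ∀ i ∉ S, zr.2 ≤ dist (x i) zr.1 := by
  classical
  have e : ∀ z r, {p ∈ range x | dist p z < r} =
      x '' (Finset.univ.filter fun i ↦ dist (x i) z < r : Finset (Fin n)) := by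
    intro z r; ext p; simp; grind
  have e' : ∀ z r, {p ∈ range x | dist p z < r}.encard ≤ (k : ℕ∞) ↔
      (Finset.univ.filter fun i ↦ dist (x i) z < r : Finset (Fin n)).card ≤ k := by
    intro z r
    rw [e, hx.encard_image, encard_coe_eq_coe_finsetCard, Nat.cast_le]
  constructor
  · rintro ⟨z, r, h1, h2⟩
    refine ⟨(z, r), _, (e' z r).1 h2, fun i hi ↦ h1 _ (Finset.mem_image_of_mem _ hi), ?_⟩
    simp
  · rintro ⟨⟨z, r⟩, S, hS, h1, h2⟩
    refine ⟨z, r, ?_, (e' z r).2 (le_trans (Finset.card_le_card ?_) hS)⟩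
    · simpa using h1
    · intro i hi
      by_contra h
      exact absurd (Finset.mem_filter.1 hi).2 (not_lt.2 (h2 i h))

theorem isOrderDT_image {x : Fin n → Pt} (hx : Function.Injective x) {k : ℕ}
    {F : Finset (Finset (Fin n))} :
    IsOrderDT (range x) k (Finset.image x '' F) ↔ IndexDT k F x := by
  have hinj : Function.Injective (Finset.image x) := Finset.image_injective hx
  rw [IsOrderDT, IsTriangulation, IndexDT, and_iff_right (F.finite_toSet.image _)]
  simp only [forall_mem_image, Finset.mem_coe, orderKTri_image hx, and_assoc,
    Finset.card_image_of_injective _ hx, forall_mem_range, exists_mem_image, Set.Pairwise,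
    hinj.ne_iff, triSet, Finset.coe_image, biUnion_image, image_subset_range, and_true,
    hx.mem_finset_image]

theorem ncard_isOrderDT {x : Fin n → Pt} (hx : Function.Injective x) (k : ℕ) :
    ({T : Set (Finset Pt) | IsOrderDT (range x) k T}.ncard : ℝ) =
      ∑ F : Finset (Finset (Fin n)), {x | IndexDT k F x}.indicator 1 x := by
  classical
  have hinj : Function.Injective (Finset.image x) := Finset.image_injective hx
  have e : {T : Set (Finset Pt) | IsOrderDT (range x) k T} =
      (fun F : Finset (Finset (Fin n)) ↦ Finset.image x '' (F : Set (Finset (Fin n)))) ''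
        (Finset.univ.filter (IndexDT k · x) : Finset (Finset (Finset (Fin n)))) := by
    ext T
    constructor
    · intro hT
      have hsub : T ⊆ range (Finset.image x) := by
        intro t ht
        obtain ⟨s, -, hs⟩ := Finset.subset_set_image_iff (s := univ).1
          (by rw [image_univ]; exact (hT.1.2.1 t ht).2)
        exact ⟨s, hs⟩
      have hfin : (Finset.image x ⁻¹' T).Finite := toFinite _
      have hT' : Finset.image x '' (hfin.toFinset : Set (Finset (Fin n))) = T := by
        rw [hfin.coe_toFinset, image_preimage_eq_of_subset hsub]
      refine ⟨hfin.toFinset, ?_, hT'⟩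
      simp only [Finset.coe_filter, Finset.mem_univ, true_and, mem_ofPred_eq]
      rw [← isOrderDT_image hx, hT']; exact hT
    · rintro ⟨F, hF, rfl⟩
      simp only [Finset.coe_filter, Finset.mem_univ, true_and, mem_ofPred_eq] at hF
      exact (isOrderDT_image hx).2 hF
  rw [e, ncard_image_of_injective, ncard_coe_finset, Finset.card_filter]
  · simp [indicator]
  · intro F G h
    exact Finset.coe_injective (hinj.image_injective h)

theorem aestronglyMeasurable_ncard (n k : ℕ) : AEStronglyMeasurable
    (fun x : Fin n → Pt ↦ ({T : Set (Finset Pt) | IsOrderDT (range x) k T}.ncard : ℝ))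
    (conf n) := by
  have hm : Measurable fun x : Fin n → Pt ↦
      ∑ F : Finset (Finset (Fin n)), {x | IndexDT k F x}.indicator (1 : (Fin n → Pt) → ℝ) x :=
    Finset.measurable_sum _ fun F _ ↦ measurable_one.indicator (measurableSet_indexDT k F)
  refine hm.aestronglyMeasurable.congr ?_
  filter_upwards [ae_generic n] with x hx
  exact (ncard_isOrderDT (fun i j h ↦ hx.1 (congrArg (fun p : Pt ↦ p 0) h)) k).symm

end

/-- The area of the part of a disk on the left of a chord of length `2 * a`, where `s` is the signed
distance of the centre from the chord. -/
def cap (a s : ℝ) : ℝ := (a ^ 2 + s ^ 2) * (Real.pi / 2 + Real.arctan (s / a)) + a * s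

/-- The derivative of `cap a`. -/
def cap' (a s : ℝ) : ℝ := 2 * s * (Real.pi / 2 + Real.arctan (s / a)) + 2 * a

theorem hasDerivAt_cap {a : ℝ} (ha : 0 < a) (s : ℝ) : HasDerivAt (cap a) (cap' a s) s := by
  have h1 : HasDerivAt (fun s : ℝ ↦ a ^ 2 + s ^ 2) (2 * s) s := by
    simpa using (hasDerivAt_pow 2 s).const_add (a ^ 2)
  have h2 : HasDerivAt (fun s : ℝ ↦ Real.pi / 2 + Real.arctan (s / a))
      (1 / (1 + (s / a) ^ 2) * (1 / a)) s :=
    (((hasDerivAt_id s).div_const a).arctan).const_add _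
  have h3 : HasDerivAt (fun s : ℝ ↦ a * s) a s := by simpa using (hasDerivAt_id s).const_mul a
  refine ((h1.fun_mul h2).fun_add h3).congr_deriv ?_
  have : a ^ 2 + s ^ 2 ≠ 0 := by positivity
  rw [cap']
  field_simp
  ring

theorem integral_sqrt_sub_sq {R t : ℝ} (hR : 0 < R) (h1 : -R < t) (h2 : t ≤ R) :
    ∫ x in t..R, 2 * √(R ^ 2 - x ^ 2) =
      R ^ 2 * (Real.pi / 2) - (t * √(R ^ 2 - t ^ 2) + R ^ 2 * Real.arcsin (t / R)) := by
  have hderiv : ∀ x ∈ Ioo t R, HasDerivAt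
      (fun x ↦ x * √(R ^ 2 - x ^ 2) + R ^ 2 * Real.arcsin (x / R)) (2 * √(R ^ 2 - x ^ 2)) x := by
    intro x hx
    have hx1 : -R < x := h1.trans hx.1
    have hpos : 0 < R ^ 2 - x ^ 2 := by nlinarith [hx.2]
    have e1 : HasDerivAt (fun x : ℝ ↦ R ^ 2 - x ^ 2) (-(2 * x)) x := by
      simpa using (hasDerivAt_pow 2 x).const_sub (R ^ 2)
    have e2 := (hasDerivAt_id x).fun_mul (e1.sqrt hpos.ne')
    have hne : x / R ≠ -1 := by
      intro h; rw [div_eq_iff hR.ne'] at h; linarith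
    have hne' : x / R ≠ 1 := by
      intro h; rw [div_eq_iff hR.ne'] at h; linarith [hx.2]
    have e3 := ((Real.hasDerivAt_arcsin hne hne').comp x ((hasDerivAt_id x).div_const R)).const_mul
      (R ^ 2)
    refine (e2.fun_add e3).congr_deriv ?_
    have hs : √(1 - (x / R) ^ 2) = √(R ^ 2 - x ^ 2) / R := by
      rw [show 1 - (x / R) ^ 2 = (R ^ 2 - x ^ 2) / R ^ 2 by field_simp, Real.sqrt_div hpos.le,
        Real.sqrt_sq hR.le]
    simp only [id_eq, hs]
    have h0 : 0 < √(R ^ 2 - x ^ 2) := Real.sqrt_pos.2 hpos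
    have hsq := Real.sq_sqrt hpos.le
    field_simp
    linear_combination -hsq
  have hcont : Continuous fun x ↦ x * √(R ^ 2 - x ^ 2) + R ^ 2 * Real.arcsin (x / R) :=
    (by fun_prop : Continuous fun x ↦ x * √(R ^ 2 - x ^ 2)).add
      (continuous_const.mul (Real.continuous_arcsin.comp (by fun_prop)))
  rw [intervalIntegral.integral_eq_sub_of_hasDerivAt_of_le h2 hcont.continuousOn hderiv
    (Continuous.intervalIntegrable (by fun_prop) _ _)]
  rw [div_self hR.ne', Real.arcsin_one]
  simp

theorem integral_cap {a : ℝ} (ha : 0 < a) (s : ℝ) :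
    ∫ y in 0..(s + √(a ^ 2 + s ^ 2)), 2 * √(a ^ 2 + s ^ 2 - (y - s) ^ 2) = cap a s := by
  set R := √(a ^ 2 + s ^ 2) with hR
  have hpos : 0 < a ^ 2 + s ^ 2 := by positivity
  have hR2 : R ^ 2 = a ^ 2 + s ^ 2 := Real.sq_sqrt hpos.le
  have hR0 : 0 < R := Real.sqrt_pos.2 hpos
  have habs := abs_lt.1 (abs_lt_of_sq_lt_sq (a := s) (b := R) (by rw [hR2]; nlinarith) hR0.le)
  rw [← hR2, intervalIntegral.integral_comp_sub_right (fun x ↦ 2 * √(R ^ 2 - x ^ 2)) s,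
    zero_sub, add_sub_cancel_left, integral_sqrt_sub_sq hR0 (by linarith) (by linarith), cap,
    Real.arctan_eq_arcsin]
  have e1 : √(R ^ 2 - (-s) ^ 2) = a := by
    rw [hR2, show a ^ 2 + s ^ 2 - (-s) ^ 2 = a ^ 2 by ring, Real.sqrt_sq ha.le]
  have e2 : s / a / √(1 + (s / a) ^ 2) = s / R := by
    rw [show 1 + (s / a) ^ 2 = R ^ 2 / a ^ 2 by rw [hR2]; field_simp,
      Real.sqrt_div (by positivity), Real.sqrt_sq ha.le, Real.sqrt_sq hR0.le]
    field_simp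
  rw [e1, e2, ← hR2, neg_div, Real.arcsin_neg]
  ring

/-- Area of a circular segment, in canonical position. -/
theorem volume_segment {a : ℝ} (ha : 0 < a) (s : ℝ) :
    volume {p : Pt | 0 < p 0 ∧ p 0 ^ 2 + p 1 ^ 2 - a ^ 2 < 2 * s * p 0} =
      ENNReal.ofReal (cap a s) := by
  set R := √(a ^ 2 + s ^ 2) with hR
  have hpos : 0 < a ^ 2 + s ^ 2 := by positivity
  have hR2 : R ^ 2 = a ^ 2 + s ^ 2 := Real.sq_sqrt hpos.le
  have hR0 : 0 < R := Real.sqrt_pos.2 hpos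
  have habs := abs_lt.1 (abs_lt_of_sq_lt_sq (a := s) (b := R) (by rw [hR2]; nlinarith) hR0.le)
  let f : ℝ → ℝ := fun y ↦ √(a ^ 2 + s ^ 2 - (y - s) ^ 2)
  have hf : Continuous f := by fun_prop
  have hpres : MeasurePreserving (fun p : Pt ↦ (p 0, p 1)) volume volume :=
    (volume_preserving_finTwoArrow ℝ).comp (PiLp.volume_preserving_ofLp (Fin 2))
  have hset : {p : Pt | 0 < p 0 ∧ p 0 ^ 2 + p 1 ^ 2 - a ^ 2 < 2 * s * p 0} =
      (fun p : Pt ↦ (p 0, p 1)) ⁻¹' regionBetween (fun y ↦ -f y) f (Ioc 0 (s + R)) := by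
    ext p
    simp only [mem_ofPred_eq, mem_preimage, regionBetween, mem_Ioc, mem_Ioo, f, ← abs_lt]
    constructor
    · rintro ⟨h0, h1⟩
      refine ⟨⟨h0, ?_⟩, Real.lt_sqrt (abs_nonneg _) |>.2 (by rw [sq_abs]; nlinarith)⟩
      have : p 0 - s < R := lt_of_pow_lt_pow_left₀ 2 hR0.le (by nlinarith [sq_nonneg (p 1)])
      linarith
    · rintro ⟨⟨h0, -⟩, h1⟩
      rw [Real.lt_sqrt (abs_nonneg _), sq_abs] at h1
      exact ⟨h0, by nlinarith⟩
  rw [hset, hpres.measure_preimage (measurableSet_regionBetween (by fun_prop) (by fun_prop)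
    measurableSet_Ioc).nullMeasurableSet, Measure.volume_eq_prod,
    volume_regionBetween_eq_integral (f := fun y ↦ -f y)
      ((hf.neg.integrableOn_Icc).mono_set Ioc_subset_Icc_self)
      ((hf.integrableOn_Icc).mono_set Ioc_subset_Icc_self) measurableSet_Ioc]
  · rw [← integral_cap ha, intervalIntegral.integral_of_le (by linarith)]
    congr 2
    funext y
    simp [f]; ring
  · intro y _
    have := Real.sqrt_nonneg (a ^ 2 + s ^ 2 - (y - s) ^ 2)
    simp only [f]; linarith

/-- The signed distance from the line `u v` (positive on the left) of the centre of the circle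
through `u`, `v`, `p`. -/
def ctr (u v p : Pt) : ℝ :=
  dist u v / 2 * ((p 0 - u 0) * (p 0 - v 0) + (p 1 - u 1) * (p 1 - v 1)) / crs u v p

theorem exists_canonical {u v : Pt} (huv : u ≠ v) : ∃ f : Pt →ₗ[ℝ] Pt, |LinearMap.det f| = 1 ∧
    ∀ p : Pt, crs u v (f p + (1 / 2 : ℝ) • (u + v)) = dist u v * p 0 ∧
    ((f p + (1 / 2 : ℝ) • (u + v)) 0 - u 0) * ((f p + (1 / 2 : ℝ) • (u + v)) 0 - v 0) +
      ((f p + (1 / 2 : ℝ) • (u + v)) 1 - u 1) * ((f p + (1 / 2 : ℝ) • (u + v)) 1 - v 1) =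
      p 0 ^ 2 + p 1 ^ 2 - (dist u v / 2) ^ 2 := by
  have hd : 0 < dist u v := dist_pos.2 huv
  have hd2 : dist u v ^ 2 = (u 0 - v 0) ^ 2 + (u 1 - v 1) ^ 2 := dist_sq_eq u v
  generalize dist u v = d at *
  let b := (EuclideanSpace.basisFun (Fin 2) ℝ).toBasis
  let A : Matrix (Fin 2) (Fin 2) ℝ :=
    !![-(v 1 - u 1) / d, (v 0 - u 0) / d; (v 0 - u 0) / d, (v 1 - u 1) / d]
  have happ : ∀ p : Pt, (Matrix.toLin b b A p) 0 = -(v 1 - u 1) / d * p 0 + (v 0 - u 0) / d * p 1 ∧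
      (Matrix.toLin b b A p) 1 = (v 0 - u 0) / d * p 0 + (v 1 - u 1) / d * p 1 := by
    intro p
    rw [Matrix.toLin_apply]
    simp [b, A, Matrix.mulVec, dotProduct, Fin.sum_univ_two]
  refine ⟨Matrix.toLin b b A, ?_, fun p ↦ ?_⟩
  · rw [LinearMap.det_toLin, Matrix.det_fin_two_of]
    have : -(v 1 - u 1) / d * ((v 1 - u 1) / d) - (v 0 - u 0) / d * ((v 0 - u 0) / d) = -1 := by
      field_simp; linear_combination hd2
    rw [this]; simp
  · simp only [crs, PiLp.add_apply, PiLp.smul_apply, smul_eq_mul, (happ p).1, (happ p).2]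
    constructor
    · field_simp
      linear_combination (-2 * p 0) * hd2
    · field_simp
      linear_combination (-4 * (p 0 ^ 2 + p 1 ^ 2) + d ^ 2) * hd2

theorem volume_ctr_lt {u v : Pt} (huv : u ≠ v) (s : ℝ) :
    volume {p | 0 < crs u v p ∧ ctr u v p < s} = ENNReal.ofReal (cap (dist u v / 2) s) := by
  obtain ⟨f, hf, hfp⟩ := exists_canonical huv
  have hd : 0 < dist u v := dist_pos.2 huv
  have hdet : LinearMap.det f ≠ 0 := by
    intro h; rw [h] at hf; simp at hf
  rw [← volume_segment (by positivity : 0 < dist u v / 2),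
    ← measure_preimage_add_right volume ((1 / 2 : ℝ) • (u + v)),
    ← one_mul (volume ((fun p ↦ p + _) ⁻¹' _))]
  have := Measure.addHaar_preimage_linearMap volume hdet
    ((fun p ↦ p + (1 / 2 : ℝ) • (u + v)) ⁻¹' {p | 0 < crs u v p ∧ ctr u v p < s})
  rw [abs_inv, hf, inv_one, ENNReal.ofReal_one] at this
  rw [← this]
  congr 1
  ext p
  simp only [mem_preimage, mem_ofPred_eq, ctr, (hfp p).1, (hfp p).2, mul_pos_iff_of_pos_left hd]
  refine and_congr_right fun h0 ↦ ?_
  rw [div_lt_iff₀ (by positivity)]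
  constructor <;> intro h <;> nlinarith

theorem measurable_crs : Measurable fun q : Pt × Pt × Pt ↦ crs q.1 q.2.1 q.2.2 :=
  (by fun_prop : Continuous fun q : Pt × Pt × Pt ↦ crs q.1 q.2.1 q.2.2).measurable

theorem measurable_ctr_right (u v : Pt) : Measurable (ctr u v) := by
  have h : Continuous fun p : Pt ↦ dist u v / 2 *
      ((p 0 - u 0) * (p 0 - v 0) + (p 1 - u 1) * (p 1 - v 1)) := by
    fun_prop
  exact h.measurable.div (by fun_prop : Continuous fun p ↦ crs u v p).measurable

theorem measurable_ctr : Measurable fun q : Pt × Pt × Pt ↦ ctr q.1 q.2.1 q.2.2 := by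
  have h : Continuous fun q : Pt × Pt × Pt ↦ dist q.1 q.2.1 / 2 *
      ((q.2.2 0 - q.1 0) * (q.2.2 0 - q.2.1 0) + (q.2.2 1 - q.1 1) * (q.2.2 1 - q.2.1 1)) := by
    fun_prop
  exact h.measurable.div measurable_crs

@[fun_prop]
theorem Measurable.ctr {X : Type*} [MeasurableSpace X] {f g h : X → Pt} (hf : Measurable f)
    (hg : Measurable g) (hh : Measurable h) : Measurable fun x ↦ _root_.ctr (f x) (g x) (h x) :=
  (measurable_ctr.comp (hf.prodMk (hg.prodMk hh)) :)

@[fun_prop]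
theorem Measurable.crs {X : Type*} [MeasurableSpace X] {f g h : X → Pt} (hf : Measurable f)
    (hg : Measurable g) (hh : Measurable h) : Measurable fun x ↦ _root_.crs (f x) (g x) (h x) :=
  measurable_crs.comp (hf.prodMk (hg.prodMk hh))

@[fun_prop]
theorem Measurable.cap {X : Type*} [MeasurableSpace X] {f g : X → ℝ} (hf : Measurable f)
    (hg : Measurable g) : Measurable fun x ↦ _root_.cap (f x) (g x) := by
  unfold _root_.cap
  have := Real.measurable_arctan.comp (hg.div hf)
  exact (((hf.pow_const 2).add (hg.pow_const 2)).mul (this.const_add _)).add (hf.mul hg)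

@[fun_prop]
theorem Measurable.cap' {X : Type*} [MeasurableSpace X] {f g : X → ℝ} (hf : Measurable f)
    (hg : Measurable g) : Measurable fun x ↦ _root_.cap' (f x) (g x) := by
  unfold _root_.cap'
  have := Real.measurable_arctan.comp (hg.div hf)
  exact ((hg.const_mul 2).mul (this.const_add _)).add (hf.const_mul 2)

theorem continuous_cap' (a : ℝ) : Continuous (cap' a) := by
  unfold cap'
  have : Continuous fun s : ℝ ↦ Real.arctan (s / a) := Real.continuous_arctan.comp (by fun_prop)
  fun_prop

theorem cap_nonneg {a : ℝ} (ha : 0 < a) (s : ℝ) : 0 ≤ cap a s := by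
  rw [← integral_cap ha]
  refine intervalIntegral.integral_nonneg ?_ fun _ _ ↦ by positivity
  have : -s ≤ √(a ^ 2 + s ^ 2) := Real.le_sqrt_of_sq_le (by nlinarith)
  linarith

theorem arctan_le_self {x : ℝ} (hx : 0 ≤ x) : Real.arctan x ≤ x := by
  rcases hx.eq_or_lt with rfl | hx
  · simp
  · have := Real.lt_tan (Real.arctan_pos.2 hx) (Real.arctan_lt_pi_div_two x)
    rw [Real.tan_arctan] at this
    exact this.le

theorem cap'_nonneg {a : ℝ} (ha : 0 < a) (s : ℝ) : 0 ≤ cap' a s := by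
  rw [cap']
  have h1 := Real.neg_pi_div_two_lt_arctan (s / a)
  rcases le_or_gt 0 s with hs | hs
  · have : 0 ≤ s * (Real.pi / 2 + Real.arctan (s / a)) := mul_nonneg hs (by linarith)
    linarith
  · have h2 : Real.pi / 2 + Real.arctan (s / a) ≤ a / (-s) := by
      have h3 := Real.arctan_inv_of_pos (x := -s / a) (div_pos (by linarith) ha)
      rw [inv_div, show -s / a = -(s / a) by ring, Real.arctan_neg] at h3
      have h4 := arctan_le_self (x := a / -s) (div_nonneg ha.le (by linarith))
      linarith
    rw [le_div_iff₀ (by linarith)] at h2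
    linarith

theorem integral_cap' {a : ℝ} (ha : 0 < a) (s t : ℝ) : ∫ x in s..t, cap' a x = cap a t - cap a s :=
  intervalIntegral.integral_eq_sub_of_hasDerivAt (fun x _ ↦ hasDerivAt_cap ha x)
    ((continuous_cap' a).intervalIntegrable _ _)

theorem map_ctr {u v : Pt} (huv : u ≠ v) :
    Measure.map (ctr u v) (volume.restrict {p | 0 < crs u v p}) =
      volume.withDensity fun s ↦ ENNReal.ofReal (cap' (dist u v / 2) s) := by
  have ha : 0 < dist u v / 2 := half_pos (dist_pos.2 huv)
  have hm := measurable_ctr_right u v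
  have hset : MeasurableSet {p | 0 < crs u v p} := measurableSet_lt (by fun_prop) (by fun_prop)
  have key : ∀ s t, s < t → Measure.map (ctr u v) (volume.restrict {p | 0 < crs u v p}) (Ico s t) =
      ENNReal.ofReal (cap (dist u v / 2) t - cap (dist u v / 2) s) := by
    intro s t hst
    rw [Measure.map_apply hm measurableSet_Ico, Measure.restrict_apply (hm measurableSet_Ico)]
    have e : ctr u v ⁻¹' Ico s t ∩ {p | 0 < crs u v p} =
        {p | 0 < crs u v p ∧ ctr u v p < t} \ {p | 0 < crs u v p ∧ ctr u v p < s} := by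
      ext p; simp only [mem_inter_iff, mem_preimage, mem_Ico, mem_ofPred_eq, mem_sdiff]; grind
    rw [e, measure_sdiff, volume_ctr_lt huv, volume_ctr_lt huv,
      ENNReal.ofReal_sub _ (cap_nonneg ha _)]
    · exact fun p hp ↦ ⟨hp.1, hp.2.trans hst⟩
    · exact (hset.inter (measurableSet_lt hm measurable_const)).nullMeasurableSet
    · rw [volume_ctr_lt huv]; exact ENNReal.ofReal_ne_top
  refine Measure.ext_of_Ico' _ _ (fun s t hst ↦ ?_) fun s t hst ↦ ?_
  · rw [key s t hst]; exact ENNReal.ofReal_ne_top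
  · rw [key s t hst, withDensity_apply _ measurableSet_Ico, ← integral_cap' ha,
      intervalIntegral.integral_of_le hst.le, ← integral_Ico_eq_integral_Ioc,
      ofReal_integral_eq_lintegral_ofReal]
    · exact ((continuous_cap' _).integrableOn_Icc).mono_set Ico_subset_Icc_self
    · exact Filter.Eventually.of_forall fun x ↦ cap'_nonneg ha x

/-- Integrating a function of the circle through `u`, `v`, `p` over the points `p` on the left. -/
theorem lintegral_ctr {u v : Pt} (huv : u ≠ v) {F : ℝ → ENNReal} (hF : Measurable F) :
    ∫⁻ p in {p | 0 < crs u v p}, F (ctr u v p) =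
      ∫⁻ s, ENNReal.ofReal (cap' (dist u v / 2) s) * F s := by
  rw [← lintegral_map hF (measurable_ctr_right u v), map_ctr huv,
    lintegral_withDensity_eq_lintegral_mul _
    (by fun_prop) hF]
  rfl

theorem ctr_swap (u v p : Pt) : ctr v u p = -ctr u v p := by
  rw [ctr, ctr, crs_swap u v p, dist_comm, div_neg]
  ring

/-- The circles through `u` and `v`, parametrised by the signed distance of their centre. -/
theorem exists_pw_eq {u v : Pt} (huv : u ≠ v) (s : ℝ) : ∃ z k, pw z k u = 0 ∧ pw z k v = 0 ∧
    ∀ p, crs u v p ≠ 0 → pw z k p = 2 * crs u v p / dist u v * (ctr u v p - s) := by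
  have hd : 0 < dist u v := dist_pos.2 huv
  have hd2 : dist u v ^ 2 = (u 0 - v 0) ^ 2 + (u 1 - v 1) ^ 2 := dist_sq_eq u v
  have key : ∀ p, pw !₂[(u 0 + v 0) / 2 - s * (v 1 - u 1) / dist u v,
      (u 1 + v 1) / 2 + s * (v 0 - u 0) / dist u v] (dist u v ^ 2 / 4 + s ^ 2) p =
      (p 0 - u 0) * (p 0 - v 0) + (p 1 - u 1) * (p 1 - v 1) - 2 * s * crs u v p / dist u v := by
    intro p
    simp only [pw, crs, Matrix.cons_val_zero, Matrix.cons_val_one]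
    field_simp
    linear_combination (-4 * dist u v ^ 2 - 16 * s ^ 2) * hd2
  refine ⟨_, _, by rw [key]; simp, by rw [key]; simp, fun p hp ↦ ?_⟩
  rw [key, ctr]
  field_simp

/-- The points `x`, `y` lie on the two sides of `u v`, each inside the circle of the other. -/
def Cfg (u v x y : Pt) : Prop := 0 < crs u v x ∧ 0 < crs v u y ∧ ctr u v x + ctr v u y < 0

/-- The union of the disks bounded by the circles `u v x` and `u v y`, off the line `u v`. -/
def reg (u v x y : Pt) : Set Pt :=
  {p | 0 < crs u v p ∧ ctr u v p < -ctr v u y} ∪ {p | 0 < crs v u p ∧ ctr v u p < -ctr u v x}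

/-- The area of `reg`. -/
def lens (u v x y : Pt) : ℝ := cap (dist u v / 2) (-ctr v u y) + cap (dist u v / 2) (-ctr u v x)

theorem Cfg.ne {u v x y : Pt} (h : Cfg u v x y) : u ≠ v := by
  rintro rfl
  have := h.1
  simp [crs] at this

theorem volume_reg_le {u v : Pt} (huv : u ≠ v) (x y : Pt) :
    volume (reg u v x y) ≤ ENNReal.ofReal (lens u v x y) := by
  have ha : 0 < dist u v / 2 := half_pos (dist_pos.2 huv)
  rw [lens, ENNReal.ofReal_add (cap_nonneg ha _) (cap_nonneg ha _)]
  refine (measure_union_le _ _).trans_eq ?_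
  rw [volume_ctr_lt huv, volume_ctr_lt huv.symm, dist_comm v u]

theorem Cfg.flip {P : Set Pt} (hP : GP P) {u v x y : Pt} (hu : u ∈ P) (hv : v ∈ P) (hx : x ∈ P)
    (hy : y ∈ P) (h : Cfg u v x y)
    (hreg : ∀ p ∈ P, p ≠ u → p ≠ v → p ≠ x → p ≠ y → p ∉ reg u v x y) : Flip P u v x y := by
  obtain ⟨h1, h2, h3⟩ := id h
  have hd : 0 < dist u v := dist_pos.2 h.ne
  rw [crs_swap u v y] at h2
  rw [ctr_swap u v y] at h3
  have hpos : ∀ c t : ℝ, 0 ≤ c * t → 0 ≤ 2 * c / dist u v * t := fun c t hct ↦ by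
    rw [show 2 * c / dist u v * t = 2 * (c * t) / dist u v by ring]; positivity
  have hneg : ∀ c t : ℝ, c * t < 0 → 2 * c / dist u v * t < 0 := fun c t hct ↦ by
    rw [show 2 * c / dist u v * t = 2 * (c * t) / dist u v by ring]
    exact div_neg_of_neg_of_pos (by linarith) hd
  have hout : ∀ p ∈ P, p ≠ u → p ≠ v → p ≠ x → p ≠ y →
      0 < crs u v p ∧ ctr u v y ≤ ctr u v p ∨ crs u v p < 0 ∧ ctr u v p ≤ ctr u v x := by
    intro p hp pu pv px py
    have hp' := hreg p hp pu pv px py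
    simp only [reg, mem_union, mem_ofPred_eq, ctr_swap u v, crs_swap u v, not_or, not_and,
      not_lt, neg_neg] at hp'
    rcases (hP.col u hu v hv p hp h.ne pu.symm pv.symm).lt_or_gt with h0 | h0
    · exact Or.inr ⟨h0, by linarith [hp'.2 (by linarith)]⟩
    · exact Or.inl ⟨h0, hp'.1 h0⟩
  refine ⟨hu, hv, hx, hy, by nlinarith, ?_, ?_⟩
  · obtain ⟨z, k, ku, kv, kp⟩ := exists_pw_eq h.ne (ctr u v x)
    have kx : pw z k x = 0 := by rw [kp x h1.ne']; simp
    refine ⟨z, k, ku, kv, kx, ?_, fun p hp py ↦ ?_⟩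
    · rw [kp y (by linarith)]
      exact hneg _ _ (by nlinarith)
    · by_cases pu : p = u
      · rw [pu, ku]
      by_cases pv : p = v
      · rw [pv, kv]
      by_cases px : p = x
      · rw [px, kx]
      rcases hout p hp pu pv px py with ⟨c1, c2⟩ | ⟨c1, c2⟩
      · rw [kp p c1.ne']; exact hpos _ _ (by nlinarith)
      · rw [kp p c1.ne]; exact hpos _ _ (by nlinarith)
  · obtain ⟨z, k, ku, kv, kp⟩ := exists_pw_eq h.ne (ctr u v y)
    have ky : pw z k y = 0 := by rw [kp y (by linarith)]; simp
    refine ⟨z, k, ku, kv, ky, ?_, fun p hp px ↦ ?_⟩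
    · rw [kp x (by linarith)]
      exact hneg _ _ (by nlinarith)
    · by_cases pu : p = u
      · rw [pu, ku]
      by_cases pv : p = v
      · rw [pv, kv]
      by_cases py : p = y
      · rw [py, ky]
      rcases hout p hp pu pv px py with ⟨c1, c2⟩ | ⟨c1, c2⟩
      · rw [kp p c1.ne']; exact hpos _ _ (by nlinarith)
      · rw [kp p c1.ne]; exact hpos _ _ (by nlinarith)

theorem measurePreserving_comp_embedding {ι κ X : Type*} [Fintype ι] [Fintype κ]
    [MeasurableSpace X] (μ : Measure X) [SigmaFinite μ] (f : ι ↪ κ) [Fintype ↥(range f)ᶜ] :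
    MeasurePreserving (fun x : κ → X ↦ (fun i ↦ x (f i), fun m : ↥(range f)ᶜ ↦ x m))
      (Measure.pi fun _ ↦ μ) ((Measure.pi fun _ ↦ μ).prod (Measure.pi fun _ ↦ μ)) := by
  classical
  let e : ι ⊕ ↥(range f)ᶜ ≃ κ := (Equiv.sumCongr (Equiv.ofInjective f f.injective)
    (Equiv.refl _)).trans (Equiv.Set.sumCompl (range f))
  exact (measurePreserving_sumPiEquivProdPi fun _ ↦ μ).comp
    (measurePreserving_piCongrLeft (fun _ ↦ μ) e).symm

theorem measurePreserving_pi_four {X : Type*} [MeasurableSpace X] (μ : Measure X) [SigmaFinite μ] :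
    MeasurePreserving (fun q : Fin 4 → X ↦ (q 0, q 1, q 2, q 3)) (Measure.pi fun _ ↦ μ)
      (μ.prod (μ.prod (μ.prod μ))) := by
  have h : ∀ n, MeasurePreserving (fun q : Fin (n + 1) → X ↦ (q 0, fun i : Fin n ↦ q i.succ))
      (Measure.pi fun _ ↦ μ) (μ.prod (Measure.pi fun _ ↦ μ)) := fun n ↦
    measurePreserving_piFinSuccAbove (fun _ ↦ μ) 0
  have h1 : MeasurePreserving (fun q : Fin 1 → X ↦ q 0) (Measure.pi fun _ ↦ μ) μ :=
    measurePreserving_funUnique μ (Fin 1)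
  exact ((MeasurePreserving.id μ).prod (((MeasurePreserving.id μ).prod
    (((MeasurePreserving.id μ).prod h1).comp (h 1))).comp (h 2))).comp (h 3)

theorem measure_pi_embedding {ι κ X : Type*} [Fintype ι] [Fintype κ]
    [MeasurableSpace X] (μ : Measure X) [IsProbabilityMeasure μ] (f : ι ↪ κ)
    {G : Set (ι → X)} (hG : MeasurableSet G) {R : (ι → X) → Set X}
    (hR : MeasurableSet {z : (ι → X) × X | z.2 ∈ R z.1}) :
    Measure.pi (fun _ ↦ μ) {x : κ → X | (fun i ↦ x (f i)) ∈ G ∧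
      ∀ m, m ∉ range f → x m ∉ R fun i ↦ x (f i)} =
      ∫⁻ q in G, (1 - μ (R q)) ^ (Fintype.card κ - Fintype.card ι) ∂Measure.pi fun _ ↦ μ := by
  classical
  have hcard : Fintype.card ↥(range f)ᶜ = Fintype.card κ - Fintype.card ι := by
    rw [Fintype.card_compl_set, Set.card_range_of_injective f.injective]
  have hRm : ∀ q, MeasurableSet (R q) := fun q ↦ measurable_prodMk_left hR
  let S : Set ((ι → X) × (↥(range f)ᶜ → X)) := {z | z.1 ∈ G ∧ ∀ m, z.2 m ∉ R z.1}
  have hS : MeasurableSet S := by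
    simp only [S, ofPred_and, ofPred_forall]
    refine (measurable_fst hG).inter (MeasurableSet.iInter fun m ↦ MeasurableSet.compl ?_)
    exact (by fun_prop : Measurable fun z : (ι → X) × (↥(range f)ᶜ → X) ↦ (z.1, z.2 m)) hR
  have hpre := (measurePreserving_comp_embedding μ f).measure_preimage hS.nullMeasurableSet
  rw [Measure.prod_apply hS] at hpre
  rw [← lintegral_indicator hG]
  refine Eq.trans (congrArg _ ?_) (hpre.trans (lintegral_congr fun q ↦ ?_))
  · ext x; simp [S]
  · by_cases hq : q ∈ G
    · have : Prod.mk q ⁻¹' S = univ.pi fun _ ↦ (R q)ᶜ := by ext y; simp [S, hq]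
      rw [this, Measure.pi_pi, indicator_of_mem hq]
      simp [hcard, prob_compl_eq_one_sub (hRm q)]
    · have : Prod.mk q ⁻¹' S = ∅ := by ext y; simp [S, hq]
      rw [this, indicator_of_notMem hq, measure_empty]

abbrev Quad : Type := Pt × Pt × Pt × Pt

/-- A lower bound for the probability that a given quadruple of points is a flippable
configuration among `n` points, conditioned on the position of the quadruple. -/
def dens (n : ℕ) : Quad → ENNReal :=
  {q | Cfg q.1 q.2.1 q.2.2.1 q.2.2.2}.indicator
    fun q ↦ ENNReal.ofReal (1 - lens q.1 q.2.1 q.2.2.1 q.2.2.2) ^ n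

theorem measurableSet_cfg : MeasurableSet {q : Quad | Cfg q.1 q.2.1 q.2.2.1 q.2.2.2} := by
  unfold Cfg
  simp only [ofPred_and]
  exact (measurableSet_lt measurable_const (by fun_prop)).inter
    ((measurableSet_lt measurable_const (by fun_prop)).inter
      (measurableSet_lt (by fun_prop) measurable_const))

theorem measurable_lens : Measurable fun q : Quad ↦ lens q.1 q.2.1 q.2.2.1 q.2.2.2 := by
  unfold lens; fun_prop

theorem measurable_dens (n : ℕ) : Measurable (dens n) :=
  ((measurable_lens.const_sub 1).ennreal_ofReal.pow_const n).indicator measurableSet_cfg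

theorem measurableSet_reg :
    MeasurableSet {z : Quad × Pt | z.2 ∈ reg z.1.1 z.1.2.1 z.1.2.2.1 z.1.2.2.2} := by
  simp only [reg, mem_union, ofPred_or, ofPred_and]
  exact ((measurableSet_lt measurable_const (by fun_prop)).inter
    (measurableSet_lt (by fun_prop) (by fun_prop))).union
    ((measurableSet_lt measurable_const (by fun_prop)).inter
    (measurableSet_lt (by fun_prop) (by fun_prop)))

/-- The points with indices `f 0, …, f 3` form a flippable configuration. -/
def FlipAt {n : ℕ} (f : Fin 4 ↪ Fin n) : Set (Fin n → Pt) :=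
  {x | Cfg (x (f 0)) (x (f 1)) (x (f 2)) (x (f 3)) ∧
    ∀ m, m ∉ range f → x m ∉ reg (x (f 0)) (x (f 1)) (x (f 2)) (x (f 3))}

theorem measurableSet_flipAt {n : ℕ} (f : Fin 4 ↪ Fin n) : MeasurableSet (FlipAt f) := by
  simp only [FlipAt, ofPred_and, ofPred_forall]
  refine MeasurableSet.inter ?_ ?_
  · exact (by fun_prop :
      Measurable fun x : Fin n → Pt ↦ (x (f 0), x (f 1), x (f 2), x (f 3))) measurableSet_cfg
  · refine MeasurableSet.iInter fun m ↦ MeasurableSet.iInter fun _ ↦ MeasurableSet.compl ?_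
    exact (by fun_prop : Measurable fun x : Fin n → Pt ↦
      ((x (f 0), x (f 1), x (f 2), x (f 3)), x m)) measurableSet_reg

theorem lintegral_dens_le {n : ℕ} (f : Fin 4 ↪ Fin n) :
    ∫⁻ q, dens n q ∂unifSq.prod (unifSq.prod (unifSq.prod unifSq)) ≤ conf n (FlipAt f) := by
  have h4 := measurePreserving_pi_four unifSq
  have hG : MeasurableSet {q : Fin 4 → Pt | Cfg (q 0) (q 1) (q 2) (q 3)} :=
    h4.measurable measurableSet_cfg
  have h := measure_pi_embedding unifSq f hG
    (R := fun q ↦ reg (q 0) (q 1) (q 2) (q 3))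
    ((by fun_prop : Measurable fun z : (Fin 4 → Pt) × Pt ↦
      ((z.1 0, z.1 1, z.1 2, z.1 3), z.2)) measurableSet_reg)
  rw [show conf n (FlipAt f) = _ from h, ← h4.lintegral_comp (measurable_dens n),
    ← lintegral_indicator hG]
  refine lintegral_mono fun q ↦ ?_
  by_cases hq : Cfg (q 0) (q 1) (q 2) (q 3)
  · have ha : 0 < dist (q 0) (q 1) / 2 := half_pos (dist_pos.2 hq.ne)
    rw [dens, indicator_of_mem (by exact hq), indicator_of_mem (by exact hq)]
    have h0 : 0 ≤ lens (q 0) (q 1) (q 2) (q 3) := add_nonneg (cap_nonneg ha _) (cap_nonneg ha _)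
    refine (pow_le_pow_right_of_le_one' (ENNReal.ofReal_le_one.2 (by linarith))
      ((Nat.sub_le _ _).trans_eq (Fintype.card_fin n))).trans (pow_le_pow_left' ?_ _)
    rw [ENNReal.ofReal_sub _ h0, ENNReal.ofReal_one]
    exact tsub_le_tsub_left ((Measure.restrict_apply_le _ _).trans (volume_reg_le hq.ne _ _)) _
  · rw [dens, indicator_of_notMem (by exact hq)]
    exact zero_le

theorem two_mul_card_embedding_lt (n : ℕ) :
    2 * (Finset.univ.filter fun f : Fin 4 ↪ Fin n ↦ f 0 < f 1).card = n.descFactorial 4 := by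
  have h1 : (Finset.univ.filter fun f : Fin 4 ↪ Fin n ↦ f 0 < f 1).card =
      (Finset.univ.filter fun f : Fin 4 ↪ Fin n ↦ ¬ f 0 < f 1).card := by
    refine Finset.card_equiv (Equiv.embeddingCongr (Equiv.swap 0 1) (Equiv.refl _)) fun f ↦ ?_
    have h01 : f 0 ≠ f 1 := fun h ↦ absurd (f.injective h) (by decide)
    have h : ∀ i, Equiv.embeddingCongr (Equiv.swap 0 1) (Equiv.refl _) f i = f (Equiv.swap 0 1 i) :=
      fun i ↦ rfl
    simp only [Finset.mem_filter_univ, h, Equiv.swap_apply_left, Equiv.swap_apply_right]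
    exact ⟨fun h ↦ h.not_gt, fun h ↦ lt_of_le_of_ne (not_lt.1 h) h01⟩
  have h2 := Finset.card_filter_add_card_filter_not (s := (Finset.univ : Finset (Fin 4 ↪ Fin n)))
    (fun f ↦ f 0 < f 1)
  rw [Finset.card_univ, Fintype.card_embedding_eq, Fintype.card_fin, Fintype.card_fin] at h2
  omega

open Classical in
/-- The number of flippable configurations, counted without repetition. -/
def numFlips {n : ℕ} (x : Fin n → Pt) : ℕ :=
  (Finset.univ.filter fun f : Fin 4 ↪ Fin n ↦ f 0 < f 1 ∧ x ∈ FlipAt f).card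

theorem two_pow_numFlips_le {n : ℕ} (hn : 3 ≤ n) {x : Fin n → Pt} (hx : Function.Injective x)
    (hP : GP (range x)) :
    2 ^ numFlips x ≤ {T : Set (Finset Pt) | IsOrderDT (range x) 1 T}.ncard := by
  classical
  have hcoe : ((Finset.univ.image x : Finset Pt) : Set Pt) = range x := by simp
  have hcard : (Finset.univ.image x).card = n := by
    rw [Finset.card_image_of_injective _ hx, Finset.card_univ, Fintype.card_fin]
  let g : (Fin 4 ↪ Fin n) → Quad := fun f ↦ (x (f 0), x (f 1), x (f 2), x (f 3))
  have hg : Function.Injective g := by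
    intro f f' h
    simp only [g, Prod.mk.injEq, hx.eq_iff] at h
    ext i
    fin_cases i <;> simp [h]
  rw [numFlips, ← Finset.card_image_of_injective _ hg, ← hcoe]
  refine two_pow_le_ncard (hcoe ▸ hP) (hn.trans_eq hcard.symm) ?_ ?_
  · simp only [Finset.mem_image, Finset.mem_filter_univ, forall_exists_index, and_imp]
    rintro _ f - hf rfl
    rw [hcoe]
    refine hf.1.flip hP (mem_range_self _) (mem_range_self _) (mem_range_self _)
      (mem_range_self _) ?_
    rintro _ ⟨m, rfl⟩ h0 h1 h2 h3
    refine hf.2 m ?_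
    rintro ⟨i, rfl⟩
    fin_cases i <;> simp_all [g]
  · simp only [Finset.mem_image, Finset.mem_filter_univ, forall_exists_index, and_imp]
    rintro _ f hlt hf rfl _ f' hlt' hf' rfl ⟨h1, h2⟩
    simp only [g, hx.eq_iff] at h1 h2
    obtain ⟨h0, h1⟩ := h1.resolve_right fun h ↦ by
      rw [h.1, h.2] at hlt
      exact hlt.not_gt hlt'
    rcases h2 with ⟨h2, h3⟩ | ⟨h2, h3⟩
    · simp only [g, h0, h1, h2, h3]
    · have e1 := hf.1.1
      have e2 := hf'.1.2.1
      rw [crs_swap, ← h0, ← h1, ← h2] at e2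
      linarith

theorem numFlips_eq_sum {n : ℕ} (x : Fin n → Pt) :
    numFlips x = ∑ f ∈ Finset.univ.filter (fun f : Fin 4 ↪ Fin n ↦ f 0 < f 1),
      (FlipAt f).indicator 1 x := by
  classical
  rw [numFlips, ← Finset.filter_filter, Finset.card_filter]
  exact Finset.sum_congr rfl fun f _ ↦ by simp [indicator_apply]

theorem measurable_numFlips (n : ℕ) : Measurable fun x : Fin n → Pt ↦ numFlips x := by
  simp_rw [numFlips_eq_sum]
  exact Finset.measurable_fun_sum _ fun f _ ↦ measurable_one.indicator (measurableSet_flipAt f)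

theorem le_lintegral_numFlips (n : ℕ) :
    (n.descFactorial 4 / 2 : ENNReal) *
      ∫⁻ q, dens n q ∂unifSq.prod (unifSq.prod (unifSq.prod unifSq)) ≤
      ∫⁻ x, (numFlips x : ENNReal) ∂conf n := by
  classical
  have h : ∀ x : Fin n → Pt, (numFlips x : ENNReal) =
      ∑ f ∈ Finset.univ.filter (fun f : Fin 4 ↪ Fin n ↦ f 0 < f 1),
        (FlipAt f).indicator 1 x := by
    intro x
    rw [numFlips_eq_sum]
    push_cast
    exact Finset.sum_congr rfl fun f _ ↦ by simp [indicator_apply]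
  simp_rw [h]
  rw [lintegral_finsetSum _ fun f _ ↦ measurable_one.indicator (measurableSet_flipAt f)]
  simp_rw [lintegral_indicator_one (measurableSet_flipAt _)]
  refine le_trans ?_ (Finset.card_nsmul_le_sum _ _ _ fun f _ ↦ lintegral_dens_le f)
  rw [nsmul_eq_mul, ← two_mul_card_embedding_lt]
  gcongr
  push_cast
  rw [mul_comm, ENNReal.mul_div_cancel_right (by simp) (by simp)]

open Filter Topology

/-- Shrink the last three points by the factor `r` and move the origin to the first point. -/
def zoom (r : ℝ) (q : Quad) : Quad := (q.1, q.1 + r • q.2.1, q.1 + r • q.2.2.1, q.1 + r • q.2.2.2)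

theorem continuous_zoom (q : Quad) : Continuous fun r ↦ zoom r q := by unfold zoom; fun_prop

theorem measurable_zoom (r : ℝ) : Measurable (zoom r) :=
  (by unfold zoom; fun_prop : Continuous (zoom r)).measurable

theorem lintegral_add_smul {r : ℝ} (hr : 0 < r) (u : Pt) (f : Pt → ENNReal) :
    ∫⁻ v, f v = ENNReal.ofReal (r ^ 2) * ∫⁻ v, f (u + r • v) := by
  have h := lintegral_map_equiv (μ := volume) (fun v ↦ f (u + v))
    (Homeomorph.smul (isUnit_iff_ne_zero.2 hr.ne').unit : Pt ≃ₜ Pt).toMeasurableEquiv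
  have h' : Measure.map (Homeomorph.smul (isUnit_iff_ne_zero.2 hr.ne').unit :
      Pt ≃ₜ Pt).toMeasurableEquiv volume = ENNReal.ofReal |(r ^ 2)⁻¹| • (volume : Measure Pt) := by
    have := Measure.map_addHaar_smul (volume : Measure Pt) hr.ne'
    rwa [finrank_euclideanSpace_fin] at this
  rw [h', lintegral_smul_measure, lintegral_add_left_eq_self] at h
  have h2 : ∫⁻ v, f (u + r • v) = ENNReal.ofReal |(r ^ 2)⁻¹| * ∫⁻ v, f v := h.symm
  rw [h2, ← mul_assoc, ← ENNReal.ofReal_mul (by positivity), abs_of_pos (by positivity),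
    mul_inv_cancel₀ (by positivity), ENNReal.ofReal_one, one_mul]

theorem lintegral_zoom {r : ℝ} (hr : 0 < r) {F : Quad → ENNReal} (hF : Measurable F) :
    ∫⁻ q, F q = ENNReal.ofReal (r ^ 2) ^ 3 * ∫⁻ q, F (zoom r q) := by
  have iter : ∀ G : Quad → ENNReal, Measurable G →
      ∫⁻ q, G q = ∫⁻ u, ∫⁻ v, ∫⁻ x, ∫⁻ y, G (u, v, x, y) := fun G hG ↦ by
    rw [Measure.volume_eq_prod, lintegral_prod _ hG.aemeasurable]
    refine lintegral_congr fun u ↦ ?_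
    rw [Measure.volume_eq_prod, lintegral_prod _ (by fun_prop)]
    refine lintegral_congr fun v ↦ ?_
    rw [Measure.volume_eq_prod, lintegral_prod _ (by fun_prop)]
  have step := lintegral_add_smul hr
  generalize hc : ENNReal.ofReal (r ^ 2) = c at step ⊢
  have hc' : c ≠ ⊤ := hc ▸ ENNReal.ofReal_ne_top
  rw [iter F hF, iter (fun q ↦ F (zoom r q)) (hF.comp (measurable_zoom r)),
    ← lintegral_const_mul' _ _ (ENNReal.pow_ne_top hc')]
  refine lintegral_congr fun u ↦ ?_
  rw [step u, pow_succ', mul_assoc, ← lintegral_const_mul' _ _ (ENNReal.pow_ne_top hc')]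
  congr 1
  refine lintegral_congr fun v ↦ ?_
  rw [step u, pow_two, mul_assoc]
  congr 1
  rw [← lintegral_const_mul' _ _ hc']
  refine lintegral_congr fun x ↦ ?_
  rw [step u]
  rfl

theorem crs_zoom (r : ℝ) (u v x : Pt) : crs u (u + r • v) (u + r • x) = r ^ 2 * crs 0 v x := by
  simp [crs]; ring

theorem dist_zoom {r : ℝ} (hr : 0 < r) (u v : Pt) : dist u (u + r • v) = r * dist 0 v := by
  rw [dist_self_add_right, norm_smul, Real.norm_of_nonneg hr.le, dist_zero_left]

theorem ctr_zoom {r : ℝ} (hr : 0 < r) (u v x : Pt) :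
    ctr u (u + r • v) (u + r • x) = r * ctr 0 v x := by
  rw [ctr, ctr, crs_zoom, dist_zoom hr]
  simp only [PiLp.add_apply, PiLp.smul_apply, smul_eq_mul, PiLp.zero_apply]
  by_cases h : crs 0 v x = 0
  · simp [h]
  · field_simp; ring

theorem cap_mul {r : ℝ} (hr : 0 < r) (a s : ℝ) : cap (r * a) (r * s) = r ^ 2 * cap a s := by
  rw [cap, cap, mul_div_mul_left _ _ hr.ne']; ring

theorem cfg_zoom {r : ℝ} (hr : 0 < r) (u v x y : Pt) :
    Cfg u (u + r • v) (u + r • x) (u + r • y) ↔ Cfg 0 v x y := by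
  rw [Cfg, Cfg, crs_swap u, crs_swap 0, ctr_swap u, ctr_swap 0, crs_zoom, crs_zoom,
    ctr_zoom hr, ctr_zoom hr, ← mul_neg, ← mul_neg, ← mul_add,
    mul_pos_iff_of_pos_left (by positivity), mul_pos_iff_of_pos_left (by positivity),
    mul_neg_iff, and_iff_right hr, or_iff_left (fun h ↦ h.1.not_gt hr)]

theorem lens_zoom {r : ℝ} (hr : 0 < r) (u v x y : Pt) :
    lens u (u + r • v) (u + r • x) (u + r • y) = r ^ 2 * lens 0 v x y := by
  rw [lens, lens, ctr_swap u, ctr_swap 0, ctr_zoom hr, ctr_zoom hr, dist_zoom hr, mul_div_assoc,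
    neg_neg, neg_neg, ← mul_neg, cap_mul hr, cap_mul hr, mul_add]

/-- The limit of the rescaled densities `dens n`. -/
def limDens : Pt × Pt × Pt → ENNReal := {w | Cfg 0 w.1 w.2.1 w.2.2}.indicator
  fun w ↦ ENNReal.ofReal (Real.exp (-lens 0 w.1 w.2.1 w.2.2))

theorem measurable_limDens : Measurable limDens := by
  have h : Measurable fun w : Pt × Pt × Pt ↦ ((0, w) : Quad) := by fun_prop
  exact (Real.measurable_exp.comp (measurable_lens.comp h).neg).ennreal_ofReal.indicator
    (h measurableSet_cfg)

theorem tendsto_dens_zoom (q : Quad) :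
    Tendsto (fun n : ℕ ↦ dens n (zoom (√n)⁻¹ q)) atTop (𝓝 (limDens q.2)) := by
  obtain ⟨u, v, x, y⟩ := q
  by_cases h : Cfg 0 v x y
  · have h1 : Tendsto (fun n : ℕ ↦ ENNReal.ofReal ((1 + -lens 0 v x y / n) ^ n)) atTop
        (𝓝 (limDens (v, x, y))) := by
      rw [limDens, indicator_of_mem (by exact h)]
      exact ENNReal.tendsto_ofReal (Real.tendsto_one_add_div_pow_exp _)
    refine h1.congr' ?_
    have h2 : ∀ᶠ n : ℕ in atTop, lens 0 v x y ≤ n :=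
      tendsto_natCast_atTop_atTop.eventually_ge_atTop _
    filter_upwards [h2, eventually_gt_atTop 0] with n hn hn0
    have hn0 : (0 : ℝ) < n := by exact_mod_cast hn0
    have hr : 0 < (√n)⁻¹ := by positivity
    rw [dens, zoom, indicator_of_mem (by exact (cfg_zoom hr u v x y).2 h), lens_zoom hr, inv_pow,
      Real.sq_sqrt hn0.le, ENNReal.ofReal_pow]
    · congr 2; ring
    · rw [neg_div, ← sub_eq_add_neg, sub_nonneg, div_le_one hn0]; exact hn
  · rw [limDens, indicator_of_notMem (by exact h)]
    refine tendsto_const_nhds.congr' ?_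
    filter_upwards [eventually_gt_atTop 0] with n hn0
    have hr : 0 < (√(n : ℝ))⁻¹ := by positivity
    rw [dens, zoom, indicator_of_notMem (by exact fun h' ↦ h ((cfg_zoom hr u v x y).1 h'))]

/-- The interior of the unit square. -/
def openSq : Set Pt := {p | p 0 ∈ Ioo (0 : ℝ) 1 ∧ p 1 ∈ Ioo (0 : ℝ) 1}

theorem isOpen_openSq : IsOpen openSq :=
  (isOpen_Ioo.preimage (by fun_prop : Continuous fun p : Pt ↦ p 0)).inter
    (isOpen_Ioo.preimage (by fun_prop : Continuous fun p : Pt ↦ p 1))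

theorem volume_openSq : volume openSq = 1 := by
  have h := (EuclideanSpace.volume_preserving_symm_measurableEquiv_toLp (Fin 2)).measure_preimage
    (s := Set.pi univ fun _ ↦ Ioo (0 : ℝ) 1)
    (MeasurableSet.univ_pi fun _ ↦ measurableSet_Ioo).nullMeasurableSet
  rw [volume_pi_pi] at h
  simp at h
  rw [← h]
  congr 1
  ext p
  simp [openSq]

theorem openSq_subset : openSq ⊆ unitSq :=
  fun _ hp ↦ ⟨Ioo_subset_Icc_self hp.1, Ioo_subset_Icc_self hp.2⟩

/-- The rescaled density, restricted to the square. -/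
def zdens (n : ℕ) (q : Quad) : ENNReal :=
  ENNReal.ofReal ((n - 3) ^ 4 / (2 * n ^ 4)) *
    (unitSq ×ˢ unitSq ×ˢ unitSq ×ˢ unitSq).indicator (dens n) (zoom (√n)⁻¹ q)

theorem measurableSet_sq : MeasurableSet (unitSq ×ˢ unitSq ×ˢ unitSq ×ˢ unitSq) :=
  measurableSet_unitSq.prod (measurableSet_unitSq.prod
    (measurableSet_unitSq.prod measurableSet_unitSq))

theorem measurable_zdens (n : ℕ) : Measurable (zdens n) :=
  (((measurable_dens n).indicator measurableSet_sq).comp (measurable_zoom _)).const_mul _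

theorem tendsto_zdens {q : Quad} (hq : q.1 ∈ openSq) :
    Tendsto (fun n ↦ zdens n q) atTop (𝓝 (2⁻¹ * limDens q.2)) := by
  have h1 : Tendsto (fun n : ℕ ↦ ENNReal.ofReal (((n : ℝ) - 3) ^ 4 / (2 * n ^ 4))) atTop
      (𝓝 2⁻¹) := by
    have h2 : Tendsto (fun n : ℕ ↦ (1 - 3 / (n : ℝ)) ^ 4 / 2) atTop (𝓝 ((1 - 0) ^ 4 / 2)) :=
      ((tendsto_const_nhds.sub (tendsto_const_div_atTop_nhds_zero_nat 3)).pow 4).div_const 2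
    have h3 := ENNReal.tendsto_ofReal h2
    rw [show ((1 : ℝ) - 0) ^ 4 / 2 = 2⁻¹ by norm_num, ENNReal.ofReal_inv_of_pos (by norm_num)] at h3
    simp only [ENNReal.ofReal_ofNat] at h3
    refine h3.congr' ?_
    filter_upwards [eventually_gt_atTop 0] with n hn
    congr 1
    field_simp
  refine ENNReal.Tendsto.mul h1 (Or.inl (by simp)) ?_ (Or.inr (by simp))
  refine (tendsto_dens_zoom q).congr' ?_
  have h4 : Tendsto (fun n : ℕ ↦ zoom (√n)⁻¹ q) atTop (𝓝 (q.1, q.1, q.1, q.1)) := by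
    have h5 : Tendsto (fun n : ℕ ↦ (√(n : ℝ))⁻¹) atTop (𝓝 0) :=
      tendsto_inv_atTop_zero.comp (Real.tendsto_sqrt_atTop.comp tendsto_natCast_atTop_atTop)
    have h6 := ((continuous_zoom q).tendsto 0).comp h5
    simpa [zoom, Function.comp_def] using h6
  have h7 : openSq ×ˢ openSq ×ˢ openSq ×ˢ openSq ∈ 𝓝 (q.1, q.1, q.1, q.1) :=
    (isOpen_openSq.prod (isOpen_openSq.prod (isOpen_openSq.prod isOpen_openSq))).mem_nhds
      ⟨hq, hq, hq, hq⟩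
  filter_upwards [h4.eventually_mem h7] with n hn
  rw [indicator_of_mem]
  exact prod_mono openSq_subset (prod_mono openSq_subset (prod_mono openSq_subset openSq_subset)) hn

theorem lintegral_zdens_le {n : ℕ} (hn : 3 ≤ n) :
    ∫⁻ q, zdens n q ≤ (∫⁻ x, (numFlips x : ENNReal) ∂conf n) / n := by
  have hn0 : (0 : ℝ) < n := by positivity
  rw [ENNReal.le_div_iff_mul_le (by simp; omega) (by simp)]
  refine le_trans ?_ (le_lintegral_numFlips n)
  have hm : Measurable ((unitSq ×ˢ unitSq ×ˢ unitSq ×ˢ unitSq).indicator (dens n)) :=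
    (measurable_dens n).indicator measurableSet_sq
  have h1 := lintegral_zoom (r := (√n)⁻¹) (by positivity) hm
  rw [lintegral_indicator measurableSet_sq, inv_pow, Real.sq_sqrt hn0.le] at h1
  simp only [unifSq, Measure.prod_restrict, ← Measure.volume_eq_prod]
  rw [h1]
  unfold zdens
  rw [lintegral_const_mul' _ _ (by simp)]
  generalize ∫⁻ q, indicator _ (dens n) (zoom _ q) = J at *
  have h2 : ENNReal.ofReal (((n : ℝ) - 3) ^ 4 / (2 * n ^ 4)) * n ≤
      n.descFactorial 4 / 2 * ENNReal.ofReal ((n : ℝ)⁻¹) ^ 3 := by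
    have h3 : ((n : ℝ) - 3) ^ 4 ≤ n.descFactorial 4 := by
      have := Nat.pow_sub_le_descFactorial n 4
      rw [show n + 1 - 4 = n - 3 by omega] at this
      have h : (((n - 3) ^ 4 : ℕ) : ℝ) ≤ n.descFactorial 4 := by exact_mod_cast this
      push_cast [hn] at h
      exact h
    rw [← ENNReal.ofReal_natCast, ← ENNReal.ofReal_natCast, ← ENNReal.ofReal_pow (by positivity),
      ← ENNReal.ofReal_ofNat 2, ← ENNReal.ofReal_div_of_pos (by norm_num),
      ← ENNReal.ofReal_mul (by positivity), ← ENNReal.ofReal_mul (by positivity)]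
    refine ENNReal.ofReal_le_ofReal ?_
    calc ((n : ℝ) - 3) ^ 4 / (2 * n ^ 4) * n = ((n : ℝ) - 3) ^ 4 / 2 * (n : ℝ)⁻¹ ^ 3 := by field_simp
      _ ≤ _ := by gcongr
  calc _ = ENNReal.ofReal (((n : ℝ) - 3) ^ 4 / (2 * n ^ 4)) * n * J := mul_right_comm _ _ _
    _ ≤ _ := by gcongr
    _ = _ := mul_assoc _ _ _

theorem le_liminf_lintegral_numFlips :
    2⁻¹ * ∫⁻ w, limDens w ≤
      liminf (fun n : ℕ ↦ (∫⁻ x, (numFlips x : ENNReal) ∂conf n) / n) atTop := by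
  calc 2⁻¹ * ∫⁻ w, limDens w = ∫⁻ q : Quad in openSq ×ˢ univ, 2⁻¹ * limDens q.2 := by
        rw [Measure.volume_eq_prod Pt (Pt × Pt × Pt), ← Measure.prod_restrict, Measure.restrict_univ,
          lintegral_prod _ (by have := measurable_limDens; fun_prop)]
        dsimp only
        rw [lintegral_const, Measure.restrict_apply_univ, volume_openSq, mul_one,
          lintegral_const_mul' _ _ (by simp)]
    _ = ∫⁻ q : Quad in openSq ×ˢ univ, liminf (fun n ↦ zdens n q) atTop :=
        setLIntegral_congr_fun (isOpen_openSq.measurableSet.prod .univ) fun q hq ↦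
          (tendsto_zdens hq.1).liminf_eq.symm
    _ ≤ ∫⁻ q : Quad, liminf (fun n ↦ zdens n q) atTop := setLIntegral_le_lintegral _ _
    _ ≤ liminf (fun n ↦ ∫⁻ q : Quad, zdens n q) atTop := lintegral_liminf_le measurable_zdens
    _ ≤ _ := liminf_le_liminf (by
        filter_upwards [eventually_ge_atTop 3] with n hn using lintegral_zdens_le hn)

theorem lintegral_norm {F : ℝ → ENNReal} (hF : Measurable F) :
    ∫⁻ v : Pt, F ‖v‖ = ∫⁻ a in Ioi 0, ENNReal.ofReal (8 * Real.pi * a) * F (2 * a) := by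
  have h1 := (Complex.orthonormalBasisOneI.repr.measurePreserving).lintegral_comp
    (f := fun v : Pt ↦ F ‖v‖) (by fun_prop)
  have h2 : ∫⁻ v : Pt, F ‖v‖ = ∫⁻ r in Ioi 0, ENNReal.ofReal (2 * Real.pi * r) * F r := by
    rw [← h1]
    simp only [LinearIsometryEquiv.norm_map]
    refine (Complex.lintegral_comp_polarCoord_symm fun z ↦ F ‖z‖).symm.trans ?_
    simp only [Complex.norm_polarCoord_symm]
    rw [polarCoord_target, Measure.volume_eq_prod, setLIntegral_prod _ (by fun_prop)]
    refine setLIntegral_congr_fun measurableSet_Ioi fun r hr ↦ ?_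
    have hr : 0 < r := hr
    simp only [abs_of_pos hr, smul_eq_mul, lintegral_const,
      Measure.restrict_apply, MeasurableSet.univ, univ_inter, Real.volume_Ioo]
    rw [mul_right_comm, ← ENNReal.ofReal_mul hr.le]
    congr 2; ring
  rw [h2]
  have h3 := lintegral_image_eq_lintegral_abs_deriv_mul (s := Ioi (0 : ℝ)) measurableSet_Ioi
    (f := fun a ↦ 2 * a) (f' := fun _ ↦ 2)
    (fun x _ ↦ ((hasDerivAt_id x).const_mul 2).hasDerivWithinAt.congr_deriv (by simp))
    (fun x _ y _ h ↦ by simpa using h) (fun r ↦ ENNReal.ofReal (2 * Real.pi * r) * F r)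
  have h4 : (fun a : ℝ ↦ 2 * a) '' Ioi 0 = Ioi 0 := by
    rw [image_mul_left_Ioi (by norm_num)]; simp
  rw [h4] at h3
  rw [h3]
  refine setLIntegral_congr_fun measurableSet_Ioi fun a ha ↦ ?_
  have ha : 0 < a := ha
  rw [← mul_assoc, ← ENNReal.ofReal_mul (by positivity)]
  congr 2; rw [abs_of_pos (by norm_num)]; ring

/-- The parametrisation of the distance `s` of the centre from the chord by the radius `c`. -/
theorem lintegral_radius {a r : ℝ} (ha : 0 < a) (hr : a ≤ r) (g : ℝ → ENNReal) :
    ∫⁻ s in Ioi √(r ^ 2 - a ^ 2), g s =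
      ∫⁻ c in Ioi r, ENNReal.ofReal (c / √(c ^ 2 - a ^ 2)) * g √(c ^ 2 - a ^ 2) := by
  have hpos : ∀ c ∈ Ioi r, 0 < c ^ 2 - a ^ 2 := fun c hc ↦ by
    have : r < c := hc
    nlinarith
  have h1 : (fun c : ℝ ↦ √(c ^ 2 - a ^ 2)) '' Ioi r = Ioi √(r ^ 2 - a ^ 2) := by
    ext s
    constructor
    · rintro ⟨c, hc, rfl⟩
      have : r < c := hc
      exact Real.sqrt_lt_sqrt (by nlinarith) (by nlinarith)
    · intro hs
      have hs0 : 0 < s := (Real.sqrt_nonneg _).trans_lt hs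
      refine ⟨√(s ^ 2 + a ^ 2), ?_, ?_⟩
      · have := (Real.sqrt_lt' hs0).1 hs
        exact Real.lt_sqrt_of_sq_lt (by linarith)
      · dsimp only
        rw [Real.sq_sqrt (by positivity), add_sub_cancel_right, Real.sqrt_sq hs0.le]
  rw [← h1, lintegral_image_eq_lintegral_abs_deriv_mul measurableSet_Ioi
    (f' := fun c ↦ c / √(c ^ 2 - a ^ 2))]
  · refine setLIntegral_congr_fun measurableSet_Ioi fun c hc ↦ ?_
    have : r < c := hc
    rw [abs_of_nonneg (div_nonneg (by linarith) (Real.sqrt_nonneg _))]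
  · intro c hc
    refine (((((hasDerivAt_id c).pow 2).sub_const (a ^ 2)).sqrt
      (hpos c hc).ne').hasDerivWithinAt).congr_deriv ?_
    simp
    field_simp
  · intro c hc d hd h
    have h2 : r < c := hc
    have h3 : r < d := hd
    rw [Real.sqrt_inj (hpos c hc).le (hpos d hd).le] at h
    nlinarith

theorem arctan_sqrt_div {a c : ℝ} (ha : 0 < a) (hc : a < c) :
    Real.arctan (√(c ^ 2 - a ^ 2) / a) = Real.pi / 2 - Real.arcsin (a / c) := by
  have hc0 : 0 < c := ha.trans hc
  have hs : 0 ≤ √(c ^ 2 - a ^ 2) / a := by positivity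
  rw [Real.arctan_eq_arccos hs, Real.arccos, div_pow, Real.sq_sqrt (by nlinarith)]
  congr 2
  rw [show 1 + (c ^ 2 - a ^ 2) / a ^ 2 = (c / a) ^ 2 by field_simp; ring,
    Real.sqrt_sq (by positivity), inv_div]

theorem cap_sqrt {a c : ℝ} (ha : 0 < a) (hc : a < c) :
    cap a √(c ^ 2 - a ^ 2) =
    Real.pi * c ^ 2 - c ^ 2 * Real.arcsin (a / c) + a * √(c ^ 2 - a ^ 2) := by
  rw [cap, arctan_sqrt_div ha hc, Real.sq_sqrt (by nlinarith)]; ring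

theorem cap_neg_sqrt {a c : ℝ} (ha : 0 < a) (hc : a < c) :
    cap a (-√(c ^ 2 - a ^ 2)) =
    c ^ 2 * Real.arcsin (a / c) - a * √(c ^ 2 - a ^ 2) := by
  rw [cap, neg_div, Real.arctan_neg, arctan_sqrt_div ha hc, neg_sq, Real.sq_sqrt (by nlinarith)]
  ring

theorem mul_cap'_sqrt {a c : ℝ} (ha : 0 < a) (hc : a < c) :
    c / √(c ^ 2 - a ^ 2) * cap' a √(c ^ 2 - a ^ 2) =
    2 * Real.pi * c - 2 * c * Real.arcsin (a / c) + 2 * a * c / √(c ^ 2 - a ^ 2) := by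
  have : 0 < √(c ^ 2 - a ^ 2) := Real.sqrt_pos.2 (by nlinarith)
  rw [cap', arctan_sqrt_div ha hc]
  field_simp; ring

theorem mul_cap'_neg_sqrt {a c : ℝ} (ha : 0 < a) (hc : a < c) :
    c / √(c ^ 2 - a ^ 2) * cap' a (-√(c ^ 2 - a ^ 2)) =
    2 * a * c / √(c ^ 2 - a ^ 2) - 2 * c * Real.arcsin (a / c) := by
  have : 0 < √(c ^ 2 - a ^ 2) := Real.sqrt_pos.2 (by nlinarith)
  rw [cap', neg_div, Real.arctan_neg, arctan_sqrt_div ha hc]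
  field_simp; ring

theorem ofReal_integral_le {X : Type*} [MeasurableSpace X] {μ : Measure X} {f : X → ℝ}
    {g : X → ENNReal} (h : ∀ᵐ x ∂μ, ENNReal.ofReal (f x) ≤ g x) :
    ENNReal.ofReal (∫ x, f x ∂μ) ≤ ∫⁻ x, g x ∂μ := by
  by_cases hf : Integrable f μ
  · rw [integral_eq_lintegral_pos_part_sub_lintegral_neg_part hf]
    refine (ENNReal.ofReal_le_ofReal (sub_le_self _ ENNReal.toReal_nonneg)).trans ?_
    exact ENNReal.ofReal_toReal_le.trans (lintegral_mono_ae h)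
  · simp [integral_undef hf]

theorem ofReal_setIntegral_le {s : Set ℝ} (hs : MeasurableSet s) {f : ℝ → ℝ}
    {g : ℝ → ENNReal} (h : ∀ x ∈ s, ENNReal.ofReal (f x) ≤ g x) :
    ENNReal.ofReal (∫ x in s, f x) ≤ ∫⁻ x in s, g x :=
  ofReal_integral_le ((ae_restrict_iff' hs).2 (Filter.Eventually.of_forall h))

/-- The weight of a chord of half-length `a`, one end of the arcs having centres at signed
distances `s` and `t`. -/
def arcDens (a s t : ℝ) : ENNReal :=
  ENNReal.ofReal (cap' a s * cap' a t * Real.exp (-(cap a (-s) + cap a (-t))))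

theorem measurable_arcDens (a : ℝ) : Measurable fun q : ℝ × ℝ ↦ arcDens a q.1 q.2 := by
  unfold arcDens
  have : Measurable fun q : ℝ × ℝ ↦ -(cap a (-q.1) + cap a (-q.2)) := by fun_prop
  exact ((Measurable.mul (by fun_prop) (by fun_prop)).mul
    (Real.measurable_exp.comp this)).ennreal_ofReal

theorem arcDens_swap (a s t : ℝ) : arcDens a s t = arcDens a t s := by
  rw [arcDens, arcDens, mul_comm (cap' a s), add_comm]

theorem lintegral_limDens : ∫⁻ w, limDens w = ∫⁻ a in Ioi 0, ENNReal.ofReal (8 * Real.pi * a) *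
    ∫⁻ s, ∫⁻ t in Iio (-s), arcDens a s t := by
  have hm : Measurable fun r : ℝ ↦ ∫⁻ s, ∫⁻ t in Iio (-s), arcDens (r / 2) s t := by
    have h : Measurable fun q : (ℝ × ℝ) × ℝ ↦
        (Iio (-q.1.2)).indicator (arcDens (q.1.1 / 2) q.1.2) q.2 := by
      have : Measurable fun q : (ℝ × ℝ) × ℝ ↦ arcDens (q.1.1 / 2) q.1.2 q.2 := by
        unfold arcDens
        have : Measurable fun q : (ℝ × ℝ) × ℝ ↦
          -(cap (q.1.1 / 2) (-q.1.2) + cap (q.1.1 / 2) (-q.2)) := by fun_prop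
        exact ((Measurable.mul (by fun_prop) (by fun_prop)).mul
          (Real.measurable_exp.comp this)).ennreal_ofReal
      exact this.indicator (s := {q : (ℝ × ℝ) × ℝ | q.2 < -q.1.2})
        (measurableSet_lt (by fun_prop) (by fun_prop))
    simp_rw [← lintegral_indicator measurableSet_Iio]
    exact (h.lintegral_prod_right').lintegral_prod_right'
  have h1 := lintegral_norm hm
  simp only [mul_div_cancel_left₀ _ (two_ne_zero' ℝ)] at h1
  rw [← h1, Measure.volume_eq_prod, lintegral_prod _ measurable_limDens.aemeasurable]
  refine lintegral_congr_ae ?_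
  filter_upwards [compl_mem_ae_iff.2 (measure_singleton (0 : Pt))] with v hv
  have hv : v ≠ 0 := hv
  have hv' : Measurable fun w ↦ limDens (v, w) := measurable_limDens.comp measurable_prodMk_left
  rw [Measure.volume_eq_prod, lintegral_prod _ hv'.aemeasurable]
  have ha : 0 < ‖v‖ / 2 := half_pos (norm_pos_iff.2 hv)
  set a := ‖v‖ / 2 with hadef
  have hd : dist 0 v / 2 = a := by rw [dist_zero_left]
  have hd' : dist v 0 / 2 = a := by rw [dist_zero_right]
  let G : ℝ → ENNReal := fun s ↦ ∫⁻ t in Iio (-s), ENNReal.ofReal (cap' a t) *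
    ENNReal.ofReal (Real.exp (-(cap a (-s) + cap a (-t))))
  have hE : Measurable fun q : ℝ × ℝ ↦
      ENNReal.ofReal (Real.exp (-(cap a (-q.1) + cap a (-q.2)))) :=
    (Real.measurable_exp.comp (by fun_prop :
      Measurable fun q : ℝ × ℝ ↦ -(cap a (-q.1) + cap a (-q.2)))).ennreal_ofReal
  have hG : Measurable G := by
    have h : Measurable fun q : ℝ × ℝ ↦
        (Iio (-q.1)).indicator (fun t ↦ ENNReal.ofReal (cap' a t) *
          ENNReal.ofReal (Real.exp (-(cap a (-q.1) + cap a (-t))))) q.2 :=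
      (Measurable.mul (by fun_prop) hE : Measurable fun q : ℝ × ℝ ↦ ENNReal.ofReal (cap' a q.2) *
          ENNReal.ofReal (Real.exp (-(cap a (-q.1) + cap a (-q.2))))).indicator
          (s := {q : ℝ × ℝ | q.2 < -q.1}) (measurableSet_lt (by fun_prop) (by fun_prop))
    unfold G
    simp_rw [← lintegral_indicator measurableSet_Iio]
    exact h.lintegral_prod_right'
  have hset : ∀ u v : Pt, MeasurableSet {p | 0 < crs u v p} := fun u v ↦
    measurableSet_lt (by fun_prop) (by fun_prop)
  have hx : ∀ x, ∫⁻ y, limDens (v, x, y) =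
      {p | 0 < crs 0 v p}.indicator (fun p ↦ G (ctr 0 v p)) x := by
    intro x
    by_cases hx : 0 < crs 0 v x
    · rw [indicator_of_mem (by exact hx)]
      have h2 : ∀ y, limDens (v, x, y) = {p | 0 < crs v 0 p}.indicator (fun p ↦
          (Iio (-ctr 0 v x)).indicator (fun t ↦
            ENNReal.ofReal (Real.exp (-(cap a (-ctr 0 v x) + cap a (-t))))) (ctr v 0 p)) y := by
        intro y
        by_cases hy : 0 < crs v 0 y
        · rw [indicator_of_mem (by exact hy)]
          by_cases hs : ctr 0 v x + ctr v 0 y < 0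
          · rw [limDens, indicator_of_mem (by exact ⟨hx, hy, hs⟩),
              indicator_of_mem (by rw [mem_Iio]; linarith), lens, hd, add_comm (cap a _)]
          · rw [limDens, indicator_of_notMem (by exact fun h ↦ hs h.2.2),
              indicator_of_notMem (by rw [mem_Iio]; exact fun h ↦ hs (by linarith))]
        · rw [indicator_of_notMem (by exact hy), limDens,
            indicator_of_notMem (by exact fun h ↦ hy h.2.1)]
      simp_rw [h2]
      rw [lintegral_indicator (hset _ _), lintegral_ctr hv, hd']
      · simp_rw [G, ← lintegral_indicator measurableSet_Iio]
        refine lintegral_congr fun t ↦ ?_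
        simp only [indicator]
        split_ifs <;> simp
      · exact (hE.comp measurable_prodMk_left).indicator measurableSet_Iio
    · rw [indicator_of_notMem (by exact hx)]
      have h2 : ∀ y, limDens (v, x, y) = 0 := fun y ↦ by
        rw [limDens, indicator_of_notMem (by exact fun h ↦ hx h.1)]
      simp [h2]
  simp only [hx]
  rw [lintegral_indicator (hset _ _), lintegral_ctr hv.symm hG, hd]
  refine lintegral_congr fun s ↦ ?_
  rw [← lintegral_const_mul' _ _ ENNReal.ofReal_ne_top]
  refine lintegral_congr fun t ↦ ?_
  rw [arcDens, ENNReal.ofReal_mul (mul_nonneg (cap'_nonneg ha s) (cap'_nonneg ha t)),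
    ENNReal.ofReal_mul (cap'_nonneg ha s), mul_assoc]

theorem setLIntegral_Iio_eq (r : ℝ) (g : ℝ → ENNReal) :
    ∫⁻ s in Iio r, g s = ∫⁻ s in Ioi (-r), g (-s) := by
  have h := (Measure.measurePreserving_neg (volume : Measure ℝ)).setLIntegral_comp_preimage_emb
    (MeasurableEquiv.neg ℝ).measurableEmbedding g (Iio r)
  rw [← h]
  congr 2
  ext s
  simp

theorem setLIntegral_triangle {g : ℝ → ℝ → ENNReal} (hg : Measurable fun q : ℝ × ℝ ↦ g q.1 q.2) :
    ∫⁻ s in Ioi (0 : ℝ), ∫⁻ t in Ioo 0 s, g s t = ∫⁻ t in Ioi (0 : ℝ), ∫⁻ s in Ioi t, g s t := by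
  have hm : Measurable fun q : ℝ × ℝ ↦
      {q : ℝ × ℝ | 0 < q.2 ∧ q.2 < q.1}.indicator (fun q ↦ g q.1 q.2) q :=
    hg.indicator (s := {q : ℝ × ℝ | 0 < q.2 ∧ q.2 < q.1})
      ((measurableSet_lt measurable_const measurable_snd).inter
        (measurableSet_lt measurable_snd measurable_fst))
  have h := lintegral_lintegral_swap (μ := (volume : Measure ℝ)) (ν := (volume : Measure ℝ))
    (f := fun s t ↦ {q : ℝ × ℝ | 0 < q.2 ∧ q.2 < q.1}.indicator (fun q ↦ g q.1 q.2) (s, t))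
    hm.aemeasurable
  simp_rw [← lintegral_indicator measurableSet_Ioo, ← lintegral_indicator measurableSet_Ioi]
  convert h using 1
  · refine lintegral_congr fun s ↦ ?_
    by_cases hs : 0 < s
    · simp only [indicator, mem_Ioi, hs, if_true, mem_Ioo, mem_ofPred_eq]
    · rw [indicator_of_notMem (by exact hs), ← lintegral_zero (μ := (volume : Measure ℝ))]
      refine lintegral_congr fun t ↦ ?_
      rw [indicator_of_notMem (by exact fun h ↦ hs (h.1.trans h.2))]
  · refine lintegral_congr fun t ↦ ?_
    by_cases ht : 0 < t
    · simp only [indicator, mem_Ioi, ht, if_true, mem_ofPred_eq, true_and]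
    · rw [indicator_of_notMem (by exact ht), ← lintegral_zero (μ := (volume : Measure ℝ))]
      refine lintegral_congr fun t ↦ ?_
      rw [indicator_of_notMem (by exact fun h ↦ ht h.1)]

theorem le_lintegral_arcDens (a : ℝ) :
    (∫⁻ s in Ioi (0 : ℝ), ∫⁻ t in Ioi (0 : ℝ), arcDens a (-s) (-t)) +
      2 * ∫⁻ s in Ioi (0 : ℝ), ∫⁻ t in Ioi s, arcDens a s (-t) ≤
      ∫⁻ s, ∫⁻ t in Iio (-s), arcDens a s t := by
  have h0 : Disjoint (Iio (0 : ℝ)) (Ioi 0) := disjoint_left.2 fun _ h h' ↦ lt_asymm (mem_Iio.1 h) h'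
  refine le_trans ?_ (setLIntegral_le_lintegral (Iio 0 ∪ Ioi 0) _)
  rw [lintegral_union measurableSet_Ioi h0, two_mul, ← add_assoc]
  refine add_le_add ?_ (le_of_eq ?_)
  · rw [setLIntegral_Iio_eq, neg_zero]
    have h1 : ∫⁻ s in Ioi (0 : ℝ), ∫⁻ t in Ioi s, arcDens a s (-t) =
        ∫⁻ s in Ioi (0 : ℝ), ∫⁻ t in Ioo 0 s, arcDens a (-s) t := by
      have hm : Measurable fun q : ℝ × ℝ ↦ arcDens a (-q.1) q.2 :=
        (measurable_arcDens a).comp (by fun_prop : Measurable fun q : ℝ × ℝ ↦ (-q.1, q.2))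
      rw [setLIntegral_triangle hm]
      simp only [arcDens_swap a (-_)]
    rw [h1]
    refine (le_lintegral_add _ _).trans (setLIntegral_mono' measurableSet_Ioi fun s hs ↦ ?_)
    have hs : 0 < s := hs
    have h2 : ∫⁻ t in Ioi (0 : ℝ), arcDens a (-s) (-t) = ∫⁻ t in Iio 0, arcDens a (-s) t := by
      rw [setLIntegral_Iio_eq, neg_zero]
    rw [h2, ← lintegral_union measurableSet_Ioo
      (h0.mono_right fun x hx ↦ hx.1)]
    refine lintegral_mono_set ?_
    rintro t (ht | ht)
    · have ht : t < 0 := ht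
      simpa using ht.trans hs
    · simpa using ht.2
  · refine setLIntegral_congr_fun measurableSet_Ioi fun s _ ↦ ?_
    rw [setLIntegral_Iio_eq, neg_neg]

theorem ofReal_c1_le : ENNReal.ofReal c1 ≤ ∫⁻ a in Ioi 0, ENNReal.ofReal (8 * Real.pi * a) *
    ∫⁻ s in Ioi (0 : ℝ), ∫⁻ t in Ioi (0 : ℝ), arcDens a (-s) (-t) := by
  refine ofReal_setIntegral_le measurableSet_Ioi fun a ha ↦ ?_
  have ha : 0 < a := ha
  have h0 : (0 : ℝ) = √(a ^ 2 - a ^ 2) := by simp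
  rw [h0, lintegral_radius ha le_rfl, ← lintegral_const_mul' _ _ ENNReal.ofReal_ne_top]
  refine ofReal_setIntegral_le measurableSet_Ioi fun c hc ↦ ?_
  rw [lintegral_radius ha le_rfl, ← lintegral_const_mul' _ _ ENNReal.ofReal_ne_top,
    ← lintegral_const_mul' _ _ ENNReal.ofReal_ne_top]
  refine ofReal_setIntegral_le measurableSet_Ioi fun b hb ↦ le_of_eq ?_
  have hc : a < c := hc
  have hb : a < b := hb
  have hc0 : 0 < c := ha.trans hc
  have hb0 : 0 < b := ha.trans hb
  rw [arcDens, ← ENNReal.ofReal_mul (by positivity), ← ENNReal.ofReal_mul (by positivity),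
    ← ENNReal.ofReal_mul (by positivity), neg_neg, neg_neg, cap_sqrt ha hc, cap_sqrt ha hb,
    ← mul_cap'_neg_sqrt ha hc, ← mul_cap'_neg_sqrt ha hb]
  congr 1
  rw [show ∀ x y u v w e : ℝ, x * (y * (u * (v * w * e))) = x * (y * v) * (u * w) * e by
    intros; ring]
  congr 2
  ring

theorem ofReal_c2_le : ENNReal.ofReal c2 ≤ ∫⁻ a in Ioi 0, ENNReal.ofReal (8 * Real.pi * a) *
    ∫⁻ s in Ioi (0 : ℝ), ∫⁻ t in Ioi s, arcDens a s (-t) := by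
  refine ofReal_setIntegral_le measurableSet_Ioi fun a ha ↦ ?_
  have ha : 0 < a := ha
  have h0 : (0 : ℝ) = √(a ^ 2 - a ^ 2) := by simp
  rw [h0, lintegral_radius ha le_rfl, ← lintegral_const_mul' _ _ ENNReal.ofReal_ne_top]
  refine ofReal_setIntegral_le measurableSet_Ioi fun c hc ↦ ?_
  have hc : a < c := hc
  rw [lintegral_radius ha hc.le, ← lintegral_const_mul' _ _ ENNReal.ofReal_ne_top,
    ← lintegral_const_mul' _ _ ENNReal.ofReal_ne_top]
  refine ofReal_setIntegral_le measurableSet_Ioi fun b hb ↦ le_of_eq ?_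
  have hb : a < b := hc.trans hb
  have hc0 : 0 < c := ha.trans hc
  have hb0 : 0 < b := ha.trans hb
  rw [arcDens, ← ENNReal.ofReal_mul (by positivity), ← ENNReal.ofReal_mul (by positivity),
    ← ENNReal.ofReal_mul (by positivity), neg_neg, cap_neg_sqrt ha hc, cap_sqrt ha hb,
    ← mul_cap'_sqrt ha hc, ← mul_cap'_neg_sqrt ha hb]
  congr 1
  rw [show ∀ x y u v w e : ℝ, x * (y * (u * (v * w * e))) = x * (y * v) * (u * w) * e by
    intros; ring]
  congr 2
  ring

theorem ofReal_add_le_lintegral_limDens : ENNReal.ofReal (c1 + 2 * c2) ≤ ∫⁻ w, limDens w := by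
  rw [lintegral_limDens]
  refine ENNReal.ofReal_add_le.trans ?_
  rw [ENNReal.ofReal_mul (by norm_num), ENNReal.ofReal_ofNat]
  refine (add_le_add ofReal_c1_le (mul_le_mul_right ofReal_c2_le 2)).trans ?_
  rw [← lintegral_const_mul' _ _ (by norm_num)]
  refine (le_lintegral_add _ _).trans (lintegral_mono fun a ↦ ?_)
  refine le_trans (le_of_eq ?_) (mul_le_mul_right (le_lintegral_arcDens a) _)
  ring

theorem ae_ncard_le (n : ℕ) : ∀ᵐ x ∂conf n,
    {T : Set (Finset Pt) | IsOrderDT (range x) 1 T}.ncard ≤ 2 ^ (32 * n) := by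
  classical
  filter_upwards [ae_generic n] with x hx
  have hcoe : ((Finset.univ.image x : Finset Pt) : Set Pt) = range x := by simp
  have hcard : (Finset.univ.image x).card ≤ n := Finset.card_image_le.trans (by simp)
  rw [← hcoe]
  refine (ncard_le_two_pow (hcoe ▸ hx.2) ?_).trans
    (Nat.pow_le_pow_right two_pos (Nat.mul_le_mul_left _ hcard))
  rw [hcoe]
  rintro _ ⟨i, rfl⟩ _ ⟨j, rfl⟩ h
  rw [hx.1 h]

theorem ae_two_pow_numFlips_le {n : ℕ} (hn : 3 ≤ n) : ∀ᵐ x ∂conf n,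
    2 ^ numFlips x ≤ {T : Set (Finset Pt) | IsOrderDT (range x) 1 T}.ncard := by
  filter_upwards [ae_generic n] with x hx
  exact two_pow_numFlips_le hn (fun i j h ↦ hx.1 (congrArg (fun p : Pt ↦ p 0) h)) hx.2

theorem integrable_ncard (n : ℕ) : Integrable
    (fun x : Fin n → Pt ↦ ({T : Set (Finset Pt) | IsOrderDT (range x) 1 T}.ncard : ℝ))
    (conf n) := by
  refine .of_bound (aestronglyMeasurable_ncard n 1) (2 ^ (32 * n)) ?_
  filter_upwards [ae_ncard_le n] with x hx
  rw [Real.norm_natCast]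
  exact_mod_cast hx

theorem integral_ncard_le (n : ℕ) : ∫ x : Fin n → Pt,
    ({T : Set (Finset Pt) | IsOrderDT (range x) 1 T}.ncard : ℝ) ∂conf n ≤ 2 ^ (32 * n) := by
  refine (integral_mono_ae (integrable_ncard n) (integrable_const (2 ^ (32 * n) : ℝ)) ?_).trans_eq
    (by simp)
  filter_upwards [ae_ncard_le n] with x hx
  exact_mod_cast hx

theorem integrable_comp_numFlips (n : ℕ) (g : ℕ → ℝ) :
    Integrable (fun x : Fin n → Pt ↦ g (numFlips x)) (conf n) := by
  have hle : ∀ x : Fin n → Pt, numFlips x ∈ Finset.range (Fintype.card (Fin 4 ↪ Fin n) + 1) :=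
    fun x ↦ Finset.mem_range_succ_iff.2 (Finset.card_le_univ _)
  refine .of_bound (measurable_from_nat.comp (measurable_numFlips n)).aestronglyMeasurable
    (∑ k ∈ Finset.range (Fintype.card (Fin 4 ↪ Fin n) + 1), ‖g k‖) (.of_forall fun x ↦ ?_)
  exact Finset.single_le_sum (f := fun k ↦ ‖g k‖) (fun _ _ ↦ norm_nonneg _) (hle x)

/-- Jensen's inequality for the number of flips. -/
theorem integral_numFlips_le_logb {n : ℕ} (hn : 3 ≤ n) : ∫ x, (numFlips x : ℝ) ∂conf n ≤
    Real.logb 2 (∫ x : Fin n → Pt,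
      ({T : Set (Finset Pt) | IsOrderDT (range x) 1 T}.ncard : ℝ) ∂conf n) := by
  have hlog : 0 < Real.log 2 := Real.log_pos one_lt_two
  have hpow : ∀ k : ℕ, Real.exp (k * Real.log 2) = 2 ^ k := fun k ↦ by
    rw [Real.exp_nat_mul, Real.exp_log two_pos]
  have hJ := convexOn_exp.map_integral_le (μ := conf n) Real.continuous_exp.continuousOn
    isClosed_univ (.of_forall fun _ ↦ mem_univ _)
    (integrable_comp_numFlips n fun k ↦ k * Real.log 2)
    (integrable_comp_numFlips n fun k ↦ Real.exp (k * Real.log 2))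
  simp only [hpow, integral_mul_const] at hJ
  have hle := hJ.trans (integral_mono_ae (integrable_comp_numFlips n fun k ↦ (2 : ℝ) ^ k)
    (integrable_ncard n) ((ae_two_pow_numFlips_le hn).mono fun x hx ↦ by
      dsimp only; exact_mod_cast hx))
  rw [Real.logb, le_div_iff₀ hlog]
  exact (Real.le_log_iff_exp_le ((Real.exp_pos _).trans_le hle)).2 hle

theorem ofReal_integral_numFlips (n : ℕ) : ENNReal.ofReal (∫ x, (numFlips x : ℝ) ∂conf n) =
    ∫⁻ x, (numFlips x : ENNReal) ∂conf n := by
  rw [ofReal_integral_eq_lintegral_ofReal (integrable_comp_numFlips n fun k ↦ k)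
    (.of_forall fun _ ↦ Nat.cast_nonneg _)]
  simp only [ENNReal.ofReal_natCast]

end

open MeasureTheory Filter in
/-- Theorem 4.3: for `n` independent uniform points in the unit square, the expected
number `E[N₁(n)]` of order-1 Delaunay triangulations satisfies
`liminf (log₂ E[N₁(n)]) / n ≥ ρ₁ = (c₁ + 2c₂)/2 ≈ 0.525785`. -/
theorem expected_order_one_triangulations_lower_bound :
    (c1 + 2 * c2) / 2 ≤
      Filter.liminf
        (fun n : ℕ =>
          Real.logb 2
            (∫ x : Fin n → Pt,
              (({T : Set (Finset Pt) | IsOrderDT (Set.range x) 1 T}.ncard : ℝ)) ∂(conf n))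
            / n)
        atTop := by
  refine le_of_forall_lt fun r hr ↦ ?_
  obtain ⟨R, hrR, hR⟩ := exists_between hr
  refine hrR.trans_le (le_liminf_of_le ?_ ?_)
  · refine (isBoundedUnder_of_eventually_le (a := 32) ?_).isCoboundedUnder_ge
    filter_upwards [eventually_ge_atTop 3] with n hn
    have hn0 : (0 : ℝ) < n := by positivity
    have h1 : (1 : ℝ) ≤ ∫ x : Fin n → Pt,
        ({T : Set (Finset Pt) | IsOrderDT (range x) 1 T}.ncard : ℝ) ∂conf n := by
      have h : ∫ _ : Fin n → Pt, (1 : ℝ) ∂conf n = 1 := by simp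
      rw [← h]
      refine integral_mono_ae (integrable_const _) (integrable_ncard n) ?_
      filter_upwards [ae_two_pow_numFlips_le hn] with x hx
      exact_mod_cast Nat.one_le_two_pow.trans hx
    rw [div_le_iff₀ hn0, Real.logb_le_iff_le_rpow one_lt_two (by linarith)]
    exact (integral_ncard_le n).trans_eq (by rw [← Real.rpow_natCast]; push_cast; rfl)
  · have hkey : ∀ᶠ n : ℕ in atTop, R ≤ (∫ x, (numFlips x : ℝ) ∂conf n) / n := by
      rcases le_or_gt R 0 with hR0 | hR0
      · refine .of_forall fun n ↦ hR0.trans (div_nonneg ?_ n.cast_nonneg)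
        exact integral_nonneg fun x ↦ Nat.cast_nonneg _
      · have h1 : ENNReal.ofReal R < 2⁻¹ * ∫⁻ w, limDens w := by
          calc ENNReal.ofReal R < ENNReal.ofReal ((c1 + 2 * c2) / 2) :=
                (ENNReal.ofReal_lt_ofReal_iff (hR0.trans hR)).2 hR
            _ = 2⁻¹ * ENNReal.ofReal (c1 + 2 * c2) := by
                rw [ENNReal.ofReal_div_of_pos two_pos, ENNReal.ofReal_ofNat,
                  div_eq_mul_inv, mul_comm (2⁻¹ : ENNReal)]
            _ ≤ _ := mul_le_mul_right ofReal_add_le_lintegral_limDens _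
        filter_upwards [eventually_lt_of_lt_liminf (h1.trans_le le_liminf_lintegral_numFlips),
          eventually_gt_atTop 0] with n hn hn0
        have hn0 : (0 : ℝ) < n := by exact_mod_cast hn0
        rw [← ofReal_integral_numFlips, ← ENNReal.ofReal_natCast,
          ← ENNReal.ofReal_div_of_pos hn0] at hn
        exact (ENNReal.ofReal_lt_ofReal_iff_of_nonneg hR0.le).1 hn |>.le
    filter_upwards [hkey, eventually_ge_atTop 3] with n hn hn3
    exact hn.trans (div_le_div_of_nonneg_right (integral_numFlips_le_logb hn3) n.cast_nonneg)

end
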